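/- Let n ≥ 2 and M ≥ 1. Then there exists a constant C > 0, depending only on n and M, with the following property: for every map Φ : ℝⁿ → ℝⁿ satisfying M⁻¹‖x − y‖ ≤ ‖Φ(x) − Φ(y)‖ ≤ M‖x − y‖ for all x, y in the open unit cube Q = (0,1)ⁿ, setting U := Φ(Q), and for every differentiable map u : U → ℝⁿ, there exists a rotation R ∈ SO(n) such that ∫_U ‖Du(x) − R‖² dx ≤ C ∫_U dist²(Du(x), SO(n)) dx (geometric rigidity with a constant uniform over bilipschitz images of a cube with uniform bilipschitz constants). -/

import Mathlib

open MeasureTheory Set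

noncomputable section

/-- The special orthogonal group `SO(n)` as a set of `n × n` real matrices. -/
def SOn (n : ℕ) : Set (Matrix (Fin n) (Fin n) ℝ) :=
  {R : Matrix (Fin n) (Fin n) ℝ | R.transpose * R = 1 ∧ R.det = 1}

/-- The Frobenius norm of an `n × n` real matrix. -/
def frobn {n : ℕ} (F : Matrix (Fin n) (Fin n) ℝ) : ℝ :=
  Real.sqrt (∑ i, ∑ j, (F i j) ^ 2)

/-- The Frobenius distance from a matrix to `SO(n)`. -/
def distSOn {n : ℕ} (F : Matrix (Fin n) (Fin n) ℝ) : ℝ :=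
  sInf ((fun R => frobn (F - R)) '' SOn n)

/-- The Euclidean norm on `ℝⁿ`. -/
def enormn {n : ℕ} (x : Fin n → ℝ) : ℝ := Real.sqrt (∑ i, (x i) ^ 2)

/-- The derivative of `u` within `U` at `x`, viewed as an `n × n` matrix. -/
def DuMat {n : ℕ} (u : (Fin n → ℝ) → Fin n → ℝ) (U : Set (Fin n → ℝ))
    (x : Fin n → ℝ) : Matrix (Fin n) (Fin n) ℝ :=
  Matrix.of fun i j => fderivWithin ℝ u U x (Pi.single j 1) i

namespace GR

variable {n : ℕ}

section matrices
attribute [local instance] Matrix.frobeniusNormedAddCommGroup Matrix.frobeniusNormedSpace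
  Matrix.frobeniusNormedRing

lemma frobn_eq_norm (F : Matrix (Fin n) (Fin n) ℝ) : frobn F = ‖F‖ := by
  rw [Matrix.frobenius_norm_def, frobn, Real.sqrt_eq_rpow]
  simp

lemma frobn_nonneg (F : Matrix (Fin n) (Fin n) ℝ) : 0 ≤ frobn F := Real.sqrt_nonneg _

lemma frobn_sq (F : Matrix (Fin n) (Fin n) ℝ) : frobn F ^ 2 = ∑ i, ∑ j, (F i j) ^ 2 :=
  Real.sq_sqrt (Finset.sum_nonneg fun _ _ => Finset.sum_nonneg fun _ _ => sq_nonneg _)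

lemma frobn_add_le (F G : Matrix (Fin n) (Fin n) ℝ) : frobn (F + G) ≤ frobn F + frobn G := by
  simp only [frobn_eq_norm]; exact norm_add_le _ _

lemma frobn_sub_le (F G : Matrix (Fin n) (Fin n) ℝ) : frobn (F - G) ≤ frobn F + frobn G := by
  simp only [frobn_eq_norm]; exact norm_sub_le _ _

lemma frobn_sub_comm (F G : Matrix (Fin n) (Fin n) ℝ) : frobn (F - G) = frobn (G - F) := by
  simp only [frobn_eq_norm]; exact norm_sub_rev _ _

lemma frobn_tri (F G H : Matrix (Fin n) (Fin n) ℝ) :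
    frobn (F - H) ≤ frobn (F - G) + frobn (G - H) := by
  simp only [frobn_eq_norm]; exact norm_sub_le_norm_sub_add_norm_sub _ _ _

lemma frobn_tri_sq (F G H : Matrix (Fin n) (Fin n) ℝ) :
    frobn (F - H) ^ 2 ≤ 2 * frobn (F - G) ^ 2 + 2 * frobn (G - H) ^ 2 := by
  have := frobn_tri F G H
  nlinarith [frobn_nonneg (F - H), frobn_nonneg (F - G), frobn_nonneg (G - H),
    sq_nonneg (frobn (F - G) - frobn (G - H))]

lemma frobn_mul_le (F G : Matrix (Fin n) (Fin n) ℝ) : frobn (F * G) ≤ frobn F * frobn G := by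
  simp only [frobn_eq_norm]; exact norm_mul_le _ _

lemma frobn_transpose (F : Matrix (Fin n) (Fin n) ℝ) : frobn F.transpose = frobn F := by
  rw [frobn, frobn, Finset.sum_comm]; rfl

lemma abs_entry_le (F : Matrix (Fin n) (Fin n) ℝ) (i j : Fin n) : |F i j| ≤ frobn F := by
  refine abs_le_of_sq_le_sq ?_ (frobn_nonneg F)
  rw [frobn_sq]
  calc F i j ^ 2 ≤ ∑ j, F i j ^ 2 :=
        Finset.single_le_sum (f := fun j => F i j ^ 2) (fun _ _ => sq_nonneg _) (Finset.mem_univ j)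
    _ ≤ _ := Finset.single_le_sum (f := fun i => ∑ j, F i j ^ 2)
        (fun _ _ => Finset.sum_nonneg fun _ _ => sq_nonneg _) (Finset.mem_univ i)

lemma frobn_le_of_entry (F : Matrix (Fin n) (Fin n) ℝ) {c : ℝ} (hc : 0 ≤ c)
    (h : ∀ i j, |F i j| ≤ c) : frobn F ≤ n * c := by
  refine le_of_sq_le_sq ?_ (by positivity)
  rw [frobn_sq]
  calc ∑ i, ∑ j, F i j ^ 2 ≤ ∑ _i : Fin n, ∑ _j : Fin n, c ^ 2 := by
        refine Finset.sum_le_sum fun i _ => Finset.sum_le_sum fun j _ => ?_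
        rw [← sq_abs]; gcongr; exact h i j
    _ = (n * c) ^ 2 := by simp; ring

lemma continuous_frobn : Continuous (frobn : Matrix (Fin n) (Fin n) ℝ → ℝ) := by
  unfold frobn; fun_prop

lemma one_mem : (1 : Matrix (Fin n) (Fin n) ℝ) ∈ SOn n := by simp [SOn]

lemma SOn_mul_transpose {R : Matrix (Fin n) (Fin n) ℝ} (h : R ∈ SOn n) : R * R.transpose = 1 :=
  mul_eq_one_comm.1 h.1

lemma SOn_transpose {R : Matrix (Fin n) (Fin n) ℝ} (h : R ∈ SOn n) : R.transpose ∈ SOn n :=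
  ⟨by simpa using SOn_mul_transpose h, by simpa using h.2⟩

lemma SOn_mul {R S : Matrix (Fin n) (Fin n) ℝ} (h : R ∈ SOn n) (h' : S ∈ SOn n) :
    R * S ∈ SOn n :=
  ⟨by rw [Matrix.transpose_mul, Matrix.mul_assoc, ← Matrix.mul_assoc _ R, h.1, Matrix.one_mul, h'.1],
   by rw [Matrix.det_mul, h.2, h'.2, one_mul]⟩

lemma frobn_sq_trace (F : Matrix (Fin n) (Fin n) ℝ) :
    frobn F ^ 2 = (F.transpose * F).trace := by
  rw [frobn_sq, Finset.sum_comm]; simp [Matrix.trace, Matrix.mul_apply, sq]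

lemma frobn_SOn_mul {R : Matrix (Fin n) (Fin n) ℝ} (h : R ∈ SOn n)
    (F : Matrix (Fin n) (Fin n) ℝ) : frobn (R * F) = frobn F := by
  have : frobn (R * F) ^ 2 = frobn F ^ 2 := by
    rw [frobn_sq_trace, frobn_sq_trace, Matrix.transpose_mul, Matrix.mul_assoc,
      ← Matrix.mul_assoc _ R, h.1, Matrix.one_mul]
  exact (sq_eq_sq₀ (frobn_nonneg _) (frobn_nonneg _)).1 this

lemma frobn_SOn_sq {R : Matrix (Fin n) (Fin n) ℝ} (h : R ∈ SOn n) : frobn R ^ 2 = n := by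
  rw [frobn_sq_trace, h.1]; simp

lemma frobn_SOn_le {R : Matrix (Fin n) (Fin n) ℝ} (h : R ∈ SOn n) : frobn R ≤ n := by
  have h1 := frobn_SOn_sq h
  have h2 : (n : ℝ) ≤ (n : ℝ) ^ 2 := by exact_mod_cast Nat.le_self_pow (by norm_num) n
  nlinarith [frobn_nonneg R]

lemma isCompact_SOn : IsCompact (SOn n) := by
  apply Metric.isCompact_of_isClosed_isBounded
  · have h1 : IsClosed {R : Matrix (Fin n) (Fin n) ℝ | R.transpose * R = 1} :=
      isClosed_eq (by fun_prop) continuous_const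
    have h2 : IsClosed {R : Matrix (Fin n) (Fin n) ℝ | R.det = 1} :=
      isClosed_eq (by fun_prop) continuous_const
    exact h1.inter h2
  · apply (Metric.isBounded_closedBall (x := (0 : Matrix (Fin n) (Fin n) ℝ)) (r := n)).subset
    intro R hR
    simpa [← frobn_eq_norm] using frobn_SOn_le hR

lemma dist_bdd (F : Matrix (Fin n) (Fin n) ℝ) :
    BddBelow ((fun R => frobn (F - R)) '' SOn n) :=
  ⟨0, by rintro _ ⟨R, _, rfl⟩; exact frobn_nonneg _⟩

lemma dist_le (F : Matrix (Fin n) (Fin n) ℝ) {R : Matrix (Fin n) (Fin n) ℝ} (h : R ∈ SOn n) :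
    distSOn F ≤ frobn (F - R) := csInf_le (dist_bdd F) ⟨R, h, rfl⟩

lemma exists_dist (F : Matrix (Fin n) (Fin n) ℝ) :
    ∃ R ∈ SOn n, distSOn F = frobn (F - R) := by
  have hc : Continuous (fun R : Matrix (Fin n) (Fin n) ℝ => frobn (F - R)) :=
    continuous_frobn.comp (continuous_const.sub continuous_id)
  obtain ⟨R, hR, h⟩ := isCompact_SOn.exists_sInf_image_eq ⟨1, one_mem⟩ hc.continuousOn
  exact ⟨R, hR, h⟩

lemma dist_nonneg (F : Matrix (Fin n) (Fin n) ℝ) : 0 ≤ distSOn F := by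
  obtain ⟨R, _, h⟩ := exists_dist F
  rw [h]; exact frobn_nonneg _

lemma dist_lip (F G : Matrix (Fin n) (Fin n) ℝ) : distSOn F ≤ distSOn G + frobn (F - G) := by
  obtain ⟨R, hR, h⟩ := exists_dist G
  rw [h, add_comm]
  exact (dist_le F hR).trans (frobn_tri _ _ _)

lemma continuous_dist : Continuous (distSOn : Matrix (Fin n) (Fin n) ℝ → ℝ) := by
  have : LipschitzWith 1 (distSOn : Matrix (Fin n) (Fin n) ℝ → ℝ) := by
    apply LipschitzWith.of_le_add
    intro F G
    rw [dist_eq_norm, ← frobn_eq_norm]; exact dist_lip F G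
  exact this.continuous

lemma frobn_le_dist (F : Matrix (Fin n) (Fin n) ℝ) : frobn F ≤ n + distSOn F := by
  obtain ⟨R, hR, h⟩ := exists_dist F
  have := frobn_add_le R (F - R)
  rw [add_sub_cancel] at this
  linarith [frobn_SOn_le hR]

lemma adjugate_SOn {R : Matrix (Fin n) (Fin n) ℝ} (h : R ∈ SOn n) :
    R.adjugate = R.transpose := by
  have h1 : R.adjugate * R = 1 := by rw [Matrix.adjugate_mul, h.2, one_smul]
  calc R.adjugate = R.adjugate * (R * R.transpose) := by rw [SOn_mul_transpose h, Matrix.mul_one]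
    _ = _ := by rw [← Matrix.mul_assoc, h1, Matrix.one_mul]

lemma contDiff_adj (i j : Fin n) :
    ContDiff ℝ 1 (fun F : Matrix (Fin n) (Fin n) ℝ => F.adjugate i j) := by
  simp only [Matrix.adjugate_apply, Matrix.det_apply]
  apply ContDiff.sum; intro σ _
  apply ContDiff.const_smul
  apply contDiff_prod; intro k _
  by_cases hk : σ k = j
  · have : (fun F : Matrix (Fin n) (Fin n) ℝ => F.updateRow j (Pi.single i 1) (σ k) k)
        = fun _ => (Pi.single i 1 : Fin n → ℝ) k := by
      ext F; rw [hk, Matrix.updateRow_self]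
    rw [this]; exact contDiff_const
  · have : (fun F : Matrix (Fin n) (Fin n) ℝ => F.updateRow j (Pi.single i 1) (σ k) k)
        = fun F => F (σ k) k := by
      ext F; rw [Matrix.updateRow_ne hk]
    rw [this]
    exact ((LinearMap.toContinuousLinearMap
      (Matrix.entryLinearMap ℝ ℝ (σ k) k : Matrix (Fin n) (Fin n) ℝ →ₗ[ℝ] ℝ))).contDiff

lemma adj_lip (L : ℝ) : ∃ C : ℝ, 0 ≤ C ∧ ∀ F G : Matrix (Fin n) (Fin n) ℝ, frobn F ≤ L →
    frobn G ≤ L → frobn (F.adjugate - G.adjugate) ≤ C * frobn (F - G) := by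
  have key : ∀ i j : Fin n, ∃ K : NNReal, LipschitzOnWith K
      (fun F : Matrix (Fin n) (Fin n) ℝ => F.adjugate i j)
      (Metric.closedBall (0 : Matrix (Fin n) (Fin n) ℝ) L) := fun i j =>
    (contDiff_adj i j).contDiffOn.exists_lipschitzOnWith (by norm_num) (convex_closedBall _ _)
      (isCompact_closedBall _ _)
  choose K hK using key
  refine ⟨n * ∑ i, ∑ j, (K i j : ℝ), by positivity, fun F G hF hG => ?_⟩
  rw [mul_assoc]
  apply frobn_le_of_entry _ (mul_nonneg (by positivity) (frobn_nonneg _))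
  intro i j
  have h1 := (hK i j).dist_le_mul F (by simpa [← frobn_eq_norm] using hF) G
    (by simpa [← frobn_eq_norm] using hG)
  rw [Real.dist_eq, dist_eq_norm, ← frobn_eq_norm] at h1
  rw [Matrix.sub_apply]
  refine h1.trans ?_
  gcongr
  · exact frobn_nonneg _
  · calc (K i j : ℝ) ≤ ∑ j, (K i j : ℝ) :=
        Finset.single_le_sum (f := fun j => (K i j : ℝ)) (fun _ _ => NNReal.coe_nonneg _) (Finset.mem_univ j)
    _ ≤ _ := Finset.single_le_sum (f := fun i => ∑ j, (K i j : ℝ))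
        (fun _ _ => Finset.sum_nonneg fun _ _ => NNReal.coe_nonneg _) (Finset.mem_univ i)

/-- On bounded sets, the cofactor matrix differs from the matrix by at most `C dist`. -/
lemma adj_sub_le (L : ℝ) : ∃ C : ℝ, 0 ≤ C ∧ ∀ F : Matrix (Fin n) (Fin n) ℝ, frobn F ≤ L →
    frobn (F - F.adjugate.transpose) ≤ C * distSOn F := by
  obtain ⟨C, hC, h⟩ := adj_lip (n := n) (max L n)
  refine ⟨1 + C, by positivity, fun F hF => ?_⟩
  obtain ⟨R, hR, hd⟩ := exists_dist F
  have h1 := h F R (hF.trans (le_max_left _ _)) ((frobn_SOn_le hR).trans (le_max_right _ _))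
  have h2 := frobn_tri F R F.adjugate.transpose
  have h3 : frobn (R - F.adjugate.transpose) = frobn (F.adjugate - R.adjugate) := by
    rw [adjugate_SOn hR, frobn_sub_comm, ← frobn_transpose (F.adjugate - _)]; simp
  rw [hd]; linarith

lemma sym_est (F R : Matrix (Fin n) (Fin n) ℝ) (hR : R ∈ SOn n) :
    frobn ((1/2 : ℝ) • (R.transpose * F + (R.transpose * F).transpose) - 1)
      ≤ distSOn F + distSOn F ^ 2 + frobn (F - R) ^ 2 := by
  obtain ⟨Q, hQ, hd⟩ := exists_dist F
  set G := R.transpose * F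
  set P := R.transpose * Q
  have hP : P ∈ SOn n := SOn_mul (SOn_transpose hR) hQ
  have h1 : frobn (G - P) = distSOn F := by
    rw [hd, ← Matrix.mul_sub, frobn_SOn_mul (SOn_transpose hR)]
  have h2 : frobn (G - 1) = frobn (F - R) := by
    rw [← hR.1, ← Matrix.mul_sub, frobn_SOn_mul (SOn_transpose hR)]
  have e1 : (1/2 : ℝ) • (G + G.transpose) - 1
      = (1/2 : ℝ) • ((G - P) + (G - P).transpose) - (1/2 : ℝ) • ((P - 1).transpose * (P - 1)) := by
    have : (P - 1).transpose * (P - 1) = 1 - P.transpose - P + 1 := by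
      rw [Matrix.transpose_sub, Matrix.transpose_one, Matrix.sub_mul, Matrix.mul_sub, hP.1]
      simp; abel
    rw [this, Matrix.transpose_sub]
    module
  have h3 : frobn (P - 1) ≤ distSOn F + frobn (F - R) := by
    rw [← h1, ← h2, frobn_sub_comm G P]; exact frobn_tri _ _ _
  have hs : ∀ X : Matrix (Fin n) (Fin n) ℝ, frobn ((1/2 : ℝ) • X) = 1/2 * frobn X := by
    intro X; simp only [frobn_eq_norm, norm_smul]; norm_num
  rw [e1]
  refine (frobn_sub_le _ _).trans ?_
  rw [hs, hs]
  have h4 := frobn_add_le (G - P) (G - P).transpose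
  rw [frobn_transpose, h1] at h4
  have h5 := frobn_mul_le (P - 1).transpose (P - 1)
  rw [frobn_transpose] at h5
  have h6 : frobn (P - 1) * frobn (P - 1) ≤ (distSOn F + frobn (F - R)) * (distSOn F + frobn (F - R)) :=
    mul_self_le_mul_self (frobn_nonneg _) h3
  nlinarith [sq_nonneg (distSOn F - frobn (F - R))]

lemma contDiff_det : ContDiff ℝ 1 (fun F : Matrix (Fin n) (Fin n) ℝ => F.det) := by
  simp only [Matrix.det_apply]
  apply ContDiff.sum; intro σ _
  apply ContDiff.const_smul
  apply contDiff_prod; intro i _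
  exact ((LinearMap.toContinuousLinearMap
    (Matrix.entryLinearMap ℝ ℝ (σ i) i : Matrix (Fin n) (Fin n) ℝ →ₗ[ℝ] ℝ))).contDiff

end matrices
end GR

namespace GR
variable {n : ℕ}

/-- Partial derivative. -/
def pd (f : (Fin n → ℝ) → ℝ) (j : Fin n) (x : Fin n → ℝ) : ℝ := fderiv ℝ f x (Pi.single j 1)

lemma pd_contDiff {f : (Fin n → ℝ) → ℝ} {m k : ℕ∞} (hf : ContDiff ℝ m f) (h : k + 1 ≤ m) (j : Fin n) :
    ContDiff ℝ k (pd f j) := by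
  unfold pd
  exact (hf.fderiv_right (by exact_mod_cast h)).clm_apply contDiff_const

lemma pd_comm {f : (Fin n → ℝ) → ℝ} (hf : ContDiff ℝ 2 f) (j k : Fin n) (x : Fin n → ℝ) :
    pd (pd f j) k x = pd (pd f k) j x := by
  have h1 : DifferentiableAt ℝ (fderiv ℝ f) x :=
    (hf.fderiv_right (m := 1) (by norm_num)).differentiable (by norm_num) x
  have h2 : ∀ j k : Fin n, pd (pd f j) k x
      = fderiv ℝ (fderiv ℝ f) x (Pi.single k 1) (Pi.single j 1) := by
    intro j k
    unfold pd
    rw [fderiv_clm_apply h1 (by fun_prop)]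
    simp
  rw [h2, h2]
  exact (hf.contDiffAt.isSymmSndFDerivAt (by simp)) _ _

lemma integrable_of_cc {f : (Fin n → ℝ) → ℝ} (hf : Continuous f) (h : HasCompactSupport f) :
    Integrable f := hf.integrable_of_hasCompactSupport h

/-- Integration by parts against a compactly supported function. -/
lemma ibp_cc {f g : (Fin n → ℝ) → ℝ} (hf : ContDiff ℝ 1 f) (hg : ContDiff ℝ 1 g)
    (hc : HasCompactSupport g) (j : Fin n) :
    ∫ x, pd g j x * f x = - ∫ x, g x * pd f j x := by
  have hpf : Continuous (pd f j) := (pd_contDiff (m := 1) (k := 0) hf (by simp) j).continuous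
  have hpg : Continuous (pd g j) := (pd_contDiff (m := 1) (k := 0) hg (by simp) j).continuous
  have hcp : HasCompactSupport (pd g j) := hc.fderiv_apply ℝ _
  have := integral_mul_fderiv_eq_neg_fderiv_mul_of_integrable (μ := volume) (f := f) (g := g)
    (v := Pi.single j (1:ℝ)) (integrable_of_cc (hpf.mul hg.continuous) hc.mul_left)
    (integrable_of_cc (hf.continuous.mul hpg) hcp.mul_left)
    (integrable_of_cc (hf.continuous.mul hg.continuous) hc.mul_left)
    (fun x _ => hf.differentiable (by norm_num) x) (fun x _ => hg.differentiable (by norm_num) x)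
  simp only [pd]
  rw [show (fun x => fderiv ℝ g x (Pi.single j 1) * f x)
    = fun x => f x * fderiv ℝ g x (Pi.single j 1) from funext fun x => mul_comm _ _, this]
  congr 1; congr 1; ext x; ring

lemma pd_prod {ι : Type*} [DecidableEq ι] (s : Finset ι) (F : ι → (Fin n → ℝ) → ℝ)
    (hF : ∀ i, ContDiff ℝ 1 (F i)) (j : Fin n) (x : Fin n → ℝ) :
    pd (fun y => ∏ i ∈ s, F i y) j x = ∑ k ∈ s, (∏ i ∈ s.erase k, F i x) * pd (F k) j x := by
  unfold pd
  rw [fderiv_finsetProd (fun i _ => (hF i).differentiable (by norm_num) x)]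
  simp

/-- Jacobian matrix. -/
def Dm (g : Fin n → (Fin n → ℝ) → ℝ) (x : Fin n → ℝ) : Matrix (Fin n) (Fin n) ℝ :=
  Matrix.of fun i j => pd (g i) j x

lemma det_rows (A : Matrix (Fin n) (Fin n) ℝ) :
    A.det = ∑ σ : Equiv.Perm (Fin n), ((Equiv.Perm.sign σ : ℤ) : ℝ) * ∏ i, A i (σ i) := by
  rw [← Matrix.det_transpose, Matrix.det_apply']; rfl

lemma piola_smooth (g : Fin n → (Fin n → ℝ) → ℝ) (hg : ∀ i, ContDiff ℝ 2 (g i)) (i0 : Fin n)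
    (hc : HasCompactSupport (g i0)) : ∫ x, (Dm g x).det = 0 := by
  classical
  have hp1 : ∀ i j, ContDiff ℝ 1 (pd (g i) j) := fun i j =>
    pd_contDiff (m := 2) (k := 1) (hg i) (by norm_num) j
  set P : Equiv.Perm (Fin n) → (Fin n → ℝ) → ℝ := fun σ x =>
    ∏ i ∈ Finset.univ.erase i0, pd (g i) (σ i) x with hP
  have hPc : ∀ σ, ContDiff ℝ 1 (P σ) := fun σ => contDiff_prod fun i _ => hp1 i _
  have hg1 : ContDiff ℝ 1 (g i0) := (hg i0).of_le (by norm_num)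
  have hcp : ∀ j, HasCompactSupport (pd (g i0) j) := fun j => hc.fderiv_apply ℝ _
  have hcanc : ∀ x, ∑ σ : Equiv.Perm (Fin n), ((Equiv.Perm.sign σ : ℤ) : ℝ) * pd (P σ) (σ i0) x = 0 := by
    intro x
    simp only [hP]
    simp_rw [pd_prod _ _ (fun i => hp1 i _), Finset.mul_sum]
    rw [Finset.sum_comm]
    refine Finset.sum_eq_zero fun k hk => ?_
    have hk : k ≠ i0 := (Finset.mem_erase.1 hk).1
    set T : Equiv.Perm (Fin n) → ℝ := fun σ => ((Equiv.Perm.sign σ : ℤ) : ℝ) *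
      ((∏ i ∈ (Finset.univ.erase i0).erase k, pd (g i) (σ i) x) * pd (pd (g k) (σ k)) (σ i0) x)
    have h1 : ∑ σ, T σ = ∑ σ, T (σ * Equiv.swap i0 k) :=
      (Equiv.sum_comp (Equiv.mulRight (Equiv.swap i0 k)) T).symm
    have h2 : ∀ σ, T (σ * Equiv.swap i0 k) = - T σ := by
      intro σ
      simp only [T, Equiv.Perm.sign_mul, Equiv.Perm.sign_swap hk.symm]
      have e1 : ∏ i ∈ (Finset.univ.erase i0).erase k, pd (g i) ((σ * Equiv.swap i0 k) i) x
          = ∏ i ∈ (Finset.univ.erase i0).erase k, pd (g i) (σ i) x := by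
        refine Finset.prod_congr rfl fun i hi => ?_
        have hi1 : i ≠ k := (Finset.mem_erase.1 hi).1
        have hi2 : i ≠ i0 := (Finset.mem_erase.1 (Finset.mem_erase.1 hi).2).1
        rw [Equiv.Perm.mul_apply, Equiv.swap_apply_of_ne_of_ne hi2 hi1]
      rw [e1, Equiv.Perm.mul_apply, Equiv.Perm.mul_apply, Equiv.swap_apply_left,
        Equiv.swap_apply_right, pd_comm (hg k)]
      push_cast; ring
    simp only [h2, Finset.sum_neg_distrib] at h1
    have : ∑ σ, T σ = 0 := by linarith
    exact this
  have hintg : ∀ σ, Integrable (fun x => pd (g i0) (σ i0) x * P σ x) := fun σ =>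
    integrable_of_cc ((hp1 _ _).continuous.mul (hPc σ).continuous) (hcp _).mul_right
  have hint2 : ∀ σ, Integrable (fun x => g i0 x * pd (P σ) (σ i0) x) := fun σ =>
    integrable_of_cc (hg1.continuous.mul
      (pd_contDiff (m := 1) (k := 0) (hPc σ) (by simp) _).continuous) hc.mul_right
  calc ∫ x, (Dm g x).det
      = ∫ x, ∑ σ : Equiv.Perm (Fin n), ((Equiv.Perm.sign σ : ℤ) : ℝ) *
          (pd (g i0) (σ i0) x * P σ x) := by
        congr 1; ext x
        rw [det_rows]
        refine Finset.sum_congr rfl fun σ _ => ?_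
        rw [← Finset.mul_prod_erase _ _ (Finset.mem_univ i0)]; rfl
    _ = ∑ σ : Equiv.Perm (Fin n), ((Equiv.Perm.sign σ : ℤ) : ℝ) *
          ∫ x, pd (g i0) (σ i0) x * P σ x := by
        rw [integral_finsetSum _ fun σ _ => (hintg σ).const_mul _]
        simp_rw [integral_const_mul]
    _ = - ∫ x, g i0 x * ∑ σ : Equiv.Perm (Fin n), ((Equiv.Perm.sign σ : ℤ) : ℝ) *
          pd (P σ) (σ i0) x := by
        simp_rw [ibp_cc (hPc _) hg1 hc, Finset.mul_sum]
        rw [integral_finsetSum _ fun σ _ => ?_, ← Finset.sum_neg_distrib]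
        · refine Finset.sum_congr rfl fun σ _ => ?_
          rw [mul_neg, ← integral_const_mul]
          congr 2; ext x; ring
        · exact ((hint2 σ).const_mul ((Equiv.Perm.sign σ : ℤ) : ℝ)).congr
            (ae_of_all _ fun x => mul_left_comm _ _ _)
    _ = 0 := by simp [hcanc]

lemma pd_le_lip {f : (Fin n → ℝ) → ℝ} {K : NNReal} (hf : LipschitzWith K f) (j : Fin n)
    (x : Fin n → ℝ) : |pd f j x| ≤ K := by
  have h1 := (fderiv ℝ f x).le_opNorm (Pi.single j 1)
  have h2 : ‖fderiv ℝ f x‖ ≤ K := norm_fderiv_le_of_lipschitz ℝ hf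
  have h3 : ‖(Pi.single j (1:ℝ) : Fin n → ℝ)‖ = 1 := by rw [Pi.norm_single, norm_one]
  rw [h3, mul_one] at h1
  exact h1.trans h2

lemma measurable_pd (f : (Fin n → ℝ) → ℝ) (j : Fin n) : Measurable (pd f j) :=
  measurable_fderiv_apply_const ℝ f _

lemma locInt_pd {f : (Fin n → ℝ) → ℝ} {K : NNReal} (hf : LipschitzWith K f) (j : Fin n) :
    LocallyIntegrable (pd f j) := by
  have : LocallyIntegrable (fun _ : Fin n → ℝ => (K : ℝ)) := locallyIntegrable_const _
  exact this.mono (measurable_pd f j).aestronglyMeasurable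
    (ae_of_all _ fun x => by simpa using pd_le_lip hf j x)

open ContinuousLinearMap Convolution

/-- Mollification. -/
def mo (φ : ContDiffBump (0 : Fin n → ℝ)) (f : (Fin n → ℝ) → ℝ) : (Fin n → ℝ) → ℝ :=
  (φ.normed volume) ⋆[lsmul ℝ ℝ, volume] f

lemma mo_apply (φ : ContDiffBump (0 : Fin n → ℝ)) (f : (Fin n → ℝ) → ℝ) (x : Fin n → ℝ) :
    mo φ f x = ∫ t, φ.normed volume t * f (x - t) := rfl

lemma mo_contDiff (φ : ContDiffBump (0 : Fin n → ℝ)) {f : (Fin n → ℝ) → ℝ}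
    (hf : LocallyIntegrable f) {m : ℕ∞} : ContDiff ℝ m (mo φ f) :=
  φ.hasCompactSupport_normed.contDiff_convolution_left _ φ.contDiff_normed hf

lemma mo_bound (φ : ContDiffBump (0 : Fin n → ℝ)) {f : (Fin n → ℝ) → ℝ} {K : ℝ}
    (h : ∀ x, |f x| ≤ K) (x : Fin n → ℝ) : |mo φ f x| ≤ K := by
  have hK : 0 ≤ K := (abs_nonneg _).trans (h 0)
  rw [mo_apply]
  calc |∫ t, φ.normed volume t * f (x - t)| ≤ ∫ t, φ.normed volume t * K := by
        rw [← Real.norm_eq_abs]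
        apply norm_integral_le_of_norm_le (φ.integrable_normed.mul_const _)
        refine ae_of_all _ fun t => ?_
        rw [norm_mul, Real.norm_of_nonneg (φ.nonneg_normed t)]
        exact mul_le_mul_of_nonneg_left (h _) (φ.nonneg_normed t)
    _ = K := by rw [integral_mul_const, φ.integral_normed, one_mul]

lemma pd_mo (φ : ContDiffBump (0 : Fin n → ℝ)) {f : (Fin n → ℝ) → ℝ} {K : NNReal}
    (hf : LipschitzWith K f) (j : Fin n) (x : Fin n → ℝ) :
    pd (mo φ f) j x = mo φ (pd f j) x := by
  have hae : ∀ᵐ t : Fin n → ℝ, DifferentiableAt ℝ f (x - t) := by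
    have h1 := hf.ae_differentiableAt (μ := (volume : Measure (Fin n → ℝ)))
    exact (Measure.measurePreserving_sub_left volume x).quasiMeasurePreserving.ae h1
  have hm : Measurable (fun t => φ.normed volume t • fderiv ℝ f (x - t)) :=
    (φ.continuous_normed.measurable).smul
      ((measurable_fderiv ℝ f).comp (measurable_const.sub measurable_id))
  have key := hasFDerivAt_integral_of_dominated_loc_of_lip (μ := volume) (𝕜 := ℝ) (s := univ)
    (F := fun x t => φ.normed volume t * f (x - t)) (x₀ := x)
    (F' := fun t => φ.normed volume t • fderiv ℝ f (x - t))
    (bound := fun t => φ.normed volume t * K) Filter.univ_mem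
    (Filter.Eventually.of_forall fun y =>
      (φ.continuous_normed.mul (hf.continuous.comp (by fun_prop))).aestronglyMeasurable)
    (integrable_of_cc (φ.continuous_normed.mul (hf.continuous.comp (by fun_prop)))
      φ.hasCompactSupport_normed.mul_right)
    hm.aestronglyMeasurable
    (ae_of_all _ fun t => by
      apply LipschitzOnWith.of_dist_le_mul
      intro a _ b _
      have h1 := hf.dist_le_mul (a - t) (b - t)
      rw [dist_sub_right] at h1
      rw [Real.dist_eq, ← mul_sub, abs_mul, abs_of_nonneg (φ.nonneg_normed t), ← Real.dist_eq]
      have h2 : ((Real.nnabs (φ.normed volume t * K) : NNReal) : ℝ) = φ.normed volume t * K := by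
        simp [abs_of_nonneg (φ.nonneg_normed t)]
      rw [h2, mul_assoc]
      exact mul_le_mul_of_nonneg_left h1 (φ.nonneg_normed t))
    (φ.integrable_normed.mul_const _)
    (hae.mono fun t ht => by
      have h1 : HasFDerivAt (fun y => f (y - t)) (fderiv ℝ f (x - t)) x := by
        have := ht.hasFDerivAt.comp x ((hasFDerivAt_id x).sub_const t)
        rwa [ContinuousLinearMap.comp_id] at this
      exact h1.const_mul _)
  have h2 : fderiv ℝ (mo φ f) x = ∫ t, φ.normed volume t • fderiv ℝ f (x - t) := key.2.fderiv
  rw [pd, h2, ContinuousLinearMap.integral_apply key.1]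
  rfl

/-- A sequence of bumps shrinking to `0`. -/
def bmp (n : ℕ) (k : ℕ) : ContDiffBump (0 : Fin n → ℝ) :=
  ⟨1 / (2 * (k + 1)), 1 / (k + 1), by positivity, by
    rw [one_div_lt_one_div (by positivity) (by positivity)]
    have : (0:ℝ) ≤ k := Nat.cast_nonneg k
    linarith⟩

lemma bmp_tendsto {f : (Fin n → ℝ) → ℝ} (hf : LocallyIntegrable f) :
    ∀ᵐ x, Filter.Tendsto (fun k => mo (bmp n k) f x) Filter.atTop (nhds (f x)) := by
  apply ContDiffBump.ae_convolution_tendsto_right_of_locallyIntegrable (K := 2)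
  · exact tendsto_one_div_add_atTop_nhds_zero_nat
  · refine Filter.Eventually.of_forall fun k => ?_
    simp only [bmp]
    rw [one_div, one_div, mul_inv, ← mul_assoc]; norm_num
  · exact hf

/-- The integral of the Jacobian determinant of a Lipschitz map with one compactly supported
component vanishes. -/
lemma piola (g : Fin n → (Fin n → ℝ) → ℝ) (K : NNReal) (hg : ∀ i, LipschitzWith K (g i)) (i0 : Fin n)
    (hc : HasCompactSupport (g i0)) : ∫ x, (Dm g x).det = 0 := by
  obtain ⟨r, hr⟩ := hc.isCompact.isBounded.subset_closedBall (0 : Fin n → ℝ)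
  have hli : ∀ i, LocallyIntegrable (g i) := fun i => (hg i).continuous.locallyIntegrable
  have hzero : ∀ k, ∀ x ∉ Metric.closedBall (0 : Fin n → ℝ) (r + 1), ∀ j, pd (mo (bmp n k) (g i0)) j x = 0 := by
    intro k x hx j
    rw [pd_mo _ (hg i0), mo_apply]
    apply integral_eq_zero_of_ae
    refine ae_of_all _ fun t => ?_
    by_cases ht : t ∈ Metric.ball (0 : Fin n → ℝ) (bmp n k).rOut
    · have h1 : x - t ∉ tsupport (g i0) := by
        intro h
        apply hx
        have h2 := hr h
        simp only [Metric.mem_closedBall, Metric.mem_ball, dist_zero_right] at h2 ht ⊢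
        have h3 : (bmp n k).rOut ≤ 1 := by
          simp only [bmp]
          rw [div_le_one (by positivity)]
          have : (0:ℝ) ≤ k := Nat.cast_nonneg k
          linarith
        calc ‖x‖ = ‖(x - t) + t‖ := by rw [sub_add_cancel]
          _ ≤ ‖x - t‖ + ‖t‖ := norm_add_le _ _
          _ ≤ r + 1 := by linarith
      have : pd (g i0) j (x - t) = 0 := by
        unfold pd
        rw [image_eq_zero_of_notMem_tsupport (fun h => h1 (tsupport_fderiv_subset ℝ h))]; rfl
      simp [this]
    · have : (bmp n k).normed volume t = 0 := by
        rw [← Function.notMem_support, (bmp n k).support_normed_eq]; exact ht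
      simp [this]
  have hcs : ∀ k, HasCompactSupport (mo (bmp n k) (g i0)) := fun k =>
    (bmp n k).hasCompactSupport_normed.convolution _ hc
  have h0 : ∀ k, ∫ x, (Dm (fun i => mo (bmp n k) (g i)) x).det = 0 := fun k =>
    piola_smooth _ (fun i => mo_contDiff (m := 2) _ (hli i)) i0 (hcs k)
  have hlim : Filter.Tendsto (fun k => ∫ x, (Dm (fun i => mo (bmp n k) (g i)) x).det) Filter.atTop
      (nhds (∫ x, (Dm g x).det)) := by
    apply tendsto_integral_of_dominated_convergence
      (bound := (Metric.closedBall (0 : Fin n → ℝ) (r + 1)).indicator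
        fun _ => ∑ _σ : Equiv.Perm (Fin n), (K : ℝ) ^ n)
    · intro k
      simp_rw [det_rows]
      refine (Finset.measurable_fun_sum _ fun σ _ => ?_).aestronglyMeasurable
      refine Measurable.const_mul ?_ _
      exact Finset.measurable_fun_prod _ fun i _ => measurable_pd _ _
    · rw [integrable_indicator_iff Metric.isClosed_closedBall.measurableSet]
      exact integrableOn_const (isCompact_closedBall _ _).measure_lt_top.ne
    · intro k
      refine ae_of_all _ fun x => ?_
      by_cases hx : x ∈ Metric.closedBall (0 : Fin n → ℝ) (r + 1)
      · rw [indicator_of_mem hx, det_rows]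
        refine (norm_sum_le _ _).trans (Finset.sum_le_sum fun σ _ => ?_)
        rw [norm_mul, norm_prod]
        have hs : ‖((Equiv.Perm.sign σ : ℤ) : ℝ)‖ = 1 := by
          rcases Int.units_eq_one_or (Equiv.Perm.sign σ) with h | h <;> simp [h]
        rw [hs, one_mul]
        calc ∏ i, ‖Dm (fun i => mo (bmp n k) (g i)) x i (σ i)‖ ≤ ∏ _i : Fin n, (K : ℝ) := by
              refine Finset.prod_le_prod (fun _ _ => norm_nonneg _) fun i _ => ?_
              change |pd (mo (bmp n k) (g i)) (σ i) x| ≤ K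
              rw [pd_mo _ (hg i)]
              exact mo_bound _ (pd_le_lip (hg i) _) _
          _ = _ := by simp
      · rw [indicator_of_notMem hx, Matrix.det_eq_zero_of_row_eq_zero i0]
        · simp
        · intro j; exact hzero k x hx j
    · have : ∀ᵐ x, ∀ i j, Filter.Tendsto (fun k => mo (bmp n k) (pd (g i) j) x) Filter.atTop
          (nhds (pd (g i) j x)) := by
        rw [ae_all_iff]; intro i; rw [ae_all_iff]; intro j
        exact bmp_tendsto (locInt_pd (hg i) j)
      filter_upwards [this] with x hx
      simp_rw [det_rows]
      refine tendsto_finsetSum _ fun σ _ => ?_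
      refine Filter.Tendsto.const_mul _ ?_
      refine tendsto_finsetProd _ fun i _ => ?_
      have := hx i (σ i)
      refine this.congr fun k => ?_
      exact (pd_mo _ (hg i) _ _).symm
  simp only [h0] at hlim
  exact (tendsto_nhds_unique hlim tendsto_const_nhds)

end GR

namespace GR
variable {n : ℕ}

lemma fderiv_eq_sum (f : (Fin n → ℝ) → ℝ) (x v : Fin n → ℝ) :
    fderiv ℝ f x v = ∑ k, v k * pd f k x := by
  have := LinearMap.pi_apply_eq_sum_univ (fderiv ℝ f x).toLinearMap v
  simp only [smul_eq_mul] at this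
  refine this.trans (Finset.sum_congr rfl fun k _ => ?_)
  unfold pd
  have : (fun j => if k = j then (1:ℝ) else 0) = Pi.single k 1 := by
    ext i; simp [Pi.single_apply, eq_comm]
  rw [← this]; rfl

lemma fderiv_zero_of_pd {f : (Fin n → ℝ) → ℝ} {x : Fin n → ℝ} (h : ∀ k, pd f k x = 0) :
    fderiv ℝ f x = 0 := by
  ext v; rw [fderiv_eq_sum]; simp [h]

lemma pd_comp_apply {Φ : (Fin n → ℝ) → Fin n → ℝ} {x : Fin n → ℝ} (h : DifferentiableAt ℝ Φ x)
    (i j : Fin n) : pd (fun y => Φ y i) j x = fderiv ℝ Φ x (Pi.single j 1) i := by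
  unfold pd
  have := (hasFDerivAt_pi'.1 h.hasFDerivAt i).fderiv
  rw [this]; rfl

lemma det_fderiv {Φ : (Fin n → ℝ) → Fin n → ℝ} {x : Fin n → ℝ} (h : DifferentiableAt ℝ Φ x) :
    (fderiv ℝ Φ x).det = (Dm (fun i y => Φ y i) x).det := by
  rw [ContinuousLinearMap.det, ← LinearMap.det_toMatrix']
  congr 1
  ext i j
  rw [LinearMap.toMatrix'_apply]
  simp only [Dm, Matrix.of_apply]
  rw [pd_comp_apply h]
  rfl

lemma pd_chain {Φ : (Fin n → ℝ) → Fin n → ℝ} {x : Fin n → ℝ} (h : DifferentiableAt ℝ Φ x)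
    {g : (Fin n → ℝ) → ℝ} (hg : DifferentiableAt ℝ g (Φ x)) (j : Fin n) :
    pd (fun y => g (Φ y)) j x = ∑ k, pd g k (Φ x) * pd (fun y => Φ y k) j x := by
  have h1 : pd (fun y => g (Φ y)) j x = fderiv ℝ g (Φ x) (fderiv ℝ Φ x (Pi.single j 1)) := by
    unfold pd
    have := (hg.hasFDerivAt.comp x h.hasFDerivAt).fderiv
    rw [show (fun y => g (Φ y)) = g ∘ Φ from rfl, this]; rfl
  rw [h1, fderiv_eq_sum]
  refine Finset.sum_congr rfl fun k _ => ?_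
  rw [pd_comp_apply h, mul_comm]

/-- truncation of a Lipschitz function vanishing on the sphere is Lipschitz -/
lemma lip_indicator {F : (Fin n → ℝ) → ℝ} {K : NNReal} (hF : LipschitzWith K F) {x0 : Fin n → ℝ} {r : ℝ}
    (h0 : ∀ x ∈ Metric.sphere x0 r, F x = 0) :
    LipschitzWith K (indicator (Metric.ball x0 r) F) := by
  have key : ∀ x ∈ Metric.ball x0 r, ∀ y ∉ Metric.ball x0 r, |F x| ≤ K * dist x y := by
    intro x hx y hy
    have hcont : ContinuousOn (fun t : ℝ => dist (x + t • (y - x)) x0) (Icc 0 1) := by fun_prop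
    have := intermediate_value_Icc (zero_le_one) hcont
    have hr : r ∈ Icc (dist (x + (0:ℝ) • (y - x)) x0) (dist (x + (1:ℝ) • (y - x)) x0) := by
      simp only [Metric.mem_ball, not_lt] at hx hy
      simp; exact ⟨hx.le, hy⟩
    obtain ⟨t, ht, hts⟩ := this hr
    have hz := h0 (x + t • (y - x)) hts
    have h1 := hF.dist_le_mul x (x + t • (y - x))
    rw [hz, Real.dist_eq, sub_zero] at h1
    refine h1.trans (mul_le_mul_of_nonneg_left ?_ K.coe_nonneg)
    rw [dist_eq_norm, dist_eq_norm, show x - (x + t • (y - x)) = t • (x - y) by module, norm_smul]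
    rw [Real.norm_eq_abs, abs_of_nonneg ht.1]
    exact mul_le_of_le_one_left (norm_nonneg _) ht.2
  refine LipschitzWith.of_dist_le_mul fun x y => ?_
  by_cases hx : x ∈ Metric.ball x0 r <;> by_cases hy : y ∈ Metric.ball x0 r
  · simp only [hx, hy, indicator_of_mem]; exact hF.dist_le_mul x y
  · simp only [hx, hy, indicator_of_mem, indicator_of_notMem, not_false_eq_true, Real.dist_eq, sub_zero]
    exact key x hx y hy
  · simp only [hx, hy, indicator_of_mem, indicator_of_notMem, not_false_eq_true, Real.dist_eq, zero_sub, abs_neg]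
    rw [dist_comm]; exact key y hy x hx
  · simp only [hx, hy, indicator_of_notMem, not_false_eq_true, dist_self]; positivity

/-- The basic weak identity. -/
lemma weak_grad {Φ : (Fin n → ℝ) → Fin n → ℝ} {K : NNReal} (hΦ : LipschitzWith K Φ)
    {x0 : Fin n → ℝ} {r : ℝ} (hr : 0 < r) {g : (Fin n → ℝ) → ℝ} (hg : ContDiff ℝ 1 g)
    (hgc : HasCompactSupport g) (h0 : ∀ x ∈ Metric.sphere x0 r, g (Φ x) = 0) (i : Fin n) :
    ∫ x in Metric.ball x0 r, pd g i (Φ x) * (Dm (fun i y => Φ y i) x).det = 0 := by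
  obtain ⟨Kg, hKg⟩ := hg.lipschitzWith_of_hasCompactSupport hgc (by norm_num)
  have hL := lip_indicator (hKg.comp hΦ) (x0 := x0) (r := r) h0
  set F := indicator (Metric.ball x0 r) (g ∘ Φ) with hF
  let G : Fin n → (Fin n → ℝ) → ℝ := Function.update (fun k y => Φ y k) i F
  have hG : ∀ k, LipschitzWith (max K (Kg * K)) (G k) := by
    intro k
    by_cases hk : k = i
    · subst hk; simp only [G, Function.update_self]; exact hL.weaken (le_max_right _ _)
    · simp only [G, Function.update_of_ne hk]
      refine LipschitzWith.weaken ?_ (le_max_left _ _)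
      exact LipschitzWith.of_dist_le_mul fun x y =>
        (dist_le_pi_dist (Φ x) (Φ y) k).trans (hΦ.dist_le_mul x y)
  have hc : HasCompactSupport (G i) := by
    simp only [G, Function.update_self]
    exact HasCompactSupport.intro (isCompact_closedBall x0 r) fun x hx =>
      indicator_of_notMem (fun h => hx (Metric.ball_subset_closedBall h)) _
  have hP := piola G _ hG i hc
  rw [← hP, ← integral_indicator Metric.isOpen_ball.measurableSet]
  apply integral_congr_ae
  have hs : ∀ᵐ x : Fin n → ℝ, x ∉ Metric.sphere x0 r :=
    measure_eq_zero_iff_ae_notMem.1 (Measure.addHaar_sphere_of_ne_zero volume x0 hr.ne')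
  filter_upwards [hΦ.ae_differentiableAt, hs] with x hx hxs
  have hDm : Dm G x = (Dm (fun i y => Φ y i) x).updateRow i (fun j => pd F j x) := by
    ext k j
    by_cases hk : k = i
    · subst hk; simp [Dm, G]
    · simp [Dm, G, Matrix.updateRow_ne, Function.update_of_ne, hk]
  rw [hDm]
  by_cases hxb : x ∈ Metric.ball x0 r
  · rw [indicator_of_mem hxb]
    have : (fun j => pd F j x) = ∑ k, pd g k (Φ x) • (Dm (fun i y => Φ y i) x) k := by
      ext j
      have h1 : pd F j x = pd (fun y => g (Φ y)) j x := by
        unfold pd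
        rw [Filter.EventuallyEq.fderiv_eq]
        filter_upwards [Metric.isOpen_ball.mem_nhds hxb] with y hy
        rw [hF, indicator_of_mem hy]; rfl
      rw [h1, pd_chain hx (hg.differentiable (by norm_num) _)]
      simp [Dm]
    rw [this, Matrix.det_updateRow_sum]; rfl
  · rw [indicator_of_notMem hxb]
    have hxc : x ∈ (Metric.closedBall x0 r)ᶜ := by
      simp only [Metric.mem_ball, Metric.mem_sphere, mem_compl_iff, Metric.mem_closedBall] at *
      intro h; exact hxs (le_antisymm h (not_lt.1 hxb))
    have : (fun j => pd F j x) = 0 := by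
      ext j
      have : F =ᶠ[nhds x] fun _ => 0 := by
        filter_upwards [Metric.isClosed_closedBall.isOpen_compl.mem_nhds hxc] with y hy
        exact indicator_of_notMem (fun h => hy (Metric.ball_subset_closedBall h)) _
      unfold pd
      rw [this.fderiv_eq]; simp
    rw [this]
    symm
    apply Matrix.det_eq_zero_of_row_eq_zero i
    intro j; simp

/-- A lower Lipschitz bound passes to the derivative. -/
lemma fderiv_lower {Φ : (Fin n → ℝ) → Fin n → ℝ} {s : Set (Fin n → ℝ)} {c : ℝ}
    (hc : ∀ x ∈ s, ∀ y ∈ s, c * ‖x - y‖ ≤ ‖Φ x - Φ y‖) {x : Fin n → ℝ} (hs : s ∈ nhds x)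
    (h : DifferentiableAt ℝ Φ x) (v : Fin n → ℝ) : c * ‖v‖ ≤ ‖fderiv ℝ Φ x v‖ := by
  have h1 := h.hasFDerivAt.hasLineDerivAt v
  have h2 := (h1.tendsto_slope_zero).norm
  have hcont : Filter.Tendsto (fun t : ℝ => x + t • v) (nhdsWithin 0 {0}ᶜ) (nhds x) := by
    have : Continuous (fun t : ℝ => x + t • v) := by fun_prop
    have := this.tendsto 0
    simp only [zero_smul, add_zero] at this
    exact this.mono_left nhdsWithin_le_nhds
  refine ge_of_tendsto h2 ?_
  filter_upwards [hcont hs, self_mem_nhdsWithin] with t ht ht0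
  have ht0' : t ≠ 0 := ht0
  have := hc _ ht x (mem_of_mem_nhds hs)
  simp only [add_sub_cancel_left, norm_smul, zero_add, zero_smul, add_zero] at this ⊢
  have hp : 0 < ‖t‖ := norm_pos_iff.2 ht0'
  rw [norm_inv, ← div_eq_inv_mul, le_div_iff₀ hp]
  linarith

lemma det_ne_zero_of_lower {A : (Fin n → ℝ) →L[ℝ] (Fin n → ℝ)} {c : ℝ} (hc : 0 < c)
    (h : ∀ v, c * ‖v‖ ≤ ‖A v‖) : A.det ≠ 0 := by
  intro h0
  have := LinearMap.bot_lt_ker_of_det_eq_zero (f := A.toLinearMap) h0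
  obtain ⟨v, hv, hv0⟩ := (Submodule.ne_bot_iff _).1 this.ne'
  have h1 := h v
  rw [show A v = 0 from hv, norm_zero] at h1
  have := norm_pos_iff.2 hv0
  nlinarith

lemma pd_mo_left (φ : ContDiffBump (0 : Fin n → ℝ)) {f : (Fin n → ℝ) → ℝ}
    (hf : LocallyIntegrable f) (i : Fin n) (a : Fin n → ℝ) :
    pd (mo φ f) i a = - ∫ y, pd (fun y => φ.normed volume (a - y)) i y * f y := by
  have h1 := φ.hasCompactSupport_normed (μ := volume) |>.hasFDerivAt_convolution_left
    (ContinuousLinearMap.lsmul ℝ ℝ) (φ.contDiff_normed (n := 1)) hf a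
  unfold pd mo
  rw [h1.fderiv]
  have hce : ConvolutionExistsAt (fderiv ℝ (φ.normed volume)) f a ((ContinuousLinearMap.precompL (Fin n → ℝ) (ContinuousLinearMap.lsmul ℝ ℝ))) volume :=
    (φ.hasCompactSupport_normed.fderiv ℝ).convolutionExists_left _
      (φ.contDiff_normed (n := 1) |>.continuous_fderiv (by norm_num)) hf a
  rw [convolution_eq_swap, ContinuousLinearMap.integral_apply hce.integrable_swap, ← integral_neg]
  congr 1; ext y
  have h2 : HasFDerivAt (fun y => φ.normed volume (a - y)) (-(fderiv ℝ (φ.normed volume) (a - y))) y := by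
    have h3 := ((φ.contDiff_normed (n := 1) (μ := volume)).differentiable (by norm_num) (a - y)).hasFDerivAt
    have h4 : HasFDerivAt (fun y : Fin n → ℝ => a - y) (-ContinuousLinearMap.id ℝ _) y :=
      (hasFDerivAt_id y).const_sub a
    have := h3.comp y h4
    refine this.congr_fderiv ?_
    ext; simp
  rw [h2.fderiv]
  simp [ContinuousLinearMap.precompL_apply]

end GR

namespace GR
variable {n : ℕ}

lemma open_aux {Φ : (Fin n → ℝ) → Fin n → ℝ} {K : NNReal} (hΦ : LipschitzWith K Φ)
    {x0 : Fin n → ℝ} {r c : ℝ} (hr : 0 < r) (hc : 0 < c)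
    (hlow : ∀ x ∈ Metric.closedBall x0 r, ∀ y ∈ Metric.closedBall x0 r, c * ‖x - y‖ ≤ ‖Φ x - Φ y‖) :
    Metric.ball (Φ x0) (c * r) ⊆ Φ '' Metric.closedBall x0 r := by
  intro q hq
  by_contra hqn
  -- missing neighbourhood
  have hcomp : IsCompact (Φ '' Metric.closedBall x0 r) :=
    (isCompact_closedBall x0 r).image hΦ.continuous
  obtain ⟨δ, hδ, hδq⟩ := Metric.isOpen_iff.1 hcomp.isClosed.isOpen_compl q hqn
  -- the set of differentiability
  set s : Set (Fin n → ℝ) := Metric.ball x0 r ∩ {x | DifferentiableAt ℝ Φ x} with hs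
  have hsm : MeasurableSet s :=
    Metric.isOpen_ball.measurableSet.inter (measurableSet_of_differentiableAt ℝ Φ)
  have hinj : InjOn Φ (Metric.closedBall x0 r) := by
    intro x hx y hy hxy
    have := hlow x hx y hy
    rw [hxy, sub_self, norm_zero] at this
    have h2 : ‖x - y‖ ≤ 0 := by
      by_contra h; push Not at h; nlinarith
    exact sub_eq_zero.1 (norm_le_zero_iff.1 h2)
  have hsB : s ⊆ Metric.closedBall x0 r := fun x hx => Metric.ball_subset_closedBall hx.1
  set J : (Fin n → ℝ) → ℝ := fun x => (fderiv ℝ Φ x).det with hJ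
  have hJm : Measurable J :=
    ContinuousLinearMap.continuous_det.measurable.comp (measurable_fderiv ℝ Φ)
  have hJ0 : ∀ x ∈ s, J x ≠ 0 := fun x hx => det_ne_zero_of_lower hc
    (fderiv_lower hlow (Filter.mem_of_superset (Metric.isOpen_ball.mem_nhds hx.1)
      Metric.ball_subset_closedBall) hx.2)
  set sp := s ∩ {x | 0 < J x} with hsp
  set sn := s ∩ {x | J x < 0} with hsn
  have hspm : MeasurableSet sp := hsm.inter (measurableSet_lt measurable_const hJm)
  have hsnm : MeasurableSet sn := hsm.inter (measurableSet_lt hJm measurable_const)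
  have hder : ∀ t ⊆ s, ∀ x ∈ t, HasFDerivWithinAt Φ (fderiv ℝ Φ x) t x := fun t ht x hx =>
    (ht hx).2.hasFDerivAt.hasFDerivWithinAt
  have hinjs : ∀ t ⊆ s, InjOn Φ t := fun t ht => hinj.mono (ht.trans hsB)
  have hspS : sp ⊆ s := inter_subset_left
  have hsnS : sn ⊆ s := inter_subset_left
  have hPm : MeasurableSet (Φ '' sp) :=
    measurable_image_of_fderivWithin hspm (hder sp hspS) (hinjs sp hspS)
  have hNm : MeasurableSet (Φ '' sn) :=
    measurable_image_of_fderivWithin hsnm (hder sn hsnS) (hinjs sn hsnS)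
  set f : (Fin n → ℝ) → ℝ := fun y => indicator (Φ '' sp) (fun _ => (1:ℝ)) y
    - indicator (Φ '' sn) (fun _ => (1:ℝ)) y with hf
  have hl : ∀ S : Set (Fin n → ℝ), MeasurableSet S → LocallyIntegrable (indicator S fun _ => (1:ℝ)) :=
    fun S hS => (locallyIntegrable_const (1:ℝ)).indicator hS
  have hfl : LocallyIntegrable f := (hl _ hPm).sub (hl _ hNm)
  have hfq : ∀ y ∈ Metric.ball q δ, f y = 0 := by
    intro y hy
    have h1 := hδq hy
    have h2 : ∀ t ⊆ s, y ∉ Φ '' t := fun t ht hyt => h1 (image_mono (ht.trans hsB) hyt)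
    simp [hf, h2 sp hspS, h2 sn hsnS]
  -- integrals against f
  have hcv : ∀ w : (Fin n → ℝ) → ℝ, Continuous w → HasCompactSupport w →
      ∫ y, w y * f y = ∫ x in Metric.ball x0 r, w (Φ x) * (Dm (fun i y => Φ y i) x).det := by
    intro w hw hwc
    have hwi : Integrable w := hw.integrable_of_hasCompactSupport hwc
    have e1 : ∀ S : Set (Fin n → ℝ), MeasurableSet S →
        ∫ y, w y * indicator S (fun _ => (1:ℝ)) y = ∫ y in S, w y := by
      intro S hS
      rw [← integral_indicator hS]; congr 1; ext y
      by_cases hy : y ∈ S <;> simp [hy]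
    have e2 : ∀ S : Set (Fin n → ℝ), MeasurableSet S →
        Integrable (fun y => w y * indicator S (fun _ => (1:ℝ)) y) := by
      intro S hS
      refine (hwi.indicator hS).congr (ae_of_all _ fun y => ?_)
      by_cases hy : y ∈ S <;> simp [hy]
    have i1 : ∀ t ⊆ s, MeasurableSet t → IntegrableOn (fun x => |J x| • w (Φ x)) t := by
      intro t ht htm
      exact (integrableOn_image_iff_integrableOn_abs_det_fderiv_smul volume htm (hder t ht)
        (hinjs t ht) w).1 hwi.integrableOn
    have e3 : ∀ t ⊆ s, MeasurableSet t → ∫ y in Φ '' t, w y = ∫ x in t, |J x| • w (Φ x) :=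
      fun t ht htm => integral_image_eq_integral_abs_det_fderiv_smul volume htm (hder t ht)
        (hinjs t ht) w
    simp only [hf, mul_sub]
    rw [integral_sub (e2 _ hPm) (e2 _ hNm), e1 _ hPm, e1 _ hNm, e3 _ hspS hspm, e3 _ hsnS hsnm]
    have hunion : s = sp ∪ sn := by
      ext x; constructor
      · intro hx
        rcases lt_or_gt_of_ne (hJ0 x hx) with h | h
        · exact Or.inr ⟨hx, h⟩
        · exact Or.inl ⟨hx, h⟩
      · rintro (h | h)
        · exact hspS h
        · exact hsnS h
    have hdisj : Disjoint sp sn := by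
      rw [Set.disjoint_left]; intro x hx hx'
      exact lt_asymm (show 0 < J x from hx.2) hx'.2
    have hae : (Metric.ball x0 r : Set (Fin n → ℝ)) =ᵐ[volume] s := by
      filter_upwards [hΦ.ae_differentiableAt (μ := volume)] with x hx
      apply propext
      exact ⟨fun h => ⟨h, hx⟩, fun h => h.1⟩
    rw [setIntegral_congr_set hae]
    have p1 : ∀ x ∈ sp, |J x| • w (Φ x) = w (Φ x) * (Dm (fun i y => Φ y i) x).det := by
      intro x hx
      rw [abs_of_pos hx.2, smul_eq_mul, mul_comm, ← det_fderiv (hspS hx).2]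
    have p2 : ∀ x ∈ sn, |J x| • w (Φ x) = -(w (Φ x) * (Dm (fun i y => Φ y i) x).det) := by
      intro x hx
      rw [abs_of_neg hx.2, smul_eq_mul, ← det_fderiv (hsnS hx).2]; ring
    have j1 := (i1 sp hspS hspm).congr_fun p1 hspm
    have j2 := ((i1 sn hsnS hsnm).congr_fun p2 hsnm).neg
    have j2' : IntegrableOn (fun x => w (Φ x) * (Dm (fun i y => Φ y i) x).det) sn :=
      j2.congr (ae_of_all _ fun x => by simp)
    rw [setIntegral_congr_fun hspm p1, setIntegral_congr_fun hsnm p2, hunion,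
      setIntegral_union hdisj hsnm j1 j2', integral_neg]
    ring
  -- vanishing gradient of mollifications
  have hrad : ∀ k, (bmp n k).rOut = 1 / (k + 1) := fun k => rfl
  have hgrad : ∀ k : ℕ, ∀ a ∈ Metric.ball (Φ x0) (c * r - 1 / (k + 1)), ∀ i, pd (mo (bmp n k) f) i a = 0 := by
    intro k a ha i
    rw [pd_mo_left _ hfl]
    set g : (Fin n → ℝ) → ℝ := fun y => (bmp n k).normed volume (a - y) with hg
    have hgC : ContDiff ℝ 1 g := (ContDiffBump.contDiff_normed _).comp (contDiff_const.sub contDiff_id)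
    have hgc : HasCompactSupport g := by
      refine HasCompactSupport.intro (isCompact_closedBall a (1 / (k + 1))) fun y hy => ?_
      have h1 : a - y ∉ Function.support ((bmp n k).normed volume) := by
        rw [ContDiffBump.support_normed_eq, hrad]
        simp only [Metric.mem_closedBall, Metric.mem_ball, dist_zero_right, not_le, not_lt] at *
        rw [dist_comm, dist_eq_norm] at hy; exact hy.le
      simpa using h1
    have hpc : Continuous (pd g i) := (pd_contDiff (m := 1) (k := 0) hgC (by simp) i).continuous
    rw [hcv _ hpc (hgc.fderiv_apply ℝ _), weak_grad hΦ hr hgC hgc, neg_zero]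
    intro x hx
    have h1 : a - Φ x ∉ Function.support ((bmp n k).normed volume) := by
      rw [ContDiffBump.support_normed_eq, hrad]
      have h2 := hlow x (Metric.sphere_subset_closedBall hx) x0 (Metric.mem_closedBall_self hr.le)
      rw [Metric.mem_sphere, dist_eq_norm] at hx
      rw [hx] at h2
      rw [Metric.mem_ball, dist_eq_norm] at ha
      simp only [Metric.mem_ball, dist_zero_right, not_lt]
      have h3 : ‖Φ x - Φ x0‖ ≤ ‖a - Φ x‖ + ‖a - Φ x0‖ := by
        rw [show Φ x - Φ x0 = (a - Φ x0) - (a - Φ x) by abel]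
        rw [add_comm]; exact norm_sub_le _ _
      linarith
    simpa using h1
  have hconst : ∀ k : ℕ, q ∈ Metric.ball (Φ x0) (c * r - 1 / (k + 1)) → 1 / ((k:ℝ) + 1) < δ →
      ∀ a ∈ Metric.ball (Φ x0) (c * r - 1 / (k + 1)), mo (bmp n k) f a = 0 := by
    intro k hqk hk a ha
    have h1 : mo (bmp n k) f a = mo (bmp n k) f q := by
      refine Metric.isOpen_ball.is_const_of_fderiv_eq_zero (𝕜 := ℝ)
        (convex_ball _ _).isPreconnected ?_ ?_ ha hqk
      · exact ((mo_contDiff (bmp n k) hfl (m := 1)).differentiable (by norm_num)).differentiableOn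
      · intro b hb
        exact fderiv_zero_of_pd (hgrad k b hb)
    rw [h1, mo_apply]
    apply integral_eq_zero_of_ae
    refine ae_of_all _ fun t => ?_
    by_cases ht : t ∈ Metric.ball (0 : Fin n → ℝ) (1 / (k + 1))
    · beta_reduce
      rw [hfq (q - t)]; · simp
      simp only [Metric.mem_ball, dist_zero_right] at ht ⊢
      rw [dist_eq_norm]; simp only [sub_sub_cancel_left, norm_neg]; linarith
    · have h1 : t ∉ Function.support ((bmp n k).normed volume) := by
        rw [ContDiffBump.support_normed_eq, hrad]; exact ht
      simp only [Function.mem_support, not_not] at h1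
      simp [h1]
  have hfz : ∀ᵐ y, y ∈ Metric.ball (Φ x0) (c * r) → f y = 0 := by
    filter_upwards [bmp_tendsto hfl] with y hy hyb
    refine tendsto_nhds_unique hy ?_
    refine Filter.Tendsto.congr' ?_ tendsto_const_nhds
    have hlim : Filter.Tendsto (fun k : ℕ => 1 / ((k:ℝ) + 1)) Filter.atTop (nhds 0) :=
      tendsto_one_div_add_atTop_nhds_zero_nat
    rw [Metric.mem_ball] at hyb hq
    filter_upwards [hlim.eventually_lt_const hδ,
      hlim.eventually_lt_const (sub_pos.2 hyb), hlim.eventually_lt_const (sub_pos.2 hq)] with k h1 h2 h3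
    refine (hconst k ?_ h1 y ?_).symm
    · rw [Metric.mem_ball]; linarith
    · rw [Metric.mem_ball]; linarith
  -- contradiction
  obtain ⟨ρ, hρ, hρs⟩ := Metric.isOpen_iff.1
    (Metric.isOpen_ball.inter (Metric.isOpen_ball.preimage hΦ.continuous) :
      IsOpen (Metric.ball x0 r ∩ Φ ⁻¹' Metric.ball (Φ x0) (c * r))) x0
    ⟨Metric.mem_ball_self hr, Metric.mem_ball_self (by positivity)⟩
  set W := s ∩ Metric.ball x0 ρ with hW
  have hWm : MeasurableSet W := hsm.inter Metric.isOpen_ball.measurableSet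
  have hWs : W ⊆ s := inter_subset_left
  have hvol : volume (Φ '' W) = 0 := by
    rw [measure_eq_zero_iff_ae_notMem]
    filter_upwards [hfz] with y hy hyW
    obtain ⟨x, hx, rfl⟩ := hyW
    have h0 := hy (hρs hx.2).2
    have hxi : ∀ t ⊆ s, Φ x ∈ Φ '' t → x ∈ t := by
      rintro t ht ⟨x', hx', he⟩
      rwa [← hinj (hsB (ht hx')) (hsB hx.1) he]
    rcases lt_or_gt_of_ne (hJ0 x hx.1) with h | h
    · have h1 : Φ x ∈ Φ '' sn := ⟨x, ⟨hx.1, h⟩, rfl⟩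
      have h2 : Φ x ∉ Φ '' sp := fun hh => lt_asymm h (hxi sp hspS hh).2
      simp [hf, h1, h2] at h0
    · have h1 : Φ x ∈ Φ '' sp := ⟨x, ⟨hx.1, h⟩, rfl⟩
      have h2 : Φ x ∉ Φ '' sn := fun hh => lt_asymm h (hxi sn hsnS hh).2
      simp [hf, h1, h2] at h0
  rw [← lintegral_abs_det_fderiv_eq_addHaar_image volume hWm (hder W hWs) (hinjs W hWs)] at hvol
  have hpos : volume W ≠ 0 := by
    have hae : (Metric.ball x0 ρ : Set (Fin n → ℝ)) =ᵐ[volume] W := by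
      filter_upwards [hΦ.ae_differentiableAt (μ := volume)] with x hx
      apply propext
      exact ⟨fun h => ⟨⟨(hρs h).1, hx⟩, h⟩, fun h => h.2⟩
    rw [← measure_congr hae]
    exact (Metric.measure_ball_pos volume x0 hρ).ne'
  rw [lintegral_eq_zero_iff' (by
    exact (hJm.abs.ennreal_ofReal).aemeasurable)] at hvol
  apply hpos
  have h3 : ∀ᵐ x ∂(volume.restrict W), False := by
    filter_upwards [hvol, ae_restrict_mem hWm] with x hx hxW
    simp only [Pi.zero_apply, ENNReal.ofReal_eq_zero] at hx
    exact hJ0 x (hWs hxW) (abs_nonpos_iff.1 hx)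
  simpa using h3

/-- Quantitative invariance of domain for bilipschitz maps. -/
lemma open_bilip {Φ : (Fin n → ℝ) → Fin n → ℝ} {K : NNReal} {x0 : Fin n → ℝ} {r c : ℝ}
    (hΦ : LipschitzOnWith K Φ (Metric.closedBall x0 r)) (hr : 0 < r) (hc : 0 < c)
    (hlow : ∀ x ∈ Metric.closedBall x0 r, ∀ y ∈ Metric.closedBall x0 r, c * ‖x - y‖ ≤ ‖Φ x - Φ y‖) :
    Metric.ball (Φ x0) (c * r) ⊆ Φ '' Metric.closedBall x0 r := by
  obtain ⟨Ψ, hΨ, he⟩ := hΦ.extend_pi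
  rw [image_congr he, he (Metric.mem_closedBall_self hr.le)]
  refine open_aux hΨ hr hc fun x hx y hy => ?_
  rw [← he hx, ← he hy]; exact hlow x hx y hy
end GR

namespace GR
variable {n : ℕ}

/-- derivative as a matrix -/
def DD (u : (Fin n → ℝ) → Fin n → ℝ) (x : Fin n → ℝ) : Matrix (Fin n) (Fin n) ℝ :=
  Matrix.of fun i j => fderiv ℝ u x (Pi.single j 1) i

lemma DD_eq_Dm {u : (Fin n → ℝ) → Fin n → ℝ} {x : Fin n → ℝ} (h : DifferentiableAt ℝ u x) :
    DD u x = Dm (fun i y => u y i) x := by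
  ext i j; simp only [DD, Dm, Matrix.of_apply]; rw [pd_comp_apply h]

lemma measurable_DD_entry (u : (Fin n → ℝ) → Fin n → ℝ) (i j : Fin n) :
    Measurable (fun x => DD u x i j) :=
  (measurable_pi_apply i).comp (measurable_fderiv_apply_const ℝ u (Pi.single j 1))

lemma measurable_DD (u : (Fin n → ℝ) → Fin n → ℝ) :
    @Measurable _ (Fin n → Fin n → ℝ) _ _ (fun x => (DD u x : Fin n → Fin n → ℝ)) :=
  measurable_pi_lambda _ fun i => measurable_pi_lambda _ fun j => measurable_DD_entry u i j

/-- continuous functions of a matrix field with measurable entries -/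
lemma measurable_comp_mat {F : (Fin n → ℝ) → Matrix (Fin n) (Fin n) ℝ}
    (hF : ∀ i j, Measurable fun x => F x i j) {g : Matrix (Fin n) (Fin n) ℝ → ℝ} (hg : Continuous g) :
    Measurable fun x => g (F x) := by
  have h1 : @Measurable _ (Fin n → Fin n → ℝ) _ _ (fun x => (F x : Fin n → Fin n → ℝ)) :=
    measurable_pi_lambda _ fun i => measurable_pi_lambda _ fun j => hF i j
  have h2 : @Measurable (Fin n → Fin n → ℝ) ℝ _ _ (fun A : Fin n → Fin n → ℝ => g (Matrix.of A)) :=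
    Continuous.measurable (hg.comp (by exact continuous_id))
  exact h2.comp h1

lemma fderiv_apply_eq (u : (Fin n → ℝ) → Fin n → ℝ) (x w : Fin n → ℝ) (i : Fin n) :
    fderiv ℝ u x w i = ∑ j, w j * DD u x i j := by
  have := LinearMap.pi_apply_eq_sum_univ (fderiv ℝ u x).toLinearMap w
  have h2 := congrFun this i
  simp only [Finset.sum_apply, Pi.smul_apply, smul_eq_mul] at h2
  refine h2.trans (Finset.sum_congr rfl fun k _ => ?_)
  have : (fun j => if k = j then (1:ℝ) else 0) = Pi.single k 1 := by
    ext i; simp [Pi.single_apply, eq_comm]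
  simp only [DD, Matrix.of_apply]
  rw [← this]; rfl

lemma norm_fderiv_apply_le (u : (Fin n → ℝ) → Fin n → ℝ) (x w : Fin n → ℝ) :
    ‖fderiv ℝ u x w‖ ≤ n * (‖w‖ * frobn (DD u x)) := by
  refine (pi_norm_le_iff_of_nonneg (by have := frobn_nonneg (DD u x); positivity)).2 fun i => ?_
  rw [fderiv_apply_eq, Real.norm_eq_abs]
  refine (Finset.abs_sum_le_sum_abs _ _).trans ?_
  calc ∑ j, |w j * DD u x i j| ≤ ∑ j : Fin n, ‖w‖ * frobn (DD u x) := by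
        refine Finset.sum_le_sum fun j _ => ?_
        rw [abs_mul]
        exact mul_le_mul (norm_le_pi_norm w j) (abs_entry_le _ _ _) (abs_nonneg _) (norm_nonneg _)
    _ = _ := by simp

lemma ftc_le (f f' : ℝ → Fin n → ℝ) (h : ∀ t ∈ Icc (0:ℝ) 1, HasDerivAt f (f' t) t) :
    ‖f 1 - f 0‖ₑ ≤ ∫⁻ t in Ioc (0:ℝ) 1, ‖f' t‖ₑ := by
  by_cases hfin : ∫⁻ t in Ioc (0:ℝ) 1, ‖f' t‖ₑ = ⊤
  · rw [hfin]; exact le_top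
  have hm : AEStronglyMeasurable f' (volume.restrict (Ioc (0:ℝ) 1)) := by
    refine ((measurable_deriv f).aestronglyMeasurable).congr ?_
    filter_upwards [ae_restrict_mem measurableSet_Ioc] with t ht
    exact (h t ⟨ht.1.le, ht.2⟩).deriv
  have hintg : IntervalIntegrable f' volume 0 1 := by
    rw [intervalIntegrable_iff_integrableOn_Ioc_of_le zero_le_one]
    exact ⟨hm, lt_top_iff_ne_top.2 hfin⟩
  have := intervalIntegral.integral_eq_sub_of_hasDerivAt (f := f) (f' := f') (a := 0) (b := 1)
    (by rw [uIcc_of_le zero_le_one]; exact h) hintg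
  rw [← this, intervalIntegral.integral_of_le zero_le_one]
  exact enorm_integral_le_lintegral_enorm _

/-- diagonal affine map -/
def dmap (a b : Fin n → ℝ) (z : Fin n → ℝ) : Fin n → ℝ := fun i => a i * z i + b i

lemma lint_dmap (a b : Fin n → ℝ) (ha : ∀ i, a i ≠ 0) (s : Set (Fin n → ℝ)) (hs : MeasurableSet s)
    (g : (Fin n → ℝ) → ENNReal) :
    ∫⁻ y in dmap a b '' s, g y = ENNReal.ofReal |∏ i, a i| * ∫⁻ x in s, g (dmap a b x) := by
  let A : (Fin n → ℝ) →L[ℝ] (Fin n → ℝ) :=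
    LinearMap.toContinuousLinearMap (Matrix.toLin' (Matrix.diagonal a))
  have hA : ∀ x, A x = fun i => a i * x i := by
    intro x; ext i; simp [A, Matrix.toLin'_apply, Matrix.mulVec_diagonal]
  have hd : ∀ x ∈ s, HasFDerivWithinAt (dmap a b) A s x := by
    intro x _
    have h1 : dmap a b = fun x => A x + b := by
      ext x i; simp [dmap, hA]
    rw [h1]
    exact (A.hasFDerivAt.add_const b).hasFDerivWithinAt
  have hinj : InjOn (dmap a b) s := by
    intro x _ y _ hxy
    ext i
    have := congrFun hxy i
    simp only [dmap, add_left_inj] at this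
    exact mul_left_cancel₀ (ha i) this
  have hdet : A.det = ∏ i, a i := by
    simp [A, ContinuousLinearMap.det, LinearMap.det_toLin', Matrix.det_diagonal]
  rw [lintegral_image_eq_lintegral_abs_det_fderiv_mul volume hs hd hinj, hdet]
  rw [lintegral_const_mul' _ _ ENNReal.ofReal_ne_top]
end GR

namespace GR
variable {n : ℕ}

/-- weak type estimate for the bad set -/
lemma bad_est (e2 : (Fin n → ℝ) → ENNReal) :
    volume {x | x ∈ Metric.ball (0 : Fin n → ℝ) 10 ∧ ∃ r, 0 < r ∧ r ≤ 20 ∧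
      volume (Metric.ball x r) < ∫⁻ y in Metric.ball x r, e2 y} ≤
    ENNReal.ofReal (5 ^ n) * ∫⁻ y in Metric.ball (0 : Fin n → ℝ) 30, e2 y := by
  set bad := {x | x ∈ Metric.ball (0 : Fin n → ℝ) 10 ∧ ∃ r, 0 < r ∧ r ≤ 20 ∧
      volume (Metric.ball x r) < ∫⁻ y in Metric.ball x r, e2 y} with hbad
  have hch : ∀ x : Fin n → ℝ, ∃ r, x ∈ bad → 0 < r ∧ r ≤ 20 ∧
      volume (Metric.ball x r) < ∫⁻ y in Metric.ball x r, e2 y := by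
    intro x
    by_cases hx : x ∈ bad
    · obtain ⟨r, hr⟩ := hx.2; exact ⟨r, fun _ => hr⟩
    · exact ⟨0, fun h => absurd h hx⟩
  choose r hr using hch
  obtain ⟨w, hwt, hdisj, hcov⟩ := Vitali.exists_disjoint_subfamily_covering_enlargement_closedBall
    bad id r 20 (fun a ha => (hr a ha).2.1) 5 (by norm_num)
  simp only [id] at hdisj hcov
  have hcount : w.Countable := by
    refine hdisj.countable_of_nonempty_interior fun a ha => ?_
    refine ⟨a, ?_⟩
    rw [mem_interior_iff_mem_nhds]
    exact Metric.closedBall_mem_nhds a (hr a (hwt ha)).1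
  have hdisj2 : w.PairwiseDisjoint fun a => Metric.ball a (r a) :=
    hdisj.mono fun a => Metric.ball_subset_closedBall
  have hsub : bad ⊆ ⋃ a ∈ w, Metric.closedBall a (5 * r a) := by
    intro x hx
    obtain ⟨b, hb, hxb⟩ := hcov x hx
    exact mem_biUnion hb (hxb (Metric.mem_closedBall_self (hr x hx).1.le))
  calc volume bad ≤ volume (⋃ a ∈ w, Metric.closedBall a (5 * r a)) := measure_mono hsub
    _ ≤ ∑' a : w, volume (Metric.closedBall (a : Fin n → ℝ) (5 * r a)) :=
        measure_biUnion_le volume hcount _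
    _ ≤ ∑' a : w, ENNReal.ofReal (5 ^ n) * ∫⁻ y in Metric.ball (a : Fin n → ℝ) (r a), e2 y := by
        refine ENNReal.tsum_le_tsum fun a => ?_
        have h := hr a (hwt a.2)
        rw [Real.volume_pi_closedBall _ (by linarith [h.1]), show 2 * (5 * r (a : Fin n → ℝ)) = 5 * (2 * r a) by ring,
          mul_pow, ENNReal.ofReal_mul (by positivity), Fintype.card_fin]
        gcongr
        have := h.2.2.le
        rwa [Real.volume_pi_ball _ h.1, Fintype.card_fin] at this
    _ = ENNReal.ofReal (5 ^ n) * ∫⁻ y in ⋃ a ∈ w, Metric.ball a (r a), e2 y := by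
        rw [ENNReal.tsum_mul_left, lintegral_biUnion hcount (fun a _ => Metric.isOpen_ball.measurableSet) hdisj2]
    _ ≤ _ := by
        gcongr
        refine iUnion₂_subset fun a ha => ?_
        have h := hr a (hwt ha)
        have h10 := (hwt ha).1
        refine Metric.ball_subset_ball' ?_
        rw [Metric.mem_ball] at h10
        linarith [h.2.1]

/-- energy density -/
def ee (u : (Fin n → ℝ) → Fin n → ℝ) (x : Fin n → ℝ) : ENNReal :=
  ENNReal.ofReal (distSOn (DD u x) ^ 2)

lemma measurable_ee (u : (Fin n → ℝ) → Fin n → ℝ) : Measurable (ee u) :=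
  ENNReal.measurable_ofReal.comp
    (measurable_comp_mat (measurable_DD_entry u) (continuous_dist.pow 2))

lemma seg_est {u : (Fin n → ℝ) → Fin n → ℝ} {x z : Fin n → ℝ} {r : ℝ}
    (hu : ∀ y ∈ Metric.ball x r, DifferentiableAt ℝ u y) (hz : z ∈ Metric.ball x r) :
    ‖u z - u x‖ₑ ≤ ∫⁻ t in Ioc (0:ℝ) 1, ENNReal.ofReal (n * r) * (ENNReal.ofReal (n + 1) + ee u (x + t • (z - x))) := by
  have hr : 0 < r := (_root_.dist_nonneg).trans_lt hz
  have hin : ∀ t ∈ Icc (0:ℝ) 1, x + t • (z - x) ∈ Metric.ball x r := by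
    intro t ht
    rw [Metric.mem_ball, dist_eq_norm] at hz ⊢
    rw [add_sub_cancel_left, norm_smul, Real.norm_eq_abs, abs_of_nonneg ht.1]
    exact (mul_le_of_le_one_left (norm_nonneg _) ht.2).trans_lt hz
  have h := ftc_le (fun t : ℝ => u (x + t • (z - x))) (fun t => fderiv ℝ u (x + t • (z - x)) (z - x))
    (fun t ht => by
      have h1 : HasDerivAt (fun t : ℝ => x + t • (z - x)) (z - x) t := by
        simpa using ((hasDerivAt_id t).smul_const (z - x)).const_add x
      exact (hu _ (hin t ht)).hasFDerivAt.comp_hasDerivAt t h1)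
  simp only [one_smul, add_sub_cancel, zero_smul, add_zero] at h
  refine h.trans (setLIntegral_mono' measurableSet_Ioc fun t ht => ?_)
  set p := x + t • (z - x)
  have hzr : ‖z - x‖ ≤ r := by rw [Metric.mem_ball, dist_eq_norm] at hz; exact hz.le
  have h2 := norm_fderiv_apply_le u p (z - x)
  have h3 := frobn_le_dist (DD u p)
  have hd := dist_nonneg (DD u p)
  have h4 : ‖fderiv ℝ u p (z - x)‖ ≤ n * r * (n + 1 + distSOn (DD u p) ^ 2) := by
    calc _ ≤ n * (‖z - x‖ * frobn (DD u p)) := h2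
      _ ≤ n * (r * (n + 1 + distSOn (DD u p) ^ 2)) := by
        have := frobn_nonneg (DD u p)
        gcongr
        nlinarith [sq_nonneg (distSOn (DD u p) - 1)]
      _ = _ := by ring
  rw [ee, ← ENNReal.ofReal_add (by positivity) (by positivity), ← ENNReal.ofReal_mul (by positivity),
    ← ofReal_norm_eq_enorm]
  exact ENNReal.ofReal_le_ofReal h4

lemma homothety_dmap (x : Fin n → ℝ) (t : ℝ) (z : Fin n → ℝ) :
    x + t • (z - x) = dmap (fun _ => t) (fun i => x i - t * x i) z := by
  ext i; simp [dmap]; ring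

lemma image_homothety_ball (x : Fin n → ℝ) {t : ℝ} (ht : 0 < t) (r : ℝ) :
    (fun z => x + t • (z - x)) '' Metric.ball x r = Metric.ball x (t * r) := by
  ext y; constructor
  · rintro ⟨z, hz, rfl⟩
    rw [Metric.mem_ball, dist_eq_norm] at *
    rw [add_sub_cancel_left, norm_smul, Real.norm_eq_abs, abs_of_pos ht]
    gcongr
  · intro hy
    refine ⟨x + t⁻¹ • (y - x), ?_, ?_⟩
    · rw [Metric.mem_ball, dist_eq_norm] at *
      rw [add_sub_cancel_left, norm_smul, Real.norm_eq_abs, abs_of_pos (inv_pos.2 ht)]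
      rw [inv_mul_lt_iff₀ ht]; exact hy
    · simp [smul_smul, mul_inv_cancel₀ ht.ne']

lemma avg_est {u : (Fin n → ℝ) → Fin n → ℝ} {x : Fin n → ℝ} {r : ℝ} (hr : 0 < r)
    (hu : ∀ y ∈ Metric.ball x r, DifferentiableAt ℝ u y)
    (hgood : ∀ s, 0 < s → s ≤ r → ∫⁻ y in Metric.ball x s, ee u y ≤ volume (Metric.ball x s)) :
    ∫⁻ z in Metric.ball x r, ‖u z - u x‖ₑ ≤ ENNReal.ofReal (n * r * (n + 2) * (2 * r) ^ n) := by
  have hme := measurable_ee u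
  calc ∫⁻ z in Metric.ball x r, ‖u z - u x‖ₑ ≤
      ∫⁻ z in Metric.ball x r, ∫⁻ t in Ioc (0:ℝ) 1,
        ENNReal.ofReal (n * r) * (ENNReal.ofReal (n + 1) + ee u (x + t • (z - x))) :=
        setLIntegral_mono' Metric.isOpen_ball.measurableSet fun z hz => seg_est hu hz
    _ = ∫⁻ t in Ioc (0:ℝ) 1, ∫⁻ z in Metric.ball x r,
        ENNReal.ofReal (n * r) * (ENNReal.ofReal (n + 1) + ee u (x + t • (z - x))) := by
        apply lintegral_lintegral_swap
        apply Measurable.aemeasurable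
        apply Measurable.const_mul
        apply Measurable.const_add
        apply hme.comp
        apply Continuous.measurable
        fun_prop
    _ ≤ ∫⁻ t in Ioc (0:ℝ) 1, ENNReal.ofReal (n * r * (n + 2) * (2 * r) ^ n) := by
        refine setLIntegral_mono' measurableSet_Ioc fun t ht => ?_
        rw [lintegral_const_mul' _ _ ENNReal.ofReal_ne_top, lintegral_add_left measurable_const,
          setLIntegral_const]
        have h1 := lint_dmap (fun _ => t) (fun i => x i - t * x i) (fun _ => ht.1.ne') (Metric.ball x r)
          Metric.isOpen_ball.measurableSet (ee u)
        simp only [← homothety_dmap] at h1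
        rw [image_homothety_ball x ht.1] at h1
        have h2 := hgood (t * r) (mul_pos ht.1 hr) (mul_le_of_le_one_left hr.le ht.2)
        rw [h1, Real.volume_pi_ball _ (mul_pos ht.1 hr), Finset.prod_const, Finset.card_univ, Fintype.card_fin,
          abs_of_pos (pow_pos ht.1 n), show (2 * (t * r)) ^ n = t ^ n * (2 * r) ^ n by
            rw [← mul_pow]; ring, ENNReal.ofReal_mul (pow_pos ht.1 n).le] at h2
        have h3 : ∫⁻ z in Metric.ball x r, ee u (x + t • (z - x)) ≤ ENNReal.ofReal ((2 * r) ^ n) := by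
          refine (ENNReal.mul_le_mul_iff_right ?_ ENNReal.ofReal_ne_top).1 h2
          simp [ht.1]
        rw [Real.volume_pi_ball _ hr, Fintype.card_fin]
        calc _ ≤ ENNReal.ofReal (n * r) * (ENNReal.ofReal (n + 1) * ENNReal.ofReal ((2 * r) ^ n) + ENNReal.ofReal ((2 * r) ^ n)) := by
              gcongr
          _ = _ := by
              rw [← ENNReal.ofReal_mul (by positivity), ← ENNReal.ofReal_add (by positivity) (by positivity), ← ENNReal.ofReal_mul (by positivity)]
              congr 1; ring
    _ = _ := by simp

lemma good_lip {u : (Fin n → ℝ) → Fin n → ℝ} {x y : Fin n → ℝ} {r : ℝ} (hr : 0 < r) (hxy : dist x y = r)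
    (hux : ∀ y ∈ Metric.ball x r, DifferentiableAt ℝ u y)
    (huy : ∀ z ∈ Metric.ball y r, DifferentiableAt ℝ u z)
    (hgx : ∀ s, 0 < s → s ≤ r → ∫⁻ y in Metric.ball x s, ee u y ≤ volume (Metric.ball x s))
    (hgy : ∀ s, 0 < s → s ≤ r → ∫⁻ z in Metric.ball y s, ee u z ≤ volume (Metric.ball y s)) :
    dist (u x) (u y) ≤ (2 * n * (n + 2) * 2 ^ n) * dist x y := by
  have hx := avg_est hr hux hgx
  have hy := avg_est hr huy hgy
  set m := x + (1/2 : ℝ) • (y - x) with hm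
  have hmx : dist m x = r / 2 := by
    rw [dist_eq_norm, hm, add_sub_cancel_left, norm_smul, ← hxy, dist_comm, dist_eq_norm]; norm_num; ring
  have hmy : dist m y = r / 2 := by
    rw [dist_eq_norm, hm, show x + (1/2 : ℝ) • (y - x) - y = (1/2 : ℝ) • (x - y) by module, norm_smul, ← hxy, dist_eq_norm]; norm_num; ring
  have s1 : Metric.ball m (r / 2) ⊆ Metric.ball x r := Metric.ball_subset_ball' (by linarith)
  have s2 : Metric.ball m (r / 2) ⊆ Metric.ball y r := Metric.ball_subset_ball' (by linarith)
  have h1 : ∫⁻ z in Metric.ball m (r / 2), ‖u x - u y‖ₑ ≤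
      ENNReal.ofReal (2 * (n * r * (n + 2) * (2 * r) ^ n)) := by
    calc _ ≤ ∫⁻ z in Metric.ball m (r / 2), (‖u z - u x‖ₑ + ‖u z - u y‖ₑ) := by
          refine lintegral_mono fun z => ?_
          rw [show u x - u y = (u z - u y) - (u z - u x) by abel, add_comm]
          exact enorm_sub_le
      _ = (∫⁻ z in Metric.ball m (r / 2), ‖u z - u x‖ₑ) + ∫⁻ z in Metric.ball m (r / 2), ‖u z - u y‖ₑ := by
          apply lintegral_add_left'
          have hc : ContinuousOn u (Metric.ball m (r / 2)) := fun z hz =>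
            (hux z (s1 hz)).continuousAt.continuousWithinAt
          exact ((hc.sub continuousOn_const).aestronglyMeasurable Metric.isOpen_ball.measurableSet).enorm
      _ ≤ ENNReal.ofReal (n * r * (n + 2) * (2 * r) ^ n) + ENNReal.ofReal (n * r * (n + 2) * (2 * r) ^ n) :=
          add_le_add ((lintegral_mono_set s1).trans hx) ((lintegral_mono_set s2).trans hy)
      _ = _ := by rw [← ENNReal.ofReal_add (by positivity) (by positivity)]; congr 1; ring
  rw [setLIntegral_const, Real.volume_pi_ball _ (by positivity), Fintype.card_fin, ← ofReal_norm_eq_enorm,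
    ← ENNReal.ofReal_mul (by positivity), ENNReal.ofReal_le_ofReal_iff (by positivity), ← dist_eq_norm] at h1
  rw [hxy]
  have h2 : 0 < r ^ n := by positivity
  rw [show 2 * (r / 2) = r by ring, mul_pow] at h1
  refine le_of_mul_le_mul_right ?_ h2
  linarith

/-- Lipschitz truncation -/
lemma lip_trunc (n : ℕ) : ∃ (L : NNReal), ∀ u : (Fin n → ℝ) → Fin n → ℝ,
    (∀ x ∈ Metric.ball (0 : Fin n → ℝ) 30, DifferentiableAt ℝ u x) →
    ∃ v : (Fin n → ℝ) → Fin n → ℝ, LipschitzWith L v ∧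
      volume {x | x ∈ Metric.ball (0 : Fin n → ℝ) 10 ∧ DD u x ≠ DD v x} ≤
        ENNReal.ofReal (5 ^ n) * ∫⁻ y in Metric.ball (0 : Fin n → ℝ) 30, ee u y := by
  refine ⟨2 * n * (n + 2) * 2 ^ n, fun u hu => ?_⟩
  set bad := {x | x ∈ Metric.ball (0 : Fin n → ℝ) 10 ∧ ∃ r, 0 < r ∧ r ≤ 20 ∧
      volume (Metric.ball x r) < ∫⁻ y in Metric.ball x r, ee u y} with hbad
  set G := Metric.ball (0 : Fin n → ℝ) 10 \ bad with hG
  have hgood : ∀ x ∈ G, ∀ s, 0 < s → s ≤ 20 → ∫⁻ y in Metric.ball x s, ee u y ≤ volume (Metric.ball x s) := by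
    intro x hx s hs hs2
    by_contra h
    push Not at h
    exact hx.2 ⟨hx.1, s, hs, hs2, h⟩
  have hlip : LipschitzOnWith (2 * n * (n + 2) * 2 ^ n) u G := by
    refine LipschitzOnWith.of_dist_le_mul fun x hx y hy => ?_
    rcases eq_or_lt_of_le (_root_.dist_nonneg (x := x) (y := y)) with h0 | h0
    · have : x = y := dist_eq_zero.1 h0.symm
      subst this; simp
    have h20 : dist x y ≤ 20 := by
      have h1 := hx.1; have h2 := hy.1
      rw [Metric.mem_ball] at h1 h2
      linarith [dist_triangle_right x y 0]
    have hb : ∀ w ∈ G, ∀ z ∈ Metric.ball w (dist x y), DifferentiableAt ℝ u z := by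
      intro w hw z hz
      apply hu
      have h1 := hw.1
      rw [Metric.mem_ball] at h1 hz ⊢
      linarith [dist_triangle z w 0]
    have := good_lip h0 rfl (hb x hx) (hb y hy) (fun s hs hs2 => hgood x hx s hs (hs2.trans h20))
      (fun s hs hs2 => hgood y hy s hs (hs2.trans h20))
    push_cast; exact this
  obtain ⟨v, hv, hve⟩ := hlip.extend_pi
  refine ⟨v, hv, le_trans ?_ (bad_est (ee u))⟩
  set S := Metric.ball (0 : Fin n → ℝ) 10 ∩ {x | u x = v x} with hS
  have hSm : MeasurableSet S := by
    have hc : ContinuousOn (fun x => u x - v x) (Metric.ball (0 : Fin n → ℝ) 10) := fun z hz =>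
      ((hu z (Metric.ball_subset_ball (by norm_num) hz)).continuousAt.sub hv.continuous.continuousAt).continuousWithinAt
    obtain ⟨t, ht, hte⟩ := (continuousOn_iff_isClosed.1 hc) {0} isClosed_singleton
    have : S = t ∩ Metric.ball (0 : Fin n → ℝ) 10 := by
      rw [← hte]; ext x; simp [hS, sub_eq_zero, and_comm]
    rw [this]; exact ht.measurableSet.inter Metric.isOpen_ball.measurableSet
  have hae : ∀ᵐ x, x ∈ S → DD u x = DD v x := by
    have h1 : ∀ᵐ x ∂(volume.restrict (S ∩ {x | DifferentiableAt ℝ v x})), ‖fderiv ℝ u x - fderiv ℝ v x - 0‖₊ ≤ 0 := by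
      refine ApproximatesLinearOn.norm_fderiv_sub_le (f := fun x => u x - v x) volume ?_ (hSm.inter (measurableSet_of_differentiableAt ℝ v)) (fun x => fderiv ℝ u x - fderiv ℝ v x) ?_
      · refine fun x hx y hy => ?_
        have e1 : u x = v x := hx.1.2
        have e2 : u y = v y := hy.1.2
        simp [e1, e2]
      · intro x hx
        exact ((hu x (Metric.ball_subset_ball (by norm_num) hx.1.1)).hasFDerivAt.sub hx.2.hasFDerivAt).hasFDerivWithinAt
    rw [ae_restrict_iff' (hSm.inter (measurableSet_of_differentiableAt ℝ v))] at h1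
    filter_upwards [h1, hv.ae_differentiableAt (μ := volume)] with x hx hvx hxS
    have h2 := hx ⟨hxS, hvx⟩
    have h3 : fderiv ℝ u x = fderiv ℝ v x := by
      rw [sub_zero] at h2
      exact sub_eq_zero.1 (by simpa using h2)
    simp [DD, h3]
  refine measure_mono_ae ?_
  filter_upwards [hae] with x hx hxm
  by_contra hxb
  have hxG : x ∈ G := ⟨hxm.1, hxb⟩
  exact hxm.2 (hx ⟨hxm.1, hve hxG⟩)
end GR

namespace GR
variable {n : ℕ}

/-- test functions -/
def TF (B : Set (Fin n → ℝ)) (φ : (Fin n → ℝ) → ℝ) : Prop :=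
  ContDiff ℝ 2 φ ∧ HasCompactSupport φ ∧ tsupport φ ⊆ B

lemma TF.pd_cont {B : Set (Fin n → ℝ)} {φ : (Fin n → ℝ) → ℝ} (h : TF B φ) (k : Fin n) :
    Continuous (pd φ k) := (pd_contDiff (m := 2) (k := 1) h.1 (by norm_num) k).continuous

lemma TF.pd_cs {B : Set (Fin n → ℝ)} {φ : (Fin n → ℝ) → ℝ} (h : TF B φ) (k : Fin n) :
    HasCompactSupport (pd φ k) := h.2.1.fderiv_apply ℝ _

lemma TF.pd_zero {B : Set (Fin n → ℝ)} {φ : (Fin n → ℝ) → ℝ} (h : TF B φ) (k : Fin n)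
    {x : Fin n → ℝ} (hx : x ∉ B) : pd φ k x = 0 := by
  have h1 : x ∉ tsupport φ := fun h' => hx (h.2.2 h')
  have : φ =ᶠ[nhds x] 0 := notMem_tsupport_iff_eventuallyEq.1 h1
  unfold pd; rw [this.fderiv_eq]; simp

/-- vector field with Euclidean values -/
def vec (w : Fin n → (Fin n → ℝ) → ℝ) (x : Fin n → ℝ) : EuclideanSpace ℝ (Fin n) :=
  WithLp.toLp 2 (fun k => w k x)

lemma inner_vec (w z : Fin n → (Fin n → ℝ) → ℝ) (x : Fin n → ℝ) :
    inner ℝ (vec w x) (vec z x) = ∑ k, w k x * z k x := by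
  simp [vec, PiLp.inner_apply, mul_comm]

lemma memLp_vec {μ : Measure (Fin n → ℝ)} [IsFiniteMeasure μ] {w : Fin n → (Fin n → ℝ) → ℝ} {C : ℝ}
    (hm : ∀ k, Measurable (w k)) (hb : ∀ k x, |w k x| ≤ C) : MemLp (vec w) 2 μ := by
  have hm' : Measurable (vec w) := by
    have : Measurable (fun x => fun k => w k x) := measurable_pi_lambda _ hm
    exact (PiLp.continuous_toLp 2 _).measurable.comp this
  refine MemLp.of_bound hm'.aestronglyMeasurable (Real.sqrt (n * C ^ 2)) (ae_of_all _ fun x => ?_)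
  rw [EuclideanSpace.norm_eq]
  apply Real.sqrt_le_sqrt
  calc ∑ k, ‖(vec w x) k‖ ^ 2 ≤ ∑ k : Fin n, C ^ 2 := by
        refine Finset.sum_le_sum fun k _ => ?_
        exact pow_le_pow_left₀ (norm_nonneg _) (hb k x) 2
    _ = _ := by simp

lemma bdd_of_cc {f : (Fin n → ℝ) → ℝ} (hf : Continuous f) (h : HasCompactSupport f) :
    ∃ C, ∀ x, |f x| ≤ C := by
  obtain ⟨C, hC⟩ := h.exists_bound_of_continuous hf
  exact ⟨C, hC⟩

lemma hodge {B : Set (Fin n → ℝ)} (hB : MeasurableSet B) (hBf : volume B ≠ ⊤)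
    (a b : Fin n → (Fin n → ℝ) → ℝ) (C : ℝ)
    (ham : ∀ k, Measurable (a k)) (hbm : ∀ k, Measurable (b k))
    (hab : ∀ k x, |a k x| ≤ C) (hbb : ∀ k x, |b k x| ≤ C)
    (hdiv : ∀ φ, TF B φ → ∫ y, ∑ k, b k y * pd φ k y = 0)
    (hcurl : ∀ φ, TF B φ → ∀ j k, ∫ y, a j y * pd φ k y = ∫ y, a k y * pd φ j y) :
    ∃ H : Fin n → (Fin n → ℝ) → ℝ, (∀ k, MemLp (H k) 2 volume) ∧ (∀ k, ∀ x ∉ B, H k x = 0) ∧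
      (∀ φ, TF B φ → ∫ y, ∑ k, H k y * pd φ k y = 0) ∧
      (∀ φ, TF B φ → ∀ j k, ∫ y, H j y * pd φ k y = ∫ y, H k y * pd φ j y) ∧
      ∫ y in B, ∑ k, (a k y - H k y) ^ 2 ≤ ∫ y in B, ∑ k, (a k y - b k y) ^ 2 := by
  classical
  set μ := (volume : Measure (Fin n → ℝ)).restrict B with hμ
  haveI : IsFiniteMeasure μ := ⟨by rw [hμ, Measure.restrict_apply_univ]; exact lt_top_iff_ne_top.2 hBf⟩
  let X := Lp (EuclideanSpace ℝ (Fin n)) 2 μ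
  -- inner products of representatives
  have hinner : ∀ (f g : X) (w z : Fin n → (Fin n → ℝ) → ℝ), (f =ᵐ[μ] vec w) → (g =ᵐ[μ] vec z) →
      inner ℝ f g = ∫ y in B, ∑ k, w k y * z k y := by
    intro f g w z hf hg
    rw [L2.inner_def]
    apply integral_congr_ae
    filter_upwards [hf, hg] with y h1 h2
    rw [h1, h2, inner_vec]
  -- full-space integrals
  have hfull : ∀ f : (Fin n → ℝ) → ℝ, (∀ x ∉ B, f x = 0) → ∫ y in B, f y = ∫ y, f y := fun f hf =>
    setIntegral_eq_integral_of_forall_compl_eq_zero hf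
  let gr : ((Fin n → ℝ) → ℝ) → Fin n → (Fin n → ℝ) → ℝ := fun φ k => pd φ k
  have hgr : ∀ φ, TF B φ → MemLp (vec (gr φ)) 2 μ := by
    intro φ hφ
    choose D hD using fun k => bdd_of_cc (hφ.pd_cont k) (hφ.pd_cs k)
    refine memLp_vec (C := ∑ k, |D k|) (fun k => measurable_pd _ _) fun k x => ?_
    refine (hD k x).trans ((le_abs_self _).trans ?_)
    exact Finset.single_le_sum (f := fun k => |D k|) (fun i _ => abs_nonneg _) (Finset.mem_univ k)
  let S : Submodule ℝ X := Submodule.span ℝ {p : X | ∃ φ, TF B φ ∧ p =ᵐ[μ] vec (gr φ)}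
  have hperp : ∀ (p : X), (∀ φ, TF B φ → ∀ q : X, q =ᵐ[μ] vec (gr φ) → inner ℝ q p = 0) → p ∈ Sᗮ := by
    intro p hp
    rw [Submodule.mem_orthogonal]
    intro q hq
    induction hq using Submodule.span_induction with
    | mem x h => obtain ⟨φ, hφ, hx⟩ := h; exact hp φ hφ x hx
    | zero => simp
    | add x y _ _ h1 h2 => rw [inner_add_left, h1, h2, add_zero]
    | smul c x _ h => rw [inner_smul_left, h, mul_zero]
  have hA := memLp_vec (μ := μ) ham hab
  have hBm := memLp_vec (μ := μ) hbm hbb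
  let A : X := hA.toLp _
  let Bv : X := hBm.toLp _
  have hAe : A =ᵐ[μ] vec a := hA.coeFn_toLp
  have hBe : Bv =ᵐ[μ] vec b := hBm.coeFn_toLp
  have hBS : Bv ∈ Sᗮ := by
    refine hperp _ fun φ hφ q hq => ?_
    rw [hinner q Bv _ _ hq hBe, hfull]
    · rw [← hdiv φ hφ]; congr 1; ext y; exact Finset.sum_congr rfl fun k _ => mul_comm _ _
    · intro x hx; exact Finset.sum_eq_zero fun k _ => by simp only [gr]; rw [hφ.pd_zero k hx, zero_mul]
  let P : X := Sᗮ.starProjection A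
  have hPS : P ∈ Sᗮ := Submodule.starProjection_apply_mem _ _
  have hAP : A - P ∈ Sᗮᗮ := Submodule.sub_starProjection_mem_orthogonal _
  let H : Fin n → (Fin n → ℝ) → ℝ := fun k => indicator B (fun y => (P y) k)
  have hHe : P =ᵐ[μ] vec H := by
    filter_upwards [ae_restrict_mem hB] with y hy
    ext k; simp [vec, H, hy]
  refine ⟨H, fun k => ?_, fun k x hx => by simp [H, hx], fun φ hφ => ?_, fun φ hφ j k => ?_, ?_⟩
  · rw [memLp_indicator_iff_restrict hB]
    have h1 : MemLp P 2 μ := Lp.memLp P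
    refine h1.mono ?_ (ae_of_all _ fun y => PiLp.norm_apply_le (P y) k)
    exact ((EuclideanSpace.proj k : EuclideanSpace ℝ (Fin n) →L[ℝ] ℝ).continuous.comp_aestronglyMeasurable h1.1)
  · have hq := (hgr φ hφ).coeFn_toLp
    have h1 := (Submodule.mem_orthogonal _ _).1 hPS _ (Submodule.subset_span ⟨φ, hφ, hq⟩)
    rw [hinner _ _ _ _ hq hHe, hfull] at h1
    · rw [← h1]; congr 1; ext y; exact Finset.sum_congr rfl fun k _ => mul_comm _ _
    · intro x hx; exact Finset.sum_eq_zero fun k _ => by simp only [gr]; rw [hφ.pd_zero k hx, zero_mul]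
  · by_cases hjk : j = k
    · rw [hjk]
    let w : Fin n → (Fin n → ℝ) → ℝ := fun l y => (if l = j then pd φ k y else 0) - (if l = k then pd φ j y else 0)
    have hwm : ∀ l, Measurable (w l) := by
      intro l
      apply Measurable.sub
      · by_cases h : l = j <;> simp [h, measurable_pd]
      · by_cases h : l = k <;> simp [h, measurable_pd]
    obtain ⟨D1, hD1⟩ := bdd_of_cc (hφ.pd_cont k) (hφ.pd_cs k)
    obtain ⟨D2, hD2⟩ := bdd_of_cc (hφ.pd_cont j) (hφ.pd_cs j)
    have hD10 := (abs_nonneg _).trans (hD1 0)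
    have hD20 := (abs_nonneg _).trans (hD2 0)
    have hwb : ∀ l x, |w l x| ≤ D1 + D2 := by
      intro l x
      refine (abs_sub _ _).trans (add_le_add ?_ ?_)
      · by_cases h : l = j <;> simp [h, hD1, hD10]
      · by_cases h : l = k <;> simp [h, hD2, hD20]
    have hwL := memLp_vec (μ := μ) hwm hwb
    let W : X := hwL.toLp _
    have hWe : W =ᵐ[μ] vec w := hwL.coeFn_toLp
    have hsum : ∀ z : Fin n → (Fin n → ℝ) → ℝ, ∀ y, ∑ l, z l y * w l y = z j y * pd φ k y - z k y * pd φ j y := by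
      intro z y
      simp [w, mul_sub, Finset.sum_sub_distrib]
    have hzz : ∀ z : Fin n → (Fin n → ℝ) → ℝ, ∀ x ∉ B, z j x * pd φ k x - z k x * pd φ j x = 0 := by
      intro z x hx; rw [hφ.pd_zero k hx, hφ.pd_zero j hx]; ring
    have hWS : W ∈ Sᗮ := by
      refine hperp _ fun ψ hψ q hq => ?_
      rw [hinner q W _ _ hq hWe]
      simp only [hsum]
      rw [hfull _ (hzz _)]
      simp only [gr]
      have hφ1 : ∀ l, ContDiff ℝ 1 (pd φ l) := fun l => pd_contDiff (m := 2) (k := 1) hφ.1 (by norm_num) l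
      have hψ0 : ContDiff ℝ 1 ψ := hψ.1.of_le (by norm_num)
      have i1 : ∀ l m, Integrable (fun y => pd ψ l y * pd φ m y) := fun l m =>
        integrable_of_cc ((hψ.pd_cont l).mul (hφ.pd_cont m)) ((hψ.pd_cs l).mul_right)
      rw [integral_sub (i1 _ _) (i1 _ _), ibp_cc (hφ1 k) hψ0 hψ.2.1, ibp_cc (hφ1 j) hψ0 hψ.2.1]
      have : ∀ y, pd (pd φ k) j y = pd (pd φ j) k y := fun y => pd_comm hφ.1 k j y
      simp [this]
    have e1 : inner ℝ A W = 0 := by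
      rw [hinner _ _ _ _ hAe hWe]
      simp only [hsum]
      rw [hfull _ (hzz _)]
      have i2 : ∀ l m, Integrable (fun y => a l y * pd φ m y) := fun l m =>
        (integrable_of_cc (hφ.pd_cont m) (hφ.pd_cs m)).bdd_mul (ham l).aestronglyMeasurable (ae_of_all _ (hab l))
      rw [integral_sub (i2 _ _) (i2 _ _), hcurl φ hφ j k, sub_self]
    have e2 : inner ℝ P W = 0 := by
      have h3 := (Submodule.mem_orthogonal' _ _).1 hAP W hWS
      rw [inner_sub_left, e1] at h3; linarith
    rw [hinner _ _ _ _ hHe hWe] at e2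
    simp only [hsum] at e2
    rw [hfull _ (hzz _)] at e2
    have hH2 : ∀ l, MemLp (H l) 2 volume := by
      intro l
      rw [memLp_indicator_iff_restrict hB]
      have h1 : MemLp P 2 μ := Lp.memLp P
      refine h1.mono ?_ (ae_of_all _ fun y => PiLp.norm_apply_le (P y) l)
      exact ((EuclideanSpace.proj l : EuclideanSpace ℝ (Fin n) →L[ℝ] ℝ).continuous.comp_aestronglyMeasurable h1.1)
    have i3 : ∀ l m, Integrable (fun y => H l y * pd φ m y) := fun l m =>
      (hH2 l).integrable_mul (q := 2) ((hφ.pd_cont m).memLp_of_hasCompactSupport (hφ.pd_cs m))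
    rw [integral_sub (i3 _ _) (i3 _ _)] at e2
    linarith
  · have h1 : ‖A - P‖ ≤ ‖A - Bv‖ := by
      have h2 : inner ℝ (A - P) (P - Bv) = 0 :=
        (Submodule.mem_orthogonal' _ _).1 hAP _ (Submodule.sub_mem _ hPS hBS)
      have h3 : ‖A - Bv‖ ^ 2 = ‖A - P‖ ^ 2 + ‖P - Bv‖ ^ 2 := by
        rw [show A - Bv = (A - P) + (P - Bv) by abel, norm_add_sq_real, h2]; ring
      nlinarith [norm_nonneg (A - P), norm_nonneg (A - Bv), sq_nonneg ‖P - Bv‖]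
    have h2 : ∀ (Q : X) (q : Fin n → (Fin n → ℝ) → ℝ), Q =ᵐ[μ] vec q →
        ‖A - Q‖ ^ 2 = ∫ y in B, ∑ k, (a k y - q k y) ^ 2 := by
      intro Q q hQ
      have h3 : (A - Q : X) =ᵐ[μ] vec (fun k y => a k y - q k y) := by
        filter_upwards [Lp.coeFn_sub A Q, hAe, hQ] with y h1 h2 h3
        rw [h1]; simp only [Pi.sub_apply]; rw [h2, h3]; ext k; simp [vec]
      rw [← real_inner_self_eq_norm_sq, hinner _ _ _ _ h3 h3]
      congr 1; ext y; exact Finset.sum_congr rfl fun k _ => by ring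
    rw [← h2 P H hHe, ← h2 Bv b hBe]
    gcongr
end GR

namespace GR
variable {n : ℕ}

/-- `cv ρ f x = ∫ ρ(y-x) f(y) dy` -/
def cv (ρ f : (Fin n → ℝ) → ℝ) (x : Fin n → ℝ) : ℝ := ∫ y, ρ (y - x) * f y

lemma cv_eq (ρ f : (Fin n → ℝ) → ℝ) :
    cv ρ f = convolution (fun t => ρ (-t)) f (ContinuousLinearMap.lsmul ℝ ℝ) volume := by
  ext x
  rw [convolution_eq_swap]
  simp [cv]

lemma cs_neg {ρ : (Fin n → ℝ) → ℝ} (h : HasCompactSupport ρ) : HasCompactSupport (fun t => ρ (-t)) :=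
  h.comp_homeomorph (Homeomorph.neg _)

lemma cv_contDiff {ρ f : (Fin n → ℝ) → ℝ} {m : ℕ∞} (hρ : ContDiff ℝ m ρ) (hc : HasCompactSupport ρ)
    (hf : LocallyIntegrable f) : ContDiff ℝ m (cv ρ f) := by
  rw [cv_eq]
  exact (cs_neg hc).contDiff_convolution_left _ (hρ.comp contDiff_neg) hf

lemma pd_cv {ρ f : (Fin n → ℝ) → ℝ} (hρ : ContDiff ℝ 1 ρ) (hc : HasCompactSupport ρ)
    (hf : LocallyIntegrable f) (i : Fin n) (a : Fin n → ℝ) :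
    pd (cv ρ f) i a = - ∫ y, pd ρ i (y - a) * f y := by
  have hρ' : ContDiff ℝ 1 (fun t => ρ (-t)) := hρ.comp contDiff_neg
  have h1 := (cs_neg hc).hasFDerivAt_convolution_left
    (ContinuousLinearMap.lsmul ℝ ℝ) hρ' hf a
  unfold pd
  rw [cv_eq, h1.fderiv]
  have hce : ConvolutionExistsAt (fderiv ℝ (fun t => ρ (-t))) f a ((ContinuousLinearMap.precompL (Fin n → ℝ) (ContinuousLinearMap.lsmul ℝ ℝ))) volume :=
    ((cs_neg hc).fderiv ℝ).convolutionExists_left _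
      (hρ'.continuous_fderiv (by norm_num)) hf a
  rw [convolution_eq_swap, ContinuousLinearMap.integral_apply hce.integrable_swap, ← integral_neg]
  congr 1; ext y
  have h2 : HasFDerivAt (fun t => ρ (-t)) (-(fderiv ℝ ρ (y - a))) (a - y) := by
    have h3 := (hρ.differentiable (by norm_num) (-(a - y))).hasFDerivAt
    have h4 : HasFDerivAt (fun y : Fin n → ℝ => - y) (-ContinuousLinearMap.id ℝ _) (a - y) :=
      (hasFDerivAt_id _).neg
    have := h3.comp (a - y) h4
    refine this.congr_fderiv ?_
    ext; simp
  rw [h2.fderiv]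
  simp [ContinuousLinearMap.precompL_apply]

/-! the radial kernel -/
def sq2 (y : Fin n → ℝ) : ℝ := ∑ i, y i ^ 2

def eta0 (y : Fin n → ℝ) : ℝ := Real.smoothTransition (1 - sq2 y)

lemma sq2_contDiff {m : ℕ∞} : ContDiff ℝ m (sq2 (n := n)) := by unfold sq2; fun_prop

lemma eta0_contDiff {m : ℕ∞} : ContDiff ℝ m (eta0 (n := n)) :=
  Real.smoothTransition.contDiff.comp (contDiff_const.sub sq2_contDiff)

lemma eta0_zero {y : Fin n → ℝ} (h : 1 ≤ sq2 y) : eta0 y = 0 :=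
  Real.smoothTransition.zero_of_nonpos (by linarith)

lemma eta0_nonneg (y : Fin n → ℝ) : 0 ≤ eta0 y := Real.smoothTransition.nonneg _

lemma norm_le_one_of_sq2 {y : Fin n → ℝ} (h : sq2 y ≤ 1) : ‖y‖ ≤ 1 := by
  refine (pi_norm_le_iff_of_nonneg zero_le_one).2 fun i => ?_
  have h1 : y i ^ 2 ≤ sq2 y := Finset.single_le_sum (f := fun i => y i ^ 2) (fun i _ => sq_nonneg _) (Finset.mem_univ i)
  rw [Real.norm_eq_abs]
  exact abs_le_one_iff_mul_self_le_one.2 (by nlinarith)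

lemma eta0_cs : HasCompactSupport (eta0 (n := n)) := by
  refine HasCompactSupport.intro (isCompact_closedBall 0 1) fun y hy => ?_
  apply eta0_zero
  by_contra h
  push Not at h
  exact hy (by simpa using norm_le_one_of_sq2 h.le)

lemma eta0_int_pos : 0 < ∫ y, eta0 (n := n) y := by
  refine (eta0_contDiff (m := 0)).continuous.integral_pos_of_hasCompactSupport_nonneg_nonzero eta0_cs eta0_nonneg (x := 0) ?_
  simp [eta0, sq2]

def eta (y : Fin n → ℝ) : ℝ := (∫ z, eta0 (n := n) z)⁻¹ * eta0 y

lemma eta_contDiff {m : ℕ∞} : ContDiff ℝ m (eta (n := n)) := contDiff_const.mul eta0_contDiff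

lemma eta_cs : HasCompactSupport (eta (n := n)) := eta0_cs.mul_left

lemma eta_nonneg (y : Fin n → ℝ) : 0 ≤ eta y :=
  mul_nonneg (inv_nonneg.2 eta0_int_pos.le) (eta0_nonneg y)

lemma eta_int : ∫ y, eta (n := n) y = 1 := by
  unfold eta; rw [integral_const_mul, inv_mul_cancel₀ eta0_int_pos.ne']

lemma eta_zero {y : Fin n → ℝ} (h : 1 ≤ sq2 y) : eta y = 0 := by rw [eta, eta0_zero h, mul_zero]

lemma eta_zero' {y : Fin n → ℝ} (h : 1 < ‖y‖) : eta y = 0 := by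
  apply eta_zero; by_contra h1; push Not at h1; linarith [norm_le_one_of_sq2 h1.le]

lemma eta_lower : ∃ c > 0, ∀ y : Fin n → ℝ, sq2 y ≤ 1/4 → c ≤ eta y := by
  refine ⟨(∫ z, eta0 (n := n) z)⁻¹ * Real.smoothTransition (3/4), mul_pos (inv_pos.2 eta0_int_pos)
    (Real.smoothTransition.pos_of_pos (by norm_num)), fun y hy => ?_⟩
  unfold eta eta0
  have : 0 < (∫ z, eta0 (n := n) z)⁻¹ := inv_pos.2 eta0_int_pos
  gcongr
  apply Real.smoothTransition.monotone
  linarith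

lemma pd_sq2 (k : Fin n) (y : Fin n → ℝ) : HasFDerivAt (sq2 (n := n)) (fderiv ℝ sq2 y) y ∧ pd sq2 k y = 2 * y k := by
  refine ⟨((sq2_contDiff (m := 1)).differentiable (by norm_num) y).hasFDerivAt, ?_⟩
  unfold pd
  have : HasFDerivAt (sq2 (n := n)) (∑ i, (2 * y i) • (ContinuousLinearMap.proj i : (Fin n → ℝ) →L[ℝ] ℝ)) y := by
    unfold sq2
    apply HasFDerivAt.fun_sum
    intro i _
    have := ((ContinuousLinearMap.proj i : (Fin n → ℝ) →L[ℝ] ℝ).hasFDerivAt (x := y)).pow 2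
    simpa using this
  rw [this.fderiv]
  simp [Pi.single_apply]

lemma pd_eta (k : Fin n) (y : Fin n → ℝ) : ∃ c : ℝ, ∀ k, pd eta k y = c * y k := by
  have h1 : HasDerivAt Real.smoothTransition (deriv Real.smoothTransition (1 - sq2 y)) (1 - sq2 y) :=
    ((Real.smoothTransition.contDiff (n := 1)).differentiable (by norm_num) _).hasDerivAt
  refine ⟨(∫ z, eta0 (n := n) z)⁻¹ * (deriv Real.smoothTransition (1 - sq2 y) * (- 2)), fun k => ?_⟩
  have h2 := h1.comp_hasFDerivAt y ((pd_sq2 k y).1.const_sub 1)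
  have h3 := h2.const_mul (∫ z, eta0 (n := n) z)⁻¹
  unfold pd
  have h4 : fderiv ℝ (eta (n := n)) y = _ := h3.fderiv
  rw [h4]
  have h5 := (pd_sq2 k y).2
  unfold pd at h5
  simp only [ContinuousLinearMap.smul_apply, ContinuousLinearMap.neg_apply, smul_eq_mul, h5]
  ring

/-- rescaled kernel -/
def es (s : ℝ) (z : Fin n → ℝ) : ℝ := (s ^ n)⁻¹ * eta (s⁻¹ • z)

lemma es_contDiff {m : ℕ∞} (s : ℝ) : ContDiff ℝ m (es (n := n) s) :=
  contDiff_const.mul (eta_contDiff.comp (contDiff_id.const_smul s⁻¹))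

lemma es_zero {s : ℝ} (hs : 0 < s) {z : Fin n → ℝ} (h : s < ‖z‖) : es s z = 0 := by
  rw [es, eta_zero', mul_zero]
  rw [norm_smul, norm_inv, Real.norm_eq_abs, abs_of_pos hs, ← div_eq_inv_mul, one_lt_div hs]; exact h

lemma es_cs {s : ℝ} (hs : 0 < s) : HasCompactSupport (es (n := n) s) := by
  refine HasCompactSupport.intro (isCompact_closedBall 0 s) fun y hy => ?_
  apply es_zero hs; simpa using hy

lemma es_nonneg {s : ℝ} (hs : 0 < s) (z : Fin n → ℝ) : 0 ≤ es s z :=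
  mul_nonneg (by positivity) (eta_nonneg _)

lemma es_int {s : ℝ} (hs : 0 < s) : ∫ z, es (n := n) s z = 1 := by
  unfold es
  rw [integral_const_mul, Measure.integral_comp_inv_smul_of_nonneg volume _ hs.le, eta_int]
  simp [hs.ne']

lemma pd_es {s : ℝ} (k : Fin n) (z : Fin n → ℝ) : pd (es s) k z = (s ^ n)⁻¹ * (s⁻¹ * pd eta k (s⁻¹ • z)) := by
  have h1 : HasFDerivAt (fun z : Fin n → ℝ => s⁻¹ • z) (s⁻¹ • ContinuousLinearMap.id ℝ (Fin n → ℝ)) z :=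
    (hasFDerivAt_id z).const_smul s⁻¹
  have h2 := (((eta_contDiff (m := 1)).differentiable (by norm_num) (s⁻¹ • z)).hasFDerivAt.comp z h1).const_mul (s ^ n)⁻¹
  unfold pd
  have h4 : fderiv ℝ (es (n := n) s) z = _ := h2.fderiv
  rw [h4]; simp

lemma es_one : es (n := n) 1 = eta := by ext z; simp [es]

lemma es_rad {s : ℝ} (j k : Fin n) (z : Fin n → ℝ) : z k * pd (es s) j z = z j * pd (es s) k z := by
  obtain ⟨c, hc⟩ := pd_eta j (s⁻¹ • z)
  rw [pd_es, pd_es, hc, hc]; simp; ring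

end GR

namespace GR
variable {n : ℕ}

lemma pd_shift (f : (Fin n → ℝ) → ℝ) (k : Fin n) (x y : Fin n → ℝ) :
    pd (fun y => f (y - x)) k y = pd f k (y - x) := by
  unfold pd; rw [fderiv_comp_sub]

lemma pd_es_cont (s : ℝ) (k : Fin n) : Continuous (pd (es s) k) :=
  (pd_contDiff (m := 2) (k := 1) (es_contDiff s) (by norm_num) k).continuous

lemma es_deriv {s : ℝ} (hs : 0 < s) (z : Fin n → ℝ) :
    HasDerivAt (fun s => es s z) (-s⁻¹ * (n * es s z + ∑ k, z k * pd (es s) k z)) s := by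
  have h1 : HasDerivAt (fun s : ℝ => (s ^ n)⁻¹) (-(n * s ^ (n-1)) / (s ^ n) ^ 2) s :=
    (hasDerivAt_pow n s).inv (by positivity)
  have h2 : HasDerivAt (fun s : ℝ => s⁻¹ • z) ((-(s ^ 2)⁻¹) • z) s := (hasDerivAt_inv hs.ne').smul_const z
  have h3 := ((eta_contDiff (n := n) (m := 1)).differentiable (by norm_num) (s⁻¹ • z)).hasFDerivAt.comp_hasDerivAt s h2
  have h4 := h1.mul h3
  refine h4.congr_deriv ?_
  simp only [Function.comp]
  rw [fderiv_eq_sum]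
  have e1 : ∑ k, z k * pd (es s) k z = (s^n)⁻¹ * s⁻¹ * ∑ k, z k * pd eta k (s⁻¹ • z) := by
    rw [Finset.mul_sum]; refine Finset.sum_congr rfl fun k _ => ?_
    rw [pd_es]; ring
  have e2 : ∑ j, (-(s ^ 2)⁻¹ • z) j * pd eta j (s⁻¹ • z) = -(s^2)⁻¹ * ∑ k, z k * pd eta k (s⁻¹ • z) := by
    rw [Finset.mul_sum]; refine Finset.sum_congr rfl fun k _ => ?_
    simp; ring
  rw [e1, e2, es]
  rcases Nat.eq_zero_or_pos n with rfl | hn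
  · simp
  · have : s ^ n = s * s ^ (n-1) := by rw [← pow_succ']; congr 1; omega
    rw [this]; field_simp; ring

lemma es_deriv_bound : ∃ C ≥ 0, ∀ s > 0, ∀ z : Fin n → ℝ,
    |(-s⁻¹ * (n * es s z + ∑ k, z k * pd (es s) k z))| ≤ C * (s⁻¹) ^ (n+1) := by
  obtain ⟨C0, h0⟩ := bdd_of_cc (eta_contDiff (n := n) (m := 0)).continuous eta_cs
  have hk : ∀ k : Fin n, ∃ C, ∀ y : Fin n → ℝ, |y k * pd eta k y| ≤ C := fun k =>
    bdd_of_cc ((continuous_apply k).mul (pd_contDiff (m := 1) (k := 0) eta_contDiff (by simp) k).continuous)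
      (eta_cs.fderiv_apply ℝ _).mul_left
  choose C1 h1 using hk
  refine ⟨n * |C0| + ∑ k, |C1 k|, by positivity, fun s hs z => ?_⟩
  have e1 : ∑ k, z k * pd (es s) k z = (s^n)⁻¹ * ∑ k, (s⁻¹ • z) k * pd eta k (s⁻¹ • z) := by
    rw [Finset.mul_sum]; refine Finset.sum_congr rfl fun k _ => ?_
    rw [pd_es]; simp; ring
  rw [e1, es, show -s⁻¹ * (n * ((s ^ n)⁻¹ * eta (s⁻¹ • z)) + (s ^ n)⁻¹ * ∑ k, (s⁻¹ • z) k * pd eta k (s⁻¹ • z))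
    = - ((s⁻¹)^(n+1) * (n * eta (s⁻¹ • z) + ∑ k, (s⁻¹ • z) k * pd eta k (s⁻¹ • z))) by
      rw [pow_succ, inv_pow]; ring, abs_neg, abs_mul, abs_of_pos (by positivity), mul_comm]
  gcongr
  refine (abs_add_le _ _).trans (add_le_add ?_ ?_)
  · rw [abs_mul, Nat.abs_cast]; exact mul_le_mul_of_nonneg_left ((h0 _).trans (le_abs_self _)) (by positivity)
  · exact (Finset.abs_sum_le_sum_abs _ _).trans (Finset.sum_le_sum fun k _ => (h1 k _).trans (le_abs_self _))

/-- the test function `(y_k - x_k) ζ(y-x)` -/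
def tph (s : ℝ) (x : Fin n → ℝ) (k : Fin n) (y : Fin n → ℝ) : ℝ := (y - x) k * es s (y - x)

lemma tph_pd (s : ℝ) (x : Fin n → ℝ) (k l : Fin n) (y : Fin n → ℝ) :
    pd (tph s x k) l y = (if k = l then es s (y - x) else 0) + (y - x) k * pd (es s) l (y - x) := by
  have : tph s x k = fun y => (fun z : Fin n → ℝ => z k * es s z) (y - x) := rfl
  rw [this, pd_shift (fun z : Fin n → ℝ => z k * es s z)]
  unfold pd
  have h1 : HasFDerivAt (fun z : Fin n → ℝ => z k) (ContinuousLinearMap.proj k : (Fin n → ℝ) →L[ℝ] ℝ) (y - x) :=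
    (ContinuousLinearMap.proj k : (Fin n → ℝ) →L[ℝ] ℝ).hasFDerivAt
  have h2 := h1.mul ((es_contDiff (m := 1) s).differentiable (by norm_num) (y - x)).hasFDerivAt
  have h3 : fderiv ℝ (fun z : Fin n → ℝ => z k * es s z) (y - x) = _ := h2.fderiv
  rw [h3]
  simp [Pi.single_apply, add_comm]

lemma tsupport_shift {f : (Fin n → ℝ) → ℝ} {s : ℝ} (h : ∀ z, s < ‖z‖ → f z = 0) (x : Fin n → ℝ) :
    tsupport (fun y => f (y - x)) ⊆ Metric.closedBall x s := by
  refine closure_minimal (fun y hy => ?_) Metric.isClosed_closedBall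
  rw [Metric.mem_closedBall, dist_eq_norm]
  by_contra h'
  exact hy (h _ (not_le.1 h'))

lemma TF_shift {f : (Fin n → ℝ) → ℝ} (hf : ContDiff ℝ 2 f) {s : ℝ} (h : ∀ z, s < ‖z‖ → f z = 0) {x : Fin n → ℝ} {r : ℝ}
    (hx : ‖x‖ + s < r) : TF (Metric.ball 0 r) (fun y => f (y - x)) := by
  have h1 := tsupport_shift h x
  refine ⟨hf.comp (contDiff_id.sub contDiff_const), ?_, h1.trans ?_⟩
  · exact (isCompact_closedBall x s).of_isClosed_subset (isClosed_tsupport _) h1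
  · intro y hy
    rw [Metric.mem_closedBall, dist_eq_norm] at hy
    rw [mem_ball_zero_iff]
    have : ‖y‖ ≤ ‖y - x‖ + ‖x‖ := by simpa using norm_add_le (y - x) x
    linarith

lemma tph_TF {s : ℝ} (hs : 0 < s) {x : Fin n → ℝ} {r : ℝ} (hx : ‖x‖ + s < r) (k : Fin n) :
    TF (Metric.ball 0 r) (tph s x k) := by
  refine TF_shift (f := fun z : Fin n → ℝ => z k * es s z) ((contDiff_apply ℝ ℝ k).mul (es_contDiff (m := 2) s)) ?_ hx
  intro z hz; simp [es_zero hs hz]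

/-- weakly div and curl free on a ball -/
def WF (r : ℝ) (H : Fin n → (Fin n → ℝ) → ℝ) : Prop :=
  (∀ φ, TF (Metric.ball 0 r) φ → ∫ y, ∑ k, H k y * pd φ k y = 0) ∧
      (∀ φ, TF (Metric.ball 0 r) φ → ∀ j k, ∫ y, H j y * pd φ k y = ∫ y, H k y * pd φ j y)

lemma int_mul_cc {f g : (Fin n → ℝ) → ℝ} (hf : LocallyIntegrable f) (hg : Continuous g) (hc : HasCompactSupport g) :
    Integrable (fun y => f y * g y) := by
  have := hf.integrable_smul_right_of_hasCompactSupport hg hc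
  simpa using this

lemma m_deriv_zero {r : ℝ} {H : Fin n → (Fin n → ℝ) → ℝ} (hI : ∀ k, Integrable (H k)) (hW : WF r H)
    {s : ℝ} (hs : 0 < s) {x : Fin n → ℝ} (hx : ‖x‖ + s < r) (j : Fin n) :
    HasDerivAt (fun s => ∫ y, es s (y - x) * H j y) 0 s := by
  obtain ⟨C, hC0, hC⟩ := es_deriv_bound (n := n)
  have hcont : ∀ (s : ℝ) (f : (Fin n → ℝ) → ℝ), Continuous f → Continuous (fun y => f (y - x)) := fun s f hf =>
    hf.comp (continuous_id.sub continuous_const)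
  have hes : ∀ s, Continuous (fun y => es s (y - x)) := fun s => hcont s _ (es_contDiff (m := 0) s).continuous
  have key := hasDerivAt_integral_of_dominated_loc_of_deriv_le (μ := (volume : Measure (Fin n → ℝ)))
    (F := fun s y => es s (y - x) * H j y)
    (F' := fun s y => (-s⁻¹ * (n * es s (y - x) + ∑ k, (y - x) k * pd (es s) k (y - x))) * H j y)
    (x₀ := s) (s := Ioo (s/2) (2*s)) (bound := fun y => C * ((s/2)⁻¹)^(n+1) * |H j y|)
    (Ioo_mem_nhds (by linarith) (by linarith))
    (Filter.Eventually.of_forall fun t => ((hes t).aestronglyMeasurable.mul (hI j).1))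
    ?_ ?_ ?_ ((hI j).abs.const_mul _) ?_
  · refine key.2.congr_deriv ?_
    have e : ∀ y, (-s⁻¹ * (n * es s (y - x) + ∑ k, (y - x) k * pd (es s) k (y - x))) * H j y
        = -s⁻¹ * ∑ k, H j y * pd (tph s x k) k y := by
      intro y
      rw [show ∑ k, H j y * pd (tph s x k) k y = H j y * ∑ k, pd (tph s x k) k y by rw [Finset.mul_sum]]
      simp only [tph_pd, if_true, Finset.sum_add_distrib, Finset.sum_const, Finset.card_univ, Fintype.card_fin, nsmul_eq_mul]
      ring
    simp only [e]
    rw [integral_const_mul]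
    have hintg : ∀ i k l, Integrable (fun y => H i y * pd (tph s x k) l y) := fun i k l =>
      int_mul_cc (hI i).locallyIntegrable ((tph_TF hs hx k).pd_cont l) ((tph_TF hs hx k).pd_cs l)
    rw [integral_finsetSum _ fun k _ => hintg j k k]
    have e2 : ∀ k, ∫ y, H j y * pd (tph s x k) k y = ∫ y, H k y * pd (tph s x j) k y := by
      intro k
      rw [hW.2 _ (tph_TF hs hx k) j k]
      congr 1; ext y
      rw [tph_pd, tph_pd]
      have := es_rad (s := s) j k (y - x)
      rw [this]; simp only [eq_comm]
    simp only [e2]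
    rw [← integral_finsetSum _ fun k _ => hintg k j k, hW.1 _ (tph_TF hs hx j), mul_zero]
  · have : HasCompactSupport (fun y => es s (y - x)) := (TF_shift (es_contDiff (m := 2) s) (fun z hz => es_zero hs hz) hx).2.1
    simpa only [mul_comm] using int_mul_cc (hI j).locallyIntegrable (hes s) this
  · refine Continuous.aestronglyMeasurable ?_ |>.mul (hI j).1
    refine continuous_const.mul ((continuous_const.mul (hes s)).add (continuous_finsetSum _ fun k _ => ?_))
    exact hcont s (fun z => z k * pd (es s) k z) ((continuous_apply k).mul (pd_es_cont s k))
  · refine ae_of_all _ fun y t ht => ?_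
    have ht0 : 0 < t := by linarith [ht.1]
    rw [norm_mul, Real.norm_eq_abs, Real.norm_eq_abs]
    refine mul_le_mul_of_nonneg_right ((hC t ht0 _).trans ?_) (abs_nonneg _)
    have := ht.1
    gcongr
  · refine ae_of_all _ fun y t ht => ?_
    have ht0 : 0 < t := by linarith [ht.1]
    exact (es_deriv ht0 (y - x)).mul_const _

lemma m_const {r : ℝ} {H : Fin n → (Fin n → ℝ) → ℝ} (hI : ∀ k, Integrable (H k)) (hW : WF r H)
    {s t : ℝ} (hs : 0 < s) (ht : 0 < t) {x : Fin n → ℝ} (hx : ‖x‖ + s < r) (hx' : ‖x‖ + t < r) (j : Fin n) :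
    cv (es s) (H j) x = cv (es t) (H j) x := by
  have hd : ∀ s ∈ Ioo 0 (r - ‖x‖), HasDerivAt (fun s => ∫ y, es s (y - x) * H j y) 0 s := fun s hs =>
    m_deriv_zero hI hW hs.1 (by linarith [hs.2]) j
  have := isOpen_Ioo.is_const_of_deriv_eq_zero (s := Ioo 0 (r - ‖x‖)) isPreconnected_Ioo
    (fun s hs => (hd s hs).differentiableAt.differentiableWithinAt) (fun s hs => (hd s hs).deriv)
    (x := s) (y := t) ⟨hs, by linarith⟩ ⟨ht, by linarith⟩
  exact this

lemma es_bound : ∃ C ≥ 0, ∀ s > 0, ∀ z : Fin n → ℝ, |es s z| ≤ C * (s^n)⁻¹ := by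
  obtain ⟨C0, h0⟩ := bdd_of_cc (eta_contDiff (n := n) (m := 0)).continuous eta_cs
  refine ⟨|C0|, abs_nonneg _, fun s hs z => ?_⟩
  rw [es, abs_mul, abs_of_pos (by positivity), mul_comm]
  exact mul_le_mul_of_nonneg_right ((h0 _).trans (le_abs_self _)) (by positivity)

lemma cv_es_tendsto {f : (Fin n → ℝ) → ℝ} (hf : LocallyIntegrable f) :
    ∀ᵐ x, Filter.Tendsto (fun s => cv (es s) f x) (nhdsWithin 0 (Ioi 0)) (nhds (f x)) := by
  obtain ⟨C, hC0, hC⟩ := es_bound (n := n)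
  filter_upwards [IsUnifLocDoublingMeasure.ae_tendsto_average_norm_sub volume hf 1] with x hx
  have h1 := hx (l := nhdsWithin (0:ℝ) (Ioi 0)) (fun _ => x) (fun s => s) Filter.tendsto_id
    (Filter.eventually_of_mem self_mem_nhdsWithin fun s hs => by
      simp only [Metric.mem_closedBall, dist_self, one_mul]; exact (le_of_lt hs))
  rw [tendsto_iff_norm_sub_tendsto_zero]
  have h2 : Filter.Tendsto (fun s : ℝ => C * 2 ^ n * ⨍ y in Metric.closedBall x s, ‖f y - f x‖) (nhdsWithin 0 (Ioi 0)) (nhds 0) := by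
    simpa using h1.const_mul (C * 2 ^ n)
  refine squeeze_zero' (Filter.Eventually.of_forall fun _ => norm_nonneg _) ?_ h2
  refine Filter.eventually_of_mem self_mem_nhdsWithin fun s hs => ?_
  have hs : 0 < s := hs
  have hcs : HasCompactSupport (fun y => es s (y - x)) :=
    (TF_shift (r := ‖x‖ + s + 1) (es_contDiff (m := 2) s) (fun z hz => es_zero hs hz) (by linarith)).2.1
  have hco : Continuous (fun y => es s (y - x)) := (es_contDiff (m := 0) s).continuous.comp (continuous_id.sub continuous_const)
  have e1 : cv (es s) f x - f x = ∫ y in Metric.closedBall x s, es s (y - x) * (f y - f x) := by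
    rw [setIntegral_eq_integral_of_forall_compl_eq_zero]
    · simp only [mul_sub]
      rw [integral_sub (by simpa only [mul_comm] using int_mul_cc hf hco hcs) ((integrable_of_cc hco hcs).mul_const _),
        integral_mul_const, integral_sub_right_eq_self (es s), es_int hs, one_mul]; rfl
    · intro y hy
      rw [es_zero hs, zero_mul]
      simpa [dist_eq_norm] using hy
  rw [e1]
  refine (norm_integral_le_integral_norm _).trans ?_
  have hintg : IntegrableOn (fun y => ‖f y - f x‖) (Metric.closedBall x s) :=
    ((hf.integrableOn_isCompact (isCompact_closedBall x s)).sub (integrableOn_const (by exact (isCompact_closedBall x s).measure_lt_top.ne))).norm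
  calc ∫ y in Metric.closedBall x s, ‖es s (y - x) * (f y - f x)‖
      ≤ ∫ y in Metric.closedBall x s, (C * (s^n)⁻¹) * ‖f y - f x‖ := by
        refine integral_mono_of_nonneg (ae_of_all _ fun _ => norm_nonneg _) (hintg.const_mul _) (ae_of_all _ fun y => ?_)
        simp only [norm_mul]
        exact mul_le_mul_of_nonneg_right (hC s hs _) (norm_nonneg _)
    _ = _ := by
        rw [integral_const_mul, setAverage_eq, Measure.real, Real.volume_pi_closedBall _ hs.le, ENNReal.toReal_ofReal (by positivity)]
        simp only [Fintype.card_fin, smul_eq_mul, mul_pow, mul_inv]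
        field_simp

end GR

namespace GR
variable {n : ℕ}

/-- functions with the mean value property -/
def HM (f : (Fin n → ℝ) → ℝ) : Prop :=
  ContDiff ℝ 2 f ∧ ∀ x ∈ Metric.ball (0 : Fin n → ℝ) 6, ∀ s ∈ Ioo (0:ℝ) 2, cv (es s) f x = f x

lemma cs_shift {g : (Fin n → ℝ) → ℝ} (hc : HasCompactSupport g) (x : Fin n → ℝ) : HasCompactSupport (fun y => g (y - x)) :=
  hc.comp_homeomorph (Homeomorph.subRight x)

lemma cont_shift {g : (Fin n → ℝ) → ℝ} (hc : Continuous g) (x : Fin n → ℝ) : Continuous (fun y => g (y - x)) :=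
  hc.comp (continuous_id.sub continuous_const)

lemma int_ker {g f : (Fin n → ℝ) → ℝ} (hg : Continuous g) (hc : HasCompactSupport g) (hf : Continuous f) (x : Fin n → ℝ) :
    Integrable (fun y => g (y - x) * f y) :=
  integrable_of_cc ((cont_shift hg x).mul hf) (cs_shift hc x).mul_right

lemma es_cont (s : ℝ) : Continuous (es (n := n) s) := (es_contDiff (m := 0) s).continuous

lemma pd_es_cs {s : ℝ} (hs : 0 < s) (k : Fin n) : HasCompactSupport (pd (es s) k) := (es_cs hs).fderiv_apply ℝ _

lemma es_int_shift {s : ℝ} (hs : 0 < s) (x : Fin n → ℝ) : ∫ y, es s (y - x) = 1 := by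
  rw [integral_sub_right_eq_self (es s), es_int hs]

lemma HM.const (c : ℝ) : HM (fun _ : Fin n → ℝ => c) :=
  ⟨contDiff_const, fun x _ s hs => by rw [cv, integral_mul_const, es_int_shift hs.1, one_mul]⟩

lemma HM.add {f g : (Fin n → ℝ) → ℝ} (hf : HM f) (hg : HM g) : HM (fun x => f x + g x) :=
  ⟨hf.1.add hg.1, fun x hx s hs => by
    show _ = f x + g x
    rw [← hf.2 x hx s hs, ← hg.2 x hx s hs, cv, cv, cv, ← integral_add
      (int_ker (es_cont s) (es_cs hs.1) hf.1.continuous x) (int_ker (es_cont s) (es_cs hs.1) hg.1.continuous x)]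
    simp only [mul_add]⟩

lemma HM.cmul {f : (Fin n → ℝ) → ℝ} (hf : HM f) (c : ℝ) : HM (fun x => c * f x) :=
  ⟨contDiff_const.mul hf.1, fun x hx s hs => by
    show _ = c * f x
    rw [← hf.2 x hx s hs, cv, cv, ← integral_const_mul]
    congr 1; ext y; ring⟩

lemma HM.sum {ι : Type*} (t : Finset ι) {f : ι → (Fin n → ℝ) → ℝ} (hf : ∀ i, HM (f i)) : HM (fun x => ∑ i ∈ t, f i x) := by
  classical
  induction t using Finset.induction_on with
  | empty => simpa using HM.const (n := n) 0
  | insert a t ha ih => simp only [Finset.sum_insert ha]; exact (hf a).add ih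

lemma HM.sub_const {f : (Fin n → ℝ) → ℝ} (hf : HM f) (c : ℝ) : HM (fun x => f x - c) := by
  simpa only [sub_eq_add_neg] using hf.add (HM.const (-c))

lemma HM.pd_eq {f : (Fin n → ℝ) → ℝ} (hf : HM f) {x : Fin n → ℝ} (hx : x ∈ Metric.ball (0 : Fin n → ℝ) 6)
    {s : ℝ} (hs : s ∈ Ioo (0:ℝ) 2) (k : Fin n) : pd f k x = - ∫ y, pd (es s) k (y - x) * f y := by
  rw [← pd_cv (es_contDiff (m := 1) s) (es_cs hs.1) hf.1.continuous.locallyIntegrable]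
  unfold pd
  have : f =ᶠ[nhds x] cv (es s) f := by
    filter_upwards [Metric.isOpen_ball.mem_nhds hx] with y hy
    exact (hf.2 y hy s hs).symm
  rw [this.fderiv_eq]

lemma HM.pd_eq' {f : (Fin n → ℝ) → ℝ} (hf : HM f) {x : Fin n → ℝ} (hx : x ∈ Metric.ball (0 : Fin n → ℝ) 6)
    {s : ℝ} (hs : s ∈ Ioo (0:ℝ) 2) (k : Fin n) : pd f k x = ∫ y, es s (y - x) * pd f k y := by
  rw [hf.pd_eq hx hs]
  have := ibp_cc (hf.1.of_le (by norm_num)) ((es_contDiff (m := 1) s).comp (contDiff_id.sub (contDiff_const (c := x))))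
    (cs_shift (es_cs hs.1) x) k
  have e : ∀ y, pd (es s ∘ fun y => id y - x) k y = pd (es s) k (y - x) := fun y => pd_shift _ _ _ _
  simp only [e] at this
  rw [this]; simp

lemma cs_ineq {g f : (Fin n → ℝ) → ℝ} (hg : Continuous g) (hc : HasCompactSupport g) (hf : Continuous f) :
    (∫ y, g y * f y) ^ 2 ≤ (∫ y, |g y|) * ∫ y, |g y| * f y ^ 2 := by
  have hI : ∀ p : (Fin n → ℝ) → ℝ, Continuous p → Integrable (fun y => |g y| * p y) := fun p hp =>
    integrable_of_cc (hg.abs.mul hp) hc.norm.mul_right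
  set I := ∫ y, |g y| * |f y|
  have h1 : |∫ y, g y * f y| ≤ I := by
    refine (norm_integral_le_integral_norm (fun y => g y * f y)).trans (le_of_eq ?_)
    simp only [norm_mul, Real.norm_eq_abs]; rfl
  have h2 : ∀ t : ℝ, 0 ≤ (∫ y, |g y|) * (t * t) + (-2 * I) * t + ∫ y, |g y| * f y ^ 2 := by
    intro t
    have e : ∫ y, |g y| * (|f y| - t) ^ 2 = (∫ y, |g y|) * (t * t) + (-2 * I) * t + ∫ y, |g y| * f y ^ 2 := by
      have e1 : ∀ y, |g y| * (|f y| - t) ^ 2 = |g y| * 1 * (t * t) + |g y| * |f y| * (-2 * t) + |g y| * f y ^ 2 := by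
        intro y; rw [← sq_abs (f y)]; ring
      simp only [e1]
      have i1 : Integrable (fun y => |g y| * 1 * (t * t)) := (hI _ continuous_const).mul_const _
      have i2 : Integrable (fun y => |g y| * |f y| * (-2 * t)) := (hI _ hf.abs).mul_const _
      have i3 : Integrable (fun y => |g y| * f y ^ 2) := hI _ (hf.pow 2)
      rw [integral_add (by exact i1.add i2) i3, integral_add i1 i2, integral_mul_const, integral_mul_const (-2 * t)]
      simp only [mul_one]; ring
    rw [← e]; exact integral_nonneg fun y => mul_nonneg (abs_nonneg _) (sq_nonneg _)
  have h3 := discrim_le_zero h2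
  rw [discrim] at h3
  have h4 : (∫ y, g y * f y) ^ 2 ≤ I ^ 2 := by rw [← sq_abs]; exact pow_le_pow_left₀ (abs_nonneg _) h1 2
  nlinarith

/-- Bound of kernel integrals by L² norms -/
lemma ker_bound {g : (Fin n → ℝ) → ℝ} (hg : Continuous g) (hc : HasCompactSupport g) {s : ℝ} (hz : ∀ z, s < ‖z‖ → g z = 0) :
    ∃ C ≥ 0, ∀ f : (Fin n → ℝ) → ℝ, Continuous f → ∀ (x : Fin n → ℝ) (r : ℝ), ‖x‖ + s < r →
      (∫ y, g (y - x) * f y) ^ 2 ≤ C * ∫ y in Metric.ball 0 r, f y ^ 2 := by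
  obtain ⟨C1, hC1⟩ := bdd_of_cc hg hc
  refine ⟨(∫ y, |g y|) * |C1|, mul_nonneg (integral_nonneg fun _ => abs_nonneg _) (abs_nonneg _), fun f hf x r hx => ?_⟩
  refine (cs_ineq (cont_shift hg x) (cs_shift hc x) hf).trans ?_
  rw [integral_sub_right_eq_self (fun y => |g y|), mul_assoc]
  refine mul_le_mul_of_nonneg_left ?_ (integral_nonneg fun _ => abs_nonneg _)
  have e : ∫ y, |g (y - x)| * f y ^ 2 = ∫ y in Metric.ball 0 r, |g (y - x)| * f y ^ 2 := by
    symm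
    apply setIntegral_eq_integral_of_forall_compl_eq_zero
    intro y hy
    rw [hz, abs_zero, zero_mul]
    by_contra h; push Not at h
    apply hy
    rw [mem_ball_zero_iff]
    have : ‖y‖ ≤ ‖y - x‖ + ‖x‖ := by simpa using norm_add_le (y - x) x
    linarith
  rw [e, ← integral_const_mul]
  refine integral_mono_of_nonneg (ae_of_all _ fun y => by positivity) ?_ (ae_of_all _ fun y => ?_)
  · refine Integrable.const_mul ?_ _
    exact ((hf.pow 2).continuousOn.integrableOn_compact (isCompact_closedBall 0 r)).mono_set Metric.ball_subset_closedBall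
  · exact mul_le_mul_of_nonneg_right ((hC1 _).trans (le_abs_self _)) (sq_nonneg _)

lemma pd_es_zero {s : ℝ} (hs : 0 < s) (k : Fin n) {z : Fin n → ℝ} (hz : s < ‖z‖) : pd (es s) k z = 0 := by
  have : es s =ᶠ[nhds z] fun _ => (0:ℝ) := by
    filter_upwards [(isOpen_lt continuous_const continuous_norm).mem_nhds hz] with y hy
    exact es_zero hs hy
  unfold pd; rw [this.fderiv_eq]; simp

/-- interior estimates -/
lemma HM_est : ∃ C ≥ 0, ∀ f : (Fin n → ℝ) → ℝ, HM f → ∀ x r, ‖x‖ < 6 → ‖x‖ + 1 < r →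
    f x ^ 2 ≤ C * (∫ y in Metric.ball 0 r, f y ^ 2) ∧
    (∀ k, pd f k x ^ 2 ≤ C * ∫ y in Metric.ball 0 r, f y ^ 2) ∧
    (∀ k, pd f k x ^ 2 ≤ C * ∫ y in Metric.ball 0 r, pd f k y ^ 2) := by
  obtain ⟨C1, h10, h1⟩ := ker_bound (es_cont (n := n) 1) (es_cs one_pos) (s := 1) (fun z hz => es_zero one_pos hz)
  have : ∀ k : Fin n, _ := fun k => ker_bound (pd_es_cont (n := n) 1 k) (pd_es_cs one_pos k) (s := 1) (fun z hz => pd_es_zero one_pos k hz)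
  choose C2 h20 h2 using this
  have hs1 : (1:ℝ) ∈ Ioo (0:ℝ) 2 := ⟨by norm_num, by norm_num⟩
  refine ⟨C1 + ∑ k, C2 k, add_nonneg h10 (Finset.sum_nonneg fun k _ => h20 k), fun f hf x r hx hr => ?_⟩
  have hx' : x ∈ Metric.ball (0 : Fin n → ℝ) 6 := by simpa using hx
  have hi : ∀ g : (Fin n → ℝ) → ℝ, 0 ≤ ∫ y in Metric.ball 0 r, g y ^ 2 := fun g => integral_nonneg fun _ => sq_nonneg _
  have hle : C1 ≤ C1 + ∑ k, C2 k := le_add_of_nonneg_right (Finset.sum_nonneg fun k _ => h20 k)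
  refine ⟨?_, fun k => ?_, fun k => ?_⟩
  · have := h1 f hf.1.continuous x r hr
    rw [← hf.2 x hx' 1 hs1]
    exact this.trans (mul_le_mul_of_nonneg_right hle (hi _))
  · have := h2 k f hf.1.continuous x r hr
    rw [hf.pd_eq hx' hs1 k, neg_sq]
    refine this.trans (mul_le_mul_of_nonneg_right ?_ (hi _))
    have := Finset.single_le_sum (f := C2) (fun i _ => h20 i) (Finset.mem_univ k)
    linarith
  · have := h1 (pd f k) (pd_contDiff (m := 2) (k := 1) hf.1 (by norm_num) k).continuous x r hr
    rw [hf.pd_eq' hx' hs1 k]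
    exact this.trans (mul_le_mul_of_nonneg_right hle (hi _))

lemma norm_le_sq2 {y : Fin n → ℝ} {a : ℝ} (ha : 0 < a) (h : sq2 y ≤ a ^ 2) : ‖y‖ ≤ a := by
  refine (pi_norm_le_iff_of_nonneg ha.le).2 fun i => ?_
  have h1 : y i ^ 2 ≤ sq2 y := Finset.single_le_sum (f := fun i => y i ^ 2) (fun i _ => sq_nonneg _) (Finset.mem_univ i)
  rw [Real.norm_eq_abs]
  exact abs_le_of_sq_le_sq (h1.trans h) ha.le

lemma pd_es_half : ∃ C ≥ 0, ∀ k (z : Fin n → ℝ), |pd (es (1/2)) k z| ≤ C * eta z := by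
  obtain ⟨c, hc, h⟩ := eta_lower (n := n)
  have hk : ∀ k : Fin n, _ := fun k => bdd_of_cc (pd_es_cont (n := n) (1/2) k) (pd_es_cs (by norm_num) k)
  choose C1 h1 using hk
  refine ⟨(∑ k, |C1 k|) * c⁻¹, by positivity, fun k z => ?_⟩
  by_cases hz : sq2 z ≤ 1/4
  · calc _ ≤ |C1 k| := (h1 k z).trans (le_abs_self _)
      _ ≤ ∑ k, |C1 k| := Finset.single_le_sum (f := fun k => |C1 k|) (fun i _ => abs_nonneg _) (Finset.mem_univ k)
      _ = (∑ k, |C1 k|) * c⁻¹ * c := by field_simp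
      _ ≤ _ := by gcongr; exact h z hz
  · have : es (1/2) =ᶠ[nhds z] fun _ => (0:ℝ) := by
      push Not at hz
      filter_upwards [(isOpen_lt continuous_const (sq2_contDiff (m := 0)).continuous).mem_nhds hz] with y hy
      rw [es, eta_zero, mul_zero]
      have e : sq2 ((1/2:ℝ)⁻¹ • y) = 4 * sq2 y := by
        simp only [sq2, Finset.mul_sum]; refine Finset.sum_congr rfl fun i _ => ?_
        simp; ring
      rw [e]; have : 1/4 < sq2 y := hy
      linarith
    have e : pd (es (1/2)) k z = 0 := by unfold pd; rw [this.fderiv_eq]; simp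
    rw [e, abs_zero]
    exact mul_nonneg (by positivity) (eta_nonneg z)

/-- gradient bounded by the variance -/
lemma HM_var : ∃ C ≥ 0, ∀ f : (Fin n → ℝ) → ℝ, HM f → ∀ x, ‖x‖ < 6 → ∀ k,
    pd f k x ^ 2 ≤ C * ((∫ y, eta (y - x) * f y ^ 2) - f x ^ 2) := by
  obtain ⟨C, hC0, hC⟩ := pd_es_half (n := n)
  have hk : ∀ k : Fin n, 0 ≤ ∫ y, |pd (es (1/2)) k y| := fun k => integral_nonneg fun _ => abs_nonneg _
  refine ⟨(∑ k : Fin n, ∫ y, |pd (es (1/2)) k y|) * C, mul_nonneg (Finset.sum_nonneg fun k _ => hk k) hC0, fun f hf x hx k => ?_⟩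
  have hx' : x ∈ Metric.ball (0 : Fin n → ℝ) 6 := by simpa using hx
  have hc : Continuous (eta (n := n)) := (eta_contDiff (m := 0)).continuous
  have hv : ∫ y, eta (y - x) * (f y - f x) ^ 2 = (∫ y, eta (y - x) * f y ^ 2) - f x ^ 2 := by
    have e : ∀ y, eta (y - x) * (f y - f x) ^ 2 = eta (y - x) * f y ^ 2 + (eta (y - x) * f y * (-2 * f x) + eta (y - x) * f x ^ 2) := by
      intro y; ring
    simp only [e]
    have i1 : Integrable (fun y => eta (y - x) * f y ^ 2) := int_ker hc eta_cs (hf.1.continuous.pow 2) x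
    have i2 : Integrable (fun y => eta (y - x) * f y * (-2 * f x)) := (int_ker hc eta_cs hf.1.continuous x).mul_const _
    have i3 : Integrable (fun y => eta (y - x) * f x ^ 2) := int_ker hc eta_cs continuous_const x
    rw [integral_add i1 (by exact i2.add i3), integral_add i2 i3, integral_mul_const, integral_mul_const,
      integral_sub_right_eq_self (eta (n := n)), eta_int]
    have := hf.2 x hx' 1 ⟨by norm_num, by norm_num⟩
    rw [es_one, cv] at this
    rw [this]; ring
  have h1 := (hf.sub_const (f x)).pd_eq hx' (s := 1/2) ⟨by norm_num, by norm_num⟩ k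
  have e1 : pd (fun y => f y - f x) k x = pd f k x := by unfold pd; rw [fderiv_sub_const]
  rw [← e1, h1, neg_sq, ← hv, mul_assoc]
  have h2 := cs_ineq (cont_shift (pd_es_cont (n := n) (1/2) k) x) (cs_shift (pd_es_cs (by norm_num) k) x)
    (hf.1.continuous.sub (continuous_const (y := f x)))
  refine h2.trans ?_
  rw [integral_sub_right_eq_self (fun y => |pd (es (1/2)) k y|)]
  have h3 : ∫ y, |pd (es (1/2)) k (y - x)| * (f y - f x) ^ 2 ≤ C * ∫ y, eta (y - x) * (f y - f x) ^ 2 := by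
    rw [← integral_const_mul]
    refine integral_mono_of_nonneg (ae_of_all _ fun y => by positivity) ((int_ker hc eta_cs ((hf.1.continuous.sub continuous_const).pow 2) x).const_mul _) (ae_of_all _ fun y => ?_)
    have := hC k (y - x)
    simp only
    rw [← mul_assoc]
    exact mul_le_mul_of_nonneg_right this (sq_nonneg _)
  refine mul_le_mul ?_ h3 (integral_nonneg fun y => by positivity) (Finset.sum_nonneg fun k _ => hk k)
  exact Finset.single_le_sum (f := fun k : Fin n => ∫ y, |pd (es (1/2)) k y|) (fun i _ => hk i) (Finset.mem_univ k)

/-- from weakly harmonic fields to smooth ones -/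
lemma harm {H : Fin n → (Fin n → ℝ) → ℝ} (hI : ∀ k, Integrable (H k)) (hW : WF 10 H) :
    ∃ h : Fin n → (Fin n → ℝ) → ℝ, (∀ k, HM (h k)) ∧ (∀ j k, ∀ x, ‖x‖ < 8 → pd (h j) k x = pd (h k) j x) ∧
      ∀ᵐ x, ∀ k, ‖x‖ < 8 → H k x = h k x := by
  have hae : ∀ᵐ x, ∀ k, ‖x‖ < 8 → H k x = cv eta (H k) x := by
    rw [ae_all_iff]; intro k
    filter_upwards [cv_es_tendsto (hI k).locallyIntegrable] with x hx hx8
    refine tendsto_nhds_unique hx ?_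
    refine tendsto_const_nhds.congr' ?_
    filter_upwards [Ioo_mem_nhdsGT (show (0:ℝ) < 2 by norm_num)] with s hs
    rw [← es_one]
    exact m_const hI hW one_pos hs.1 (by linarith) (by linarith [hs.2]) k
  refine ⟨fun k => cv eta (H k), fun k => ⟨?_, fun x hx s hs => ?_⟩, fun j k x hx => ?_, hae⟩
  · exact cv_contDiff (m := 2) eta_contDiff eta_cs (hI k).locallyIntegrable
  · rw [mem_ball_zero_iff] at hx
    have : cv (es s) (cv eta (H k)) x = cv (es s) (H k) x := by
      unfold cv
      apply integral_congr_ae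
      filter_upwards [hae] with y hy
      by_cases h : ‖y - x‖ ≤ s
      · have hy8 : ‖y‖ < 8 := by
          have : ‖y‖ ≤ ‖y - x‖ + ‖x‖ := by simpa using norm_add_le (y - x) x
          linarith [hs.2]
        rw [hy k hy8]; rfl
      · rw [es_zero hs.1 (not_le.1 h)]; simp
    rw [this, ← es_one]
    exact m_const hI hW hs.1 one_pos (by linarith [hs.2]) (by linarith) k
  · have hT : TF (Metric.ball 0 10) (fun y => es 1 (y - x)) := TF_shift (s := 1) (es_contDiff (m := 2) 1) (fun z hz => es_zero one_pos hz) (by linarith)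
    rw [es_one] at hT
    have h1 := hW.2 _ hT j k
    rw [pd_cv eta_contDiff eta_cs (hI j).locallyIntegrable, pd_cv eta_contDiff eta_cs (hI k).locallyIntegrable]
    simp only [pd_shift] at h1
    simpa only [mul_comm] using congrArg Neg.neg h1

end GR

namespace GR
variable {n : ℕ}

lemma lip_ibp {f g : (Fin n → ℝ) → ℝ} {K : NNReal} (hf : LipschitzWith K f) (hg : ContDiff ℝ 1 g)
    (hc : HasCompactSupport g) (j : Fin n) : ∫ x, pd f j x * g x = - ∫ x, pd g j x * f x := by
  obtain ⟨D, hD⟩ := ContDiff.lipschitzWith_of_hasCompactSupport hc hg (by norm_num)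
  have h := hf.integral_lineDeriv_mul_eq (μ := volume) hD hc (Pi.single j 1)
  have e1 : ∫ x, pd f j x * g x = ∫ x, lineDeriv ℝ f x (Pi.single j 1) * g x := by
    apply integral_congr_ae
    filter_upwards [hf.ae_differentiableAt (μ := volume)] with x hx
    rw [hx.lineDeriv_eq_fderiv]; rfl
  rw [e1, h, ← integral_neg]
  congr 1; ext x
  rw [(hg.differentiable (by norm_num) x).lineDeriv_eq_fderiv, map_neg, neg_mul]; rfl

lemma lip_curl {f : (Fin n → ℝ) → ℝ} {K : NNReal} (hf : LipschitzWith K f) {B : Set (Fin n → ℝ)}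
    {φ : (Fin n → ℝ) → ℝ} (hφ : TF B φ) (j k : Fin n) :
    ∫ y, pd f j y * pd φ k y = ∫ y, pd f k y * pd φ j y := by
  rw [lip_ibp hf (pd_contDiff (m := 2) (k := 1) hφ.1 (by norm_num) k) (hφ.pd_cs k),
    lip_ibp hf (pd_contDiff (m := 2) (k := 1) hφ.1 (by norm_num) j) (hφ.pd_cs j)]
  simp only [pd_comm hφ.1 j k]

lemma det_upd (A : Matrix (Fin n) (Fin n) ℝ) (i : Fin n) (v : Fin n → ℝ) :
    (A.updateRow i v).det = ∑ k, A.adjugate k i * v k := by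
  rw [Matrix.det_eq_sum_mul_adjugate_row (A.updateRow i v) i]
  refine Finset.sum_congr rfl fun k _ => ?_
  rw [Matrix.adjugate_apply, Matrix.adjugate_apply, Matrix.updateRow_self, mul_comm]
  congr 2
  ext a b
  by_cases h : a = i
  · subst h; simp
  · simp [Matrix.updateRow_ne h]

lemma lip_div {g : Fin n → (Fin n → ℝ) → ℝ} {K : NNReal} (hg : ∀ i, LipschitzWith K (g i)) {B : Set (Fin n → ℝ)}
    {φ : (Fin n → ℝ) → ℝ} (hφ : TF B φ) (i : Fin n) :
    ∫ y, ∑ k, (Dm g y).adjugate k i * pd φ k y = 0 := by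
  obtain ⟨D, hD⟩ := ContDiff.lipschitzWith_of_hasCompactSupport hφ.2.1 hφ.1 (by norm_num)
  have hG : ∀ k, LipschitzWith (max K D) (Function.update g i φ k) := by
    intro k
    by_cases hk : k = i
    · subst hk; simp only [Function.update_self]; exact hD.weaken (le_max_right _ _)
    · simp only [Function.update_of_ne hk]; exact (hg k).weaken (le_max_left _ _)
  have := piola (Function.update g i φ) _ hG i (by simpa using hφ.2.1)
  rw [← this]
  congr 1; ext y
  rw [← det_upd (Dm g y) i (fun k => pd φ k y)]
  congr 1
  ext a b
  by_cases h : a = i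
  · subst h; simp [Dm]
  · simp [Matrix.updateRow_ne h, Dm, Function.update_of_ne h]

lemma measurable_Dm_entry (g : Fin n → (Fin n → ℝ) → ℝ) (i j : Fin n) : Measurable fun x => Dm g x i j := measurable_pd _ _

lemma lint_congr_ofReal {f : (Fin n → ℝ) → ℝ} {B : Set (Fin n → ℝ)} (hf : IntegrableOn f B) (h0 : ∀ x, 0 ≤ f x) :
    ∫⁻ x in B, ENNReal.ofReal (f x) = ENNReal.ofReal (∫ x in B, f x) :=
  (ofReal_integral_eq_lintegral_ofReal hf (ae_of_all _ h0)).symm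

lemma hodge_harm (L : NNReal) : ∃ C : ℝ, 0 ≤ C ∧ ∀ g : Fin n → (Fin n → ℝ) → ℝ, (∀ i, LipschitzWith L (g i)) →
    ∃ h : Fin n → Fin n → (Fin n → ℝ) → ℝ, (∀ i j, HM (h i j)) ∧
      (∀ i j k, ∀ x, ‖x‖ < 8 → pd (h i j) k x = pd (h i k) j x) ∧
      ∫⁻ x in Metric.ball 0 8, ENNReal.ofReal (frobn (Dm g x - Matrix.of fun i j => h i j x) ^ 2) ≤
        ENNReal.ofReal C * ∫⁻ x in Metric.ball 0 10, ENNReal.ofReal (distSOn (Dm g x) ^ 2) := by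
  obtain ⟨C, hC0, hC⟩ := adj_sub_le (n := n) (n * L)
  refine ⟨C ^ 2, by positivity, fun g hg => ?_⟩
  have hent : ∀ x i j, |Dm g x i j| ≤ L := fun x i j => pd_le_lip (hg i) j x
  have hfr : ∀ x, frobn (Dm g x) ≤ n * L := fun x => frobn_le_of_entry _ L.2 (hent x)
  have hd : ∀ x, distSOn (Dm g x) ≤ n * L + n := fun x =>
    (dist_le _ one_mem).trans ((frobn_sub_le _ _).trans (add_le_add (hfr x) (frobn_SOn_le one_mem)))
  have hdif : ∀ x, frobn (Dm g x - (Dm g x).adjugate.transpose) ≤ C * (n * L + n) := fun x =>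
    (hC _ (hfr x)).trans (mul_le_mul_of_nonneg_left (hd x) hC0)
  set K : ℝ := L + C * (n * L + n)
  have hK : (L:ℝ) ≤ K := le_add_of_nonneg_right (by positivity)
  have hadj : ∀ x i k, |(Dm g x).adjugate k i| ≤ K := by
    intro x i k
    have h1 := (abs_entry_le (Dm g x - (Dm g x).adjugate.transpose) i k).trans (hdif x)
    have h2 := hent x i k
    simp only [Matrix.sub_apply, Matrix.transpose_apply] at h1
    have : |(Dm g x).adjugate k i| ≤ |Dm g x i k| + |Dm g x i k - (Dm g x).adjugate k i| := by
      have := abs_sub (Dm g x i k) (Dm g x i k - (Dm g x).adjugate k i)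
      simpa using this
    linarith
  have hadjm : ∀ i k, Measurable fun x => (Dm g x).adjugate k i := fun i k =>
    measurable_comp_mat (measurable_Dm_entry g) ((continuous_id.matrix_adjugate).matrix_elem k i)
  have hBf : volume (Metric.ball (0 : Fin n → ℝ) 10) ≠ ⊤ := measure_ball_lt_top.ne
  have hrow := fun i : Fin n => hodge (B := Metric.ball (0 : Fin n → ℝ) 10) measurableSet_ball hBf
    (fun k y => Dm g y i k) (fun k y => (Dm g y).adjugate k i) K (measurable_Dm_entry g i) (hadjm i)
    (fun k x => (hent x i k).trans hK) (fun k x => hadj x i k) (fun φ hφ => lip_div hg hφ i)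
    (fun φ hφ j k => lip_curl (hg i) hφ j k)
  choose H hHL hHz hHd hHc hHe using hrow
  have hHI : ∀ i k, Integrable (H i k) := by
    intro i k
    have h1 : IntegrableOn (H i k) (Metric.ball 0 10) := by
      haveI : IsFiniteMeasure ((volume : Measure (Fin n → ℝ)).restrict (Metric.ball 0 10)) :=
        ⟨by rw [Measure.restrict_apply_univ]; exact measure_ball_lt_top⟩
      exact ((hHL i k).restrict _).integrable (by norm_num)
    refine (integrableOn_iff_integrable_of_support_subset ?_).1 h1
    intro x hx; by_contra h; exact hx (hHz i k x h)
  have hh := fun i => harm (hHI i) ⟨hHd i, hHc i⟩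
  choose h hHM hcurl hae using hh
  refine ⟨h, hHM, hcurl, ?_⟩
  haveI : IsFiniteMeasure ((volume : Measure (Fin n → ℝ)).restrict (Metric.ball 0 10)) :=
    ⟨by rw [Measure.restrict_apply_univ]; exact measure_ball_lt_top⟩
  have hbint : ∀ (f : (Fin n → ℝ) → ℝ) (c : ℝ), Measurable f → (∀ x, |f x| ≤ c) → MemLp f 2 ((volume : Measure (Fin n → ℝ)).restrict (Metric.ball 0 10)) :=
    fun f c hf hb => MemLp.of_bound hf.aestronglyMeasurable c (ae_of_all _ hb)
  have i1 : ∀ i k, IntegrableOn (fun y => (Dm g y i k - H i k y) ^ 2) (Metric.ball 0 10) := fun i k =>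
    ((hbint _ _ (measurable_Dm_entry g i k) (fun x => hent x i k)).sub ((hHL i k).restrict _)).integrable_sq
  have i2 : ∀ i k, IntegrableOn (fun y => (Dm g y i k - (Dm g y).adjugate k i) ^ 2) (Metric.ball 0 10) := fun i k =>
    ((hbint _ _ (measurable_Dm_entry g i k) (fun x => hent x i k)).sub (hbint _ _ (hadjm i k) (fun x => hadj x i k))).integrable_sq
  calc ∫⁻ x in Metric.ball 0 8, ENNReal.ofReal (frobn (Dm g x - Matrix.of fun i j => h i j x) ^ 2)
      ≤ ∫⁻ x in Metric.ball 0 8, ENNReal.ofReal (frobn (Dm g x - Matrix.of fun i j => H i j x) ^ 2) := by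
        refine setLIntegral_mono_ae' measurableSet_ball ?_
        filter_upwards [ae_all_iff.2 hae] with x hx hx8
        rw [mem_ball_zero_iff] at hx8
        have : (Matrix.of fun i j => h i j x) = Matrix.of fun i j => H i j x := by
          ext i j; simp [hx i j hx8]
        rw [this]
    _ ≤ ∫⁻ x in Metric.ball 0 10, ENNReal.ofReal (frobn (Dm g x - Matrix.of fun i j => H i j x) ^ 2) :=
        lintegral_mono_set (Metric.ball_subset_ball (by norm_num))
    _ = ENNReal.ofReal (∑ i, ∫ x in Metric.ball 0 10, ∑ k, (Dm g x i k - H i k x) ^ 2) := by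
        simp only [frobn_sq, Matrix.sub_apply, Matrix.of_apply]
        rw [lint_congr_ofReal (integrable_finsetSum _ fun i _ => integrable_finsetSum _ fun k _ => i1 i k)
          (fun x => Finset.sum_nonneg fun i _ => Finset.sum_nonneg fun k _ => sq_nonneg _),
          integral_finsetSum _ fun i _ => integrable_finsetSum _ fun k _ => i1 i k]
    _ ≤ ENNReal.ofReal (∑ i, ∫ x in Metric.ball 0 10, ∑ k, (Dm g x i k - (Dm g x).adjugate k i) ^ 2) :=
        ENNReal.ofReal_le_ofReal (Finset.sum_le_sum fun i _ => hHe i)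
    _ = ∫⁻ x in Metric.ball 0 10, ENNReal.ofReal (frobn (Dm g x - (Dm g x).adjugate.transpose) ^ 2) := by
        simp only [frobn_sq, Matrix.sub_apply, Matrix.transpose_apply]
        rw [lint_congr_ofReal (integrable_finsetSum _ fun i _ => integrable_finsetSum _ fun k _ => i2 i k)
          (fun x => Finset.sum_nonneg fun i _ => Finset.sum_nonneg fun k _ => sq_nonneg _),
          integral_finsetSum _ fun i _ => integrable_finsetSum _ fun k _ => i2 i k]
    _ ≤ ∫⁻ x in Metric.ball 0 10, ENNReal.ofReal (C ^ 2) * ENNReal.ofReal (distSOn (Dm g x) ^ 2) := by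
        refine lintegral_mono fun x => ?_
        rw [← ENNReal.ofReal_mul (by positivity), ← mul_pow]
        exact ENNReal.ofReal_le_ofReal (pow_le_pow_left₀ (frobn_nonneg _) (hC _ (hfr x)) 2)
    _ = _ := by rw [lintegral_const_mul']; exact ENNReal.ofReal_ne_top

/-- Harmonic approximation of the gradient -/
lemma harm_approx (n : ℕ) : ∃ C : ℝ, 0 ≤ C ∧ ∀ u : (Fin n → ℝ) → Fin n → ℝ,
    (∀ x ∈ Metric.ball (0 : Fin n → ℝ) 30, DifferentiableAt ℝ u x) →
    ∃ h : Fin n → Fin n → (Fin n → ℝ) → ℝ, (∀ i j, HM (h i j)) ∧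
      (∀ i j k, ∀ x, ‖x‖ < 8 → pd (h i j) k x = pd (h i k) j x) ∧
      ∫⁻ x in Metric.ball 0 8, ENNReal.ofReal (frobn (DD u x - Matrix.of fun i j => h i j x) ^ 2) ≤
        ENNReal.ofReal C * ∫⁻ x in Metric.ball 0 30, ee u x := by
  obtain ⟨L, hL⟩ := lip_trunc n
  obtain ⟨C1, hC10, hC1⟩ := hodge_harm (n := n) L
  -- pointwise constant
  set K : ℝ := 4 * (n:ℝ)^2 + 2 * (n * L) ^ 2 with hKdef
  set K2 : ℝ := (n * L + n) ^ 2 with hK2def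
  refine ⟨2 * (4 + K * 5 ^ n) + 2 * (C1 * (1 + K2 * 5 ^ n)), by positivity, fun u hu => ?_⟩
  obtain ⟨v, hv, hvol⟩ := hL u hu
  set E := ∫⁻ x in Metric.ball 0 30, ee u x with hE
  have hg : ∀ i, LipschitzWith L (fun y => v y i) := fun i => LipschitzWith.of_dist_le_mul fun x y =>
        (dist_le_pi_dist (v x) (v y) i).trans (hv.dist_le_mul x y)
  obtain ⟨h, hHM, hcurl, hest⟩ := hC1 (fun i y => v y i) hg
  refine ⟨h, hHM, hcurl, ?_⟩
  set g : Fin n → (Fin n → ℝ) → ℝ := fun i y => v y i with hgdef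
  have hfr : ∀ x, frobn (Dm g x) ≤ n * L := fun x => frobn_le_of_entry _ L.2 (fun i j => pd_le_lip (hg i) j x)
  have hDae : ∀ᵐ x, DD v x = Dm g x := by
    filter_upwards [hv.ae_differentiableAt (μ := volume)] with x hx using DD_eq_Dm hx
  set Z := {x | x ∈ Metric.ball (0 : Fin n → ℝ) 10 ∧ DD u x ≠ DD v x} with hZ
  have hZm : MeasurableSet Z := by
    refine measurableSet_ball.inter ?_
    exact (measurableSet_eq_fun (measurable_DD u) (measurable_DD v)).compl
  have hZi : ∀ x ∈ Metric.ball (0 : Fin n → ℝ) 10, ∀ c : ENNReal, x ∉ Z → DD u x = DD v x := by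
    intro x hx c hxZ; by_contra h'; exact hxZ ⟨hx, h'⟩
  have h2 : ∫⁻ x in Metric.ball 0 10, Z.indicator (fun _ => 1) x ≤ ENNReal.ofReal (5 ^ n) * E := by
    refine (setLIntegral_le_lintegral _ _).trans ?_
    rw [lintegral_indicator_const hZm, one_mul]; exact hvol
  have hE10 : ∫⁻ x in Metric.ball 0 10, ee u x ≤ E := lintegral_mono_set (Metric.ball_subset_ball (by norm_num))
  -- first piece
  have p1 : ∫⁻ x in Metric.ball 0 10, ENNReal.ofReal (frobn (DD u x - Dm g x) ^ 2) ≤ ENNReal.ofReal (4 + K * 5 ^ n) * E := by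
    calc ∫⁻ x in Metric.ball 0 10, ENNReal.ofReal (frobn (DD u x - Dm g x) ^ 2)
        ≤ ∫⁻ x in Metric.ball 0 10, (ENNReal.ofReal 4 * ee u x + ENNReal.ofReal K * Z.indicator (fun _ => 1) x) := by
          refine setLIntegral_mono_ae' measurableSet_ball ?_
          filter_upwards [hDae] with x hx hx10
          by_cases hxZ : x ∈ Z
          · rw [indicator_of_mem hxZ, mul_one, ee, ← ENNReal.ofReal_mul (by norm_num), ← ENNReal.ofReal_add (by positivity) (by positivity)]
            apply ENNReal.ofReal_le_ofReal
            have a1 := frobn_sub_le (DD u x) (Dm g x)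
            have a2 := frobn_le_dist (DD u x)
            have a3 := hfr x
            have a4 : frobn (DD u x - Dm g x) ≤ (n + distSOn (DD u x)) + n * L := by linarith
            have a5 := pow_le_pow_left₀ (frobn_nonneg _) a4 2
            have := dist_nonneg (DD u x)
            nlinarith [sq_nonneg ((n:ℝ) + distSOn (DD u x) - n * L), sq_nonneg ((n:ℝ) - distSOn (DD u x))]
          · rw [hZi x hx10 0 hxZ, hx]; simp [frobn]
      _ = ENNReal.ofReal 4 * (∫⁻ x in Metric.ball 0 10, ee u x) + ENNReal.ofReal K * ∫⁻ x in Metric.ball 0 10, Z.indicator (fun _ => 1) x := by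
          rw [lintegral_add_left ((measurable_ee u).const_mul _), lintegral_const_mul' _ _ ENNReal.ofReal_ne_top, lintegral_const_mul' _ _ ENNReal.ofReal_ne_top]
      _ ≤ ENNReal.ofReal 4 * E + ENNReal.ofReal K * (ENNReal.ofReal (5 ^ n) * E) := by gcongr
      _ = _ := by
          rw [show ENNReal.ofReal (4 + K * 5 ^ n) = ENNReal.ofReal 4 + ENNReal.ofReal K * ENNReal.ofReal (5 ^ n) by
            rw [ENNReal.ofReal_add (by norm_num) (by positivity), ENNReal.ofReal_mul (by positivity)]]
          ring
  have p2 : ∫⁻ x in Metric.ball 0 10, ENNReal.ofReal (distSOn (Dm g x) ^ 2) ≤ ENNReal.ofReal (1 + K2 * 5 ^ n) * E := by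
    calc ∫⁻ x in Metric.ball 0 10, ENNReal.ofReal (distSOn (Dm g x) ^ 2)
        ≤ ∫⁻ x in Metric.ball 0 10, (ee u x + ENNReal.ofReal K2 * Z.indicator (fun _ => 1) x) := by
          refine setLIntegral_mono_ae' measurableSet_ball ?_
          filter_upwards [hDae] with x hx hx10
          by_cases hxZ : x ∈ Z
          · rw [indicator_of_mem hxZ, mul_one]
            refine le_trans (ENNReal.ofReal_le_ofReal ?_) le_add_self
            refine pow_le_pow_left₀ (dist_nonneg _) ?_ 2
            exact (dist_le _ one_mem).trans ((frobn_sub_le _ _).trans (add_le_add (hfr x) (frobn_SOn_le one_mem)))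
          · rw [ee, hZi x hx10 0 hxZ, hx]; exact le_self_add
      _ = (∫⁻ x in Metric.ball 0 10, ee u x) + ENNReal.ofReal K2 * ∫⁻ x in Metric.ball 0 10, Z.indicator (fun _ => 1) x := by
          rw [lintegral_add_left (measurable_ee u), lintegral_const_mul' _ _ ENNReal.ofReal_ne_top]
      _ ≤ E + ENNReal.ofReal K2 * (ENNReal.ofReal (5 ^ n) * E) := by gcongr
      _ = _ := by
          rw [ENNReal.ofReal_add (by norm_num) (by positivity), ENNReal.ofReal_mul (by positivity), ENNReal.ofReal_one]; ring
  have m1 : Measurable fun x => ENNReal.ofReal (frobn (DD u x - Dm g x) ^ 2) := by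
    refine ENNReal.measurable_ofReal.comp ?_
    exact measurable_comp_mat (F := fun x => DD u x - Dm g x) (fun i j => (measurable_DD_entry u i j).sub (measurable_Dm_entry g i j)) (continuous_frobn.pow 2)
  calc ∫⁻ x in Metric.ball 0 8, ENNReal.ofReal (frobn (DD u x - Matrix.of fun i j => h i j x) ^ 2)
      ≤ ∫⁻ x in Metric.ball 0 8, (2 * ENNReal.ofReal (frobn (DD u x - Dm g x) ^ 2) +
          2 * ENNReal.ofReal (frobn (Dm g x - Matrix.of fun i j => h i j x) ^ 2)) := by
        refine lintegral_mono fun x => ?_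
        rw [show (2:ENNReal) = ENNReal.ofReal 2 by norm_num, ← ENNReal.ofReal_mul (by norm_num), ← ENNReal.ofReal_mul (by norm_num), ← ENNReal.ofReal_add (by positivity) (by positivity)]
        exact ENNReal.ofReal_le_ofReal (frobn_tri_sq _ _ _)
    _ = 2 * (∫⁻ x in Metric.ball 0 8, ENNReal.ofReal (frobn (DD u x - Dm g x) ^ 2)) +
          2 * ∫⁻ x in Metric.ball 0 8, ENNReal.ofReal (frobn (Dm g x - Matrix.of fun i j => h i j x) ^ 2) := by
        rw [lintegral_add_left (m1.const_mul _), lintegral_const_mul' _ _ (by norm_num), lintegral_const_mul' _ _ (by norm_num)]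
    _ ≤ 2 * (ENNReal.ofReal (4 + K * 5 ^ n) * E) + 2 * (ENNReal.ofReal C1 * (ENNReal.ofReal (1 + K2 * 5 ^ n) * E)) := by
        have q1 : ∫⁻ x in Metric.ball 0 8, ENNReal.ofReal (frobn (DD u x - Dm g x) ^ 2) ≤ ENNReal.ofReal (4 + K * 5 ^ n) * E :=
          (lintegral_mono_set (Metric.ball_subset_ball (by norm_num))).trans p1
        have q2 : ∫⁻ x in Metric.ball 0 8, ENNReal.ofReal (frobn (Dm g x - Matrix.of fun i j => h i j x) ^ 2) ≤ ENNReal.ofReal C1 * (ENNReal.ofReal (1 + K2 * 5 ^ n) * E) :=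
          hest.trans (mul_le_mul_right p2 _)
        gcongr
    _ = _ := by
        have e : ∀ a b c : ℝ, 0 ≤ a → 0 ≤ b → 0 ≤ c → ENNReal.ofReal (2 * a + 2 * (c * b)) =
            2 * ENNReal.ofReal a + 2 * (ENNReal.ofReal c * ENNReal.ofReal b) := by
          intro a b c ha hb hc
          rw [ENNReal.ofReal_add (by positivity) (by positivity), ENNReal.ofReal_mul (by positivity),
            ENNReal.ofReal_mul (by positivity), ENNReal.ofReal_mul hc, show ENNReal.ofReal 2 = 2 by norm_num]
        rw [e _ _ _ (by positivity) (by positivity) hC10]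
        ring

end GR

namespace GR
variable {n : ℕ}

lemma ciB {f : (Fin n → ℝ) → ℝ} (hf : Continuous f) (r : ℝ) : IntegrableOn f (Metric.ball 0 r) :=
  (hf.continuousOn.integrableOn_compact (isCompact_closedBall 0 r)).mono_set Metric.ball_subset_closedBall

/-- volume of balls as reals -/
def vB (n : ℕ) (r : ℝ) : ℝ := (volume : Measure (Fin n → ℝ)).real (Metric.ball 0 r)

lemma vB_pos {r : ℝ} (hr : 0 < r) : 0 < vB n r := by
  unfold vB Measure.real
  exact ENNReal.toReal_pos (Metric.measure_ball_pos volume _ hr).ne' measure_ball_lt_top.ne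

lemma vB_nonneg {r : ℝ} : 0 ≤ vB n r := measureReal_nonneg

lemma int_const_B (r c : ℝ) : ∫ _x in Metric.ball (0 : Fin n → ℝ) r, c = vB n r * c := by
  rw [setIntegral_const, smul_eq_mul]; rfl

lemma int_mono_B {f g : (Fin n → ℝ) → ℝ} (hf : Continuous f) (hg : Continuous g) {r : ℝ}
    (h : ∀ x, ‖x‖ < r → f x ≤ g x) : ∫ x in Metric.ball 0 r, f x ≤ ∫ x in Metric.ball 0 r, g x :=
  setIntegral_mono_on (ciB hf r) (ciB hg r) measurableSet_ball fun x hx => h x (by simpa using hx)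

lemma int_mono_set_B {f : (Fin n → ℝ) → ℝ} (hf : Continuous f) (h0 : ∀ x, 0 ≤ f x) {r s : ℝ} (h : r ≤ s) :
    ∫ x in Metric.ball 0 r, f x ≤ ∫ x in Metric.ball 0 s, f x :=
  setIntegral_mono_set (ciB hf s) (ae_of_all _ h0) (Metric.ball_subset_ball h).eventuallyLE

lemma cs_B {f : (Fin n → ℝ) → ℝ} (hf : Continuous f) (r : ℝ) :
    (∫ x in Metric.ball 0 r, f x) ^ 2 ≤ vB n r * ∫ x in Metric.ball 0 r, f x ^ 2 := by
  have h2 : ∀ t : ℝ, 0 ≤ vB n r * (t * t) + (-2 * ∫ x in Metric.ball 0 r, f x) * t + ∫ x in Metric.ball 0 r, f x ^ 2 := by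
    intro t
    have e : ∫ x in Metric.ball 0 r, (f x - t) ^ 2 = vB n r * (t * t) + (-2 * ∫ x in Metric.ball 0 r, f x) * t + ∫ x in Metric.ball 0 r, f x ^ 2 := by
      have e1 : ∀ x, (f x - t) ^ 2 = (t * t + f x * (-2 * t)) + f x ^ 2 := by intro y; ring
      simp only [e1]
      have i1 : IntegrableOn (fun _ : Fin n → ℝ => t * t) (Metric.ball 0 r) := ciB continuous_const r
      have i2 : IntegrableOn (fun x => f x * (-2 * t)) (Metric.ball 0 r) := ciB (hf.mul continuous_const) r
      have i3 : IntegrableOn (fun x => f x ^ 2) (Metric.ball 0 r) := ciB (hf.pow 2) r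
      rw [integral_add (by exact i1.add i2) i3, integral_add i1 i2, int_const_B, integral_mul_const]
      ring
    rw [← e]; exact integral_nonneg fun y => sq_nonneg _
  have h3 := discrim_le_zero h2
  rw [discrim] at h3
  nlinarith

/-- the matrix field -/
def hM (h : Fin n → Fin n → (Fin n → ℝ) → ℝ) (x : Fin n → ℝ) : Matrix (Fin n) (Fin n) ℝ := Matrix.of fun i j => h i j x

lemma hM_cont {h : Fin n → Fin n → (Fin n → ℝ) → ℝ} (hc : ∀ i j, Continuous (h i j)) : Continuous (hM h) :=
  continuous_matrix fun i j => hc i j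

lemma osc_entry {f : (Fin n → ℝ) → ℝ} (hf : ContDiff ℝ 2 f) {P r : ℝ} (hr : 0 < r) (hP : ∀ x, ‖x‖ < r → ∀ k, pd f k x ^ 2 ≤ P)
    {x : Fin n → ℝ} (hx : ‖x‖ < r) : |f x - f 0| ≤ n * r * Real.sqrt P := by
  have hb : ∀ y ∈ Metric.ball (0 : Fin n → ℝ) r, ‖fderiv ℝ f y‖ ≤ n * Real.sqrt P := by
    intro y hy
    rw [mem_ball_zero_iff] at hy
    refine ContinuousLinearMap.opNorm_le_bound _ (by positivity) fun v => ?_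
    rw [fderiv_eq_sum, Real.norm_eq_abs]
    refine (Finset.abs_sum_le_sum_abs _ _).trans ?_
    calc ∑ k, |v k * pd f k y| ≤ ∑ _k : Fin n, ‖v‖ * Real.sqrt P := by
          refine Finset.sum_le_sum fun k _ => ?_
          rw [abs_mul]
          exact mul_le_mul (norm_le_pi_norm v k) (Real.abs_le_sqrt (hP y hy k)) (abs_nonneg _) (norm_nonneg _)
      _ = _ := by simp; ring
  have := (convex_ball (0 : Fin n → ℝ) r).norm_image_sub_le_of_norm_fderiv_le
    (fun y _ => hf.differentiable (by norm_num) y) hb (x := 0) (y := x) (by simpa using hr) (by simpa using hx)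
  rw [Real.norm_eq_abs, sub_zero] at this
  refine this.trans ?_
  nlinarith [Real.sqrt_nonneg P, norm_nonneg x, mul_nonneg (Nat.cast_nonneg (α := ℝ) n) (Real.sqrt_nonneg P)]

lemma osc (n : ℕ) : ∃ C : ℝ, 0 ≤ C ∧ ∀ h : Fin n → Fin n → (Fin n → ℝ) → ℝ, (∀ i j, ContDiff ℝ 2 (h i j)) →
    ∀ (r P ε : ℝ), 1 ≤ r → r ≤ 3 → 0 ≤ P → (∀ i j k x, ‖x‖ < r → pd (h i j) k x ^ 2 ≤ P) →
    ∫ x in Metric.ball 0 8, distSOn (hM h x) ^ 2 ≤ ε ^ 2 →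
    ∃ R ∈ SOn n, ∀ x, ‖x‖ < r → frobn (hM h x - R) ^ 2 ≤ C * (P + ε ^ 2) := by
  have hv : 0 < vB n 1 := vB_pos one_pos
  refine ⟨(2 * (n * (n * 3)) ^ 2 + 4 * (n * (n * 3)) ^ 2) + 4 * (vB n 1)⁻¹, by positivity, fun h hh r P ε hr1 hr3 hP0 hP hε => ?_⟩
  have hc : Continuous (hM h) := hM_cont fun i j => (hh i j).continuous
  have hDc : Continuous fun x => distSOn (hM h x) := continuous_dist.comp hc
  obtain ⟨R, hR, hd⟩ := exists_dist (hM h 0)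
  refine ⟨R, hR, fun x hx => ?_⟩
  have hos : ∀ x, ‖x‖ < r → frobn (hM h x - hM h 0) ^ 2 ≤ (n * (n * 3)) ^ 2 * P := by
    intro x hx
    have h1 : frobn (hM h x - hM h 0) ≤ n * (n * r * Real.sqrt P) := by
      refine frobn_le_of_entry _ (by positivity) fun i j => ?_
      exact osc_entry (hh i j) (by linarith) (fun x hx k => hP i j k x hx) hx
    have h2 : frobn (hM h x - hM h 0) ≤ (n * (n * 3)) * Real.sqrt P := by
      refine h1.trans ?_
      rw [← mul_assoc]; gcongr
    have := pow_le_pow_left₀ (frobn_nonneg _) h2 2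
    rwa [mul_pow, Real.sq_sqrt hP0] at this
  have hD0 : vB n 1 * distSOn (hM h 0) ^ 2 ≤ 2 * ε ^ 2 + vB n 1 * (2 * ((n * (n * 3)) ^ 2 * P)) := by
    rw [← int_const_B]
    calc ∫ _x in Metric.ball (0 : Fin n → ℝ) 1, distSOn (hM h 0) ^ 2
        ≤ ∫ x in Metric.ball (0 : Fin n → ℝ) 1, (2 * distSOn (hM h x) ^ 2 + 2 * ((n * (n * 3)) ^ 2 * P)) := by
          refine int_mono_B continuous_const ((continuous_const.mul (hDc.pow 2)).add continuous_const) fun y hy => ?_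
          have h1 : distSOn (hM h 0) ≤ distSOn (hM h y) + frobn (hM h y - hM h 0) := by
            rw [frobn_sub_comm]; exact dist_lip (hM h 0) (hM h y)
          have h2 := hos y (by linarith)
          have h3 : distSOn (hM h 0) ^ 2 ≤ (distSOn (hM h y) + frobn (hM h y - hM h 0)) ^ 2 := pow_le_pow_left₀ (dist_nonneg _) h1 2
          show distSOn (hM h 0) ^ 2 ≤ 2 * distSOn (hM h y) ^ 2 + 2 * ((n * (n * 3)) ^ 2 * P)
          nlinarith [sq_nonneg (distSOn (hM h y) - frobn (hM h y - hM h 0))]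
      _ = 2 * (∫ x in Metric.ball (0 : Fin n → ℝ) 1, distSOn (hM h x) ^ 2) + vB n 1 * (2 * ((n * (n * 3)) ^ 2 * P)) := by
          have i1 : IntegrableOn (fun x => 2 * distSOn (hM h x) ^ 2) (Metric.ball 0 1) := ciB (continuous_const.mul (hDc.pow 2)) 1
          have i2 : IntegrableOn (fun _ : Fin n → ℝ => 2 * (((n:ℝ) * (n * 3)) ^ 2 * P)) (Metric.ball 0 1) := ciB continuous_const 1
          rw [integral_add i1 i2, int_const_B, integral_const_mul]
      _ ≤ _ := by
          have : ∫ x in Metric.ball (0 : Fin n → ℝ) 1, distSOn (hM h x) ^ 2 ≤ ε ^ 2 := (int_mono_set_B (hDc.pow 2) (fun x => sq_nonneg _) (show (1:ℝ) ≤ 8 by norm_num)).trans hε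
          linarith
  have hD0' : distSOn (hM h 0) ^ 2 ≤ 2 * (vB n 1)⁻¹ * ε ^ 2 + 2 * ((n * (n * 3)) ^ 2 * P) := by
    have : vB n 1 * distSOn (hM h 0) ^ 2 ≤ vB n 1 * (2 * (vB n 1)⁻¹ * ε ^ 2 + 2 * ((n * (n * 3)) ^ 2 * P)) := by
      refine hD0.trans (le_of_eq ?_); field_simp
    exact le_of_mul_le_mul_left this hv
  have h1 := frobn_tri_sq (hM h x) (hM h 0) R
  have h2 := hos x hx
  rw [← hd] at h1
  have hi : 0 < (vB n 1)⁻¹ := inv_pos.2 hv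
  nlinarith [mul_nonneg (sq_nonneg ((n:ℝ) * (n * 3))) (sq_nonneg ε), mul_nonneg hi.le hP0]

lemma pd_lin {ι : Type*} (t : Finset ι) {f : ι → (Fin n → ℝ) → ℝ} (c : ι → ℝ) {x : Fin n → ℝ} (hf : ∀ i, DifferentiableAt ℝ (f i) x) (k : Fin n) :
    pd (fun x => ∑ l ∈ t, c l * f l x) k x = ∑ l ∈ t, c l * pd (f l) k x := by
  unfold pd
  have : HasFDerivAt (fun x => ∑ l ∈ t, c l * f l x) (∑ l ∈ t, c l • fderiv ℝ (f l) x) x :=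
    HasFDerivAt.fun_sum fun l _ => (hf l).hasFDerivAt.const_mul (c l)
  rw [this.fderiv]; simp

end GR

namespace GR
variable {n : ℕ}

lemma hr1 (n : ℕ) : ∃ A : ℝ, 0 ≤ A ∧ ∀ h : Fin n → Fin n → (Fin n → ℝ) → ℝ, (∀ i j, HM (h i j)) →
    ∫ x in Metric.ball 0 8, distSOn (hM h x) ^ 2 ≤ 1 → ∀ x, ‖x‖ < 6 → distSOn (hM h x) ≤ A := by
  obtain ⟨C, hC0, hC⟩ := HM_est (n := n)
  set B : ℝ := C * (vB n 8 * (2 * n ^ 2) + 2) with hB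
  have hB0 : 0 ≤ B := by have := vB_nonneg (n := n) (r := 8); positivity
  refine ⟨n * Real.sqrt B + n, by positivity, fun h hh hε x hx => ?_⟩
  have hc : Continuous (hM h) := hM_cont fun i j => (hh i j).1.continuous
  have hDc : Continuous fun x => distSOn (hM h x) := continuous_dist.comp hc
  have h1 : ∀ i j, |h i j x| ≤ Real.sqrt B := by
    intro i j
    refine Real.abs_le_sqrt (((hC _ (hh i j) x 8 hx (by linarith)).1).trans ?_)
    refine mul_le_mul_of_nonneg_left ?_ hC0
    calc ∫ y in Metric.ball 0 8, h i j y ^ 2 ≤ ∫ y in Metric.ball (0 : Fin n → ℝ) 8, (2 * (n:ℝ) ^ 2 + 2 * distSOn (hM h y) ^ 2) := by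
          refine int_mono_B ((hh i j).1.continuous.pow 2) (continuous_const.add (continuous_const.mul (hDc.pow 2))) fun y _ => ?_
          show h i j y ^ 2 ≤ 2 * (n:ℝ) ^ 2 + 2 * distSOn (hM h y) ^ 2
          have e1 : |h i j y| ≤ frobn (hM h y) := abs_entry_le (hM h y) i j
          have e2 := frobn_le_dist (hM h y)
          have e3 : |h i j y| ^ 2 ≤ (n + distSOn (hM h y)) ^ 2 := pow_le_pow_left₀ (abs_nonneg _) (e1.trans e2) 2
          rw [sq_abs] at e3
          nlinarith [sq_nonneg ((n:ℝ) - distSOn (hM h y))]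
      _ = vB n 8 * (2 * n ^ 2) + 2 * ∫ y in Metric.ball (0 : Fin n → ℝ) 8, distSOn (hM h y) ^ 2 := by
          have i1 : IntegrableOn (fun x => 2 * distSOn (hM h x) ^ 2) (Metric.ball 0 8) := ciB (continuous_const.mul (hDc.pow 2)) 8
          have i2 : IntegrableOn (fun _ : Fin n → ℝ => 2 * (n:ℝ) ^ 2) (Metric.ball 0 8) := ciB continuous_const 8
          rw [integral_add i2 i1, int_const_B, integral_const_mul]
      _ ≤ _ := by linarith
  have h2 : frobn (hM h x) ≤ n * Real.sqrt B := frobn_le_of_entry _ (Real.sqrt_nonneg _) fun i j => h1 i j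
  have h3 := dist_le (hM h x) (one_mem (n := n))
  have h4 := frobn_sub_le (hM h x) 1
  have h5 := frobn_SOn_le (one_mem (n := n))
  linarith

lemma q_est (F : Matrix (Fin n) (Fin n) ℝ) : |frobn F ^ 2 - n| ≤ (2 * n + distSOn F) * distSOn F := by
  obtain ⟨R, hR, hd⟩ := exists_dist F
  have h1 := frobn_SOn_sq hR
  have h2 := frobn_SOn_le hR
  have h3 : frobn F ≤ distSOn F + frobn R := by
    have := frobn_add_le (F - R) R
    rw [sub_add_cancel] at this; linarith
  have h4 : frobn R ≤ distSOn F + frobn F := by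
    have := frobn_add_le (R - F) F
    rw [sub_add_cancel, frobn_sub_comm] at this; linarith
  have h5 := frobn_nonneg F
  have h6 := frobn_nonneg R
  have h7 := dist_nonneg F
  rw [← h1, abs_le]; constructor <;> nlinarith

lemma hr2 (n : ℕ) : ∃ C : ℝ, 0 ≤ C ∧ ∀ h : Fin n → Fin n → (Fin n → ℝ) → ℝ, (∀ i j, HM (h i j)) → ∀ ε, 0 ≤ ε → ε ≤ 1 →
    ∫ x in Metric.ball 0 8, distSOn (hM h x) ^ 2 ≤ ε ^ 2 → ∀ i j k x, ‖x‖ < 3 → pd (h i j) k x ^ 2 ≤ C * ε := by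
  obtain ⟨A, hA0, hA⟩ := hr1 n
  obtain ⟨C, hC0, hC⟩ := HM_est (n := n)
  obtain ⟨Cv, hv0, hv⟩ := HM_var (n := n)
  obtain ⟨S, hS⟩ := bdd_of_cc (eta_contDiff (n := n) (m := 0)).continuous eta_cs
  set B : ℝ := (2 * n + A) * Real.sqrt (vB n 6) with hB
  have hS0 : 0 ≤ S := (abs_nonneg _).trans (hS 0)
  have hB0 : 0 ≤ B := by positivity
  have hv4 := vB_nonneg (n := n) (r := 4)
  refine ⟨C * (Cv * (vB n 4 * (S * B) + B)), by positivity, fun h hh ε hε0 hε1 hε i j k x hx => ?_⟩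
  have hc : Continuous (hM h) := hM_cont fun i j => (hh i j).1.continuous
  have hDc : Continuous fun x => distSOn (hM h x) := continuous_dist.comp hc
  have hfc : Continuous fun x => frobn (hM h x) := continuous_frobn.comp hc
  have hε' : ε ^ 2 ≤ 1 := by nlinarith
  have hD := hA h hh (hε.trans hε')
  set q : (Fin n → ℝ) → ℝ := fun x => frobn (hM h x) ^ 2 - n with hq
  have hqc : Continuous q := (hfc.pow 2).sub continuous_const
  have hqD : ∀ x, ‖x‖ < 6 → |q x| ≤ (2 * n + A) * distSOn (hM h x) := by
    intro x hx
    refine (q_est _).trans ?_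
    have := hD x hx
    exact mul_le_mul_of_nonneg_right (by linarith) (dist_nonneg _)
  have hI : ∫ x in Metric.ball 0 6, distSOn (hM h x) ≤ Real.sqrt (vB n 6) * ε := by
    refine abs_le_of_sq_le_sq' ?_ (by positivity) |>.2
    rw [mul_pow, Real.sq_sqrt vB_nonneg]
    refine (cs_B hDc 6).trans (mul_le_mul_of_nonneg_left ?_ vB_nonneg)
    exact (int_mono_set_B (hDc.pow 2) (fun x => sq_nonneg _) (show (6:ℝ) ≤ 8 by norm_num)).trans hε
  have hQ : ∫ x in Metric.ball 0 6, |q x| ≤ B * ε := by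
    have hcc : Continuous fun x => (2 * n + A) * distSOn (hM h x) := continuous_const.mul hDc
    refine (int_mono_B hqc.abs hcc hqD).trans ?_
    rw [integral_const_mul, hB, mul_assoc]
    exact mul_le_mul_of_nonneg_left hI (by positivity)
  have hsm : ∀ x, ‖x‖ < 4 → pd (h i j) k x ^ 2 ≤ Cv * (S * (B * ε)) + Cv * |q x| := by
    intro x hx
    have hx6 : ‖x‖ < 6 := by linarith
    have hpos : ∀ i j, 0 ≤ Cv * ((∫ y, eta (y - x) * h i j y ^ 2) - h i j x ^ 2) := fun i j =>
      (sq_nonneg _).trans (hv _ (hh i j) x hx6 k)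
    have hec : Continuous fun y : Fin n → ℝ => eta (y - x) := (eta_contDiff (m := 0)).continuous.comp (continuous_id.sub continuous_const)
    have hki : ∀ f : (Fin n → ℝ) → ℝ, Continuous f → Integrable (fun y => eta (y - x) * f y) := fun f hf =>
      int_ker (eta_contDiff (m := 0)).continuous eta_cs hf x
    have e1 : ∑ i, ∑ j, ((∫ y, eta (y - x) * h i j y ^ 2) - h i j x ^ 2) = (∫ y, eta (y - x) * q y) - q x := by
      have e2 : ∫ y, eta (y - x) * q y = (∑ i, ∑ j, ∫ y, eta (y - x) * h i j y ^ 2) - n := by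
        have i1 : Integrable (fun y => eta (y - x) * ∑ i, ∑ j, h i j y ^ 2) := hki _ (by
          refine continuous_finset_sum _ fun i _ => continuous_finset_sum _ fun j _ => (hh i j).1.continuous.pow 2)
        have i2 : Integrable (fun y => eta (y - x) * (n:ℝ)) := hki _ continuous_const
        have e3 : ∀ y, eta (y - x) * q y = eta (y - x) * (∑ i, ∑ j, h i j y ^ 2) - eta (y - x) * n := by
          intro y; simp only [hq, frobn_sq, hM, Matrix.of_apply]; ring
        simp only [e3]
        rw [integral_sub i1 i2, integral_mul_const, integral_sub_right_eq_self (fun y => eta y), eta_int, one_mul]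
        congr 1
        simp only [Finset.mul_sum]
        have i3 : ∀ i j, Integrable (fun y => eta (y - x) * h i j y ^ 2) := fun i j => hki _ ((hh i j).1.continuous.pow 2)
        rw [integral_finset_sum _ fun i _ => integrable_finset_sum _ fun j _ => i3 i j]
        refine Finset.sum_congr rfl fun i _ => ?_
        rw [integral_finset_sum _ fun j _ => i3 i j]
      rw [e2]; simp only [hq, frobn_sq, hM, Matrix.of_apply, Finset.sum_sub_distrib]; ring
    have e4 : pd (h i j) k x ^ 2 ≤ Cv * ((∫ y, eta (y - x) * q y) - q x) := by
      rw [← e1, Finset.mul_sum]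
      simp only [Finset.mul_sum]
      refine (hv _ (hh i j) x hx6 k).trans ?_
      refine (Finset.single_le_sum (f := fun j => Cv * ((∫ y, eta (y - x) * h i j y ^ 2) - h i j x ^ 2)) (fun j _ => hpos i j) (Finset.mem_univ j)).trans ?_
      exact Finset.single_le_sum (f := fun i => ∑ j, Cv * ((∫ y, eta (y - x) * h i j y ^ 2) - h i j x ^ 2)) (fun i _ => Finset.sum_nonneg fun j _ => hpos i j) (Finset.mem_univ i)
    have e5 : ∫ y, eta (y - x) * q y ≤ S * (B * ε) := by
      calc ∫ y, eta (y - x) * q y = ∫ y in Metric.ball 0 6, eta (y - x) * q y := by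
            refine (setIntegral_eq_integral_of_forall_compl_eq_zero fun y hy => ?_).symm
            have : 6 ≤ ‖y‖ := by simpa using hy
            rw [eta_zero', zero_mul]
            have := norm_sub_norm_le y x
            linarith
        _ ≤ ∫ y in Metric.ball 0 6, S * |q y| := by
            refine int_mono_B (hec.mul hqc) (continuous_const.mul hqc.abs) fun y _ => ?_
            refine (le_abs_self _).trans ?_
            show |eta (y - x) * q y| ≤ S * |q y|
            rw [abs_mul]
            exact mul_le_mul_of_nonneg_right (hS _) (abs_nonneg _)
        _ ≤ _ := by rw [integral_const_mul]; exact mul_le_mul_of_nonneg_left hQ hS0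
    refine e4.trans ?_
    rw [← mul_add]
    refine mul_le_mul_of_nonneg_left ?_ hv0
    linarith [neg_abs_le (q x)]
  have hpc : Continuous fun x => pd (h i j) k x := (pd_contDiff (m := 2) (k := 1) (hh i j).1 (by norm_num) k).continuous
  refine ((hC _ (hh i j) x 4 (by linarith) (by linarith)).2.2 k).trans ?_
  rw [mul_assoc C]
  refine mul_le_mul_of_nonneg_left ?_ hC0
  have hcc : Continuous fun x => Cv * (S * (B * ε)) + Cv * |q x| := continuous_const.add (continuous_const.mul hqc.abs)
  refine (int_mono_B (hpc.pow 2) hcc hsm).trans ?_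
  have i1 : IntegrableOn (fun x => Cv * |q x|) (Metric.ball 0 4) := ciB (continuous_const.mul hqc.abs) 4
  have i2 : IntegrableOn (fun _ : Fin n → ℝ => Cv * (S * (B * ε))) (Metric.ball 0 4) := ciB continuous_const 4
  rw [integral_add i2 i1, int_const_B, integral_const_mul]
  have h46 := (int_mono_set_B hqc.abs (fun x => abs_nonneg _) (show (4:ℝ) ≤ 6 by norm_num)).trans hQ
  calc vB n 4 * (Cv * (S * (B * ε))) + Cv * ∫ x in Metric.ball 0 4, |q x| ≤ vB n 4 * (Cv * (S * (B * ε))) + Cv * (B * ε) := by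
        have := mul_le_mul_of_nonneg_left h46 hv0; linarith
    _ = _ := by ring

end GR

namespace GR
variable {n : ℕ}

lemma korn_pt (n : ℕ) {R : Matrix (Fin n) (Fin n) ℝ} (hR : R ∈ SOn n) {H : Fin n → Fin n → Fin n → ℝ}
    (hs : ∀ i j k, H i j k = H i k j) {P : ℝ}
    (hP : ∀ i j k, ((1/2:ℝ) * ((∑ l, R l i * H l j k) + ∑ l, R l j * H l i k)) ^ 2 ≤ P) (i j k : Fin n) :
    H i j k ^ 2 ≤ (3 * n ^ 2) ^ 2 * P := by
  have hP0 : 0 ≤ P := (sq_nonneg _).trans (hP i j k)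
  set G : Fin n → Fin n → Fin n → ℝ := fun i j k => ∑ l, R l i * H l j k with hG
  have hGs : ∀ i j k, G i j k = G i k j := fun i j k => by simp only [hG, hs _ j k]
  have hGb : ∀ i j k, |G i j k| ≤ 3 * Real.sqrt P := by
    intro i j k
    have h1 := Real.abs_le_sqrt (hP i j k)
    have h2 := Real.abs_le_sqrt (hP i k j)
    have h3 := Real.abs_le_sqrt (hP j k i)
    change |(1/2:ℝ) * (G i j k + G j i k)| ≤ _ at h1
    change |(1/2:ℝ) * (G i k j + G k i j)| ≤ _ at h2
    change |(1/2:ℝ) * (G j k i + G k j i)| ≤ _ at h3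
    have e1 := hGs i j k
    have e2 := hGs j i k
    have e3 := hGs k i j
    rw [abs_le] at h1 h2 h3 ⊢
    constructor <;> linarith [h1.1, h1.2, h2.1, h2.2, h3.1, h3.2]
  have hH : H i j k = ∑ m, R i m * G m j k := by
    have h1 := SOn_mul_transpose hR
    have h2 : ∀ l, ∑ m, R i m * R l m = if i = l then 1 else 0 := by
      intro l
      have := congrFun (congrFun h1 i) l
      rw [Matrix.mul_apply] at this
      simpa [Matrix.one_apply] using this
    simp only [hG, Finset.mul_sum]
    rw [Finset.sum_comm]
    simp only [← mul_assoc, ← Finset.sum_mul, h2]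
    simp
  have hb : |H i j k| ≤ (3 * n ^ 2) * Real.sqrt P := by
    rw [hH]
    refine (Finset.abs_sum_le_sum_abs _ _).trans ?_
    calc ∑ m, |R i m * G m j k| ≤ ∑ _m : Fin n, (n:ℝ) * (3 * Real.sqrt P) := by
          refine Finset.sum_le_sum fun m _ => ?_
          rw [abs_mul]
          exact mul_le_mul ((abs_entry_le R i m).trans (frobn_SOn_le hR)) (hGb _ _ _) (abs_nonneg _) (by positivity)
      _ = _ := by simp; ring
  have := pow_le_pow_left₀ (abs_nonneg _) hb 2
  rwa [sq_abs, mul_pow, Real.sq_sqrt hP0] at this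

lemma harm_rig (n : ℕ) : ∃ C : ℝ, 0 ≤ C ∧ ∀ h : Fin n → Fin n → (Fin n → ℝ) → ℝ, (∀ i j, HM (h i j)) →
    (∀ i j k x, ‖x‖ < 8 → pd (h i j) k x = pd (h i k) j x) → ∀ ε, 0 ≤ ε → ε ≤ 1 →
    ∫ x in Metric.ball 0 8, distSOn (hM h x) ^ 2 ≤ ε ^ 2 → ∃ R ∈ SOn n, ∀ x, ‖x‖ < 1 → frobn (hM h x - R) ^ 2 ≤ C * ε ^ 2 := by
  obtain ⟨A, hA0, hA⟩ := hr1 n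
  obtain ⟨C2, hC20, hC2⟩ := hr2 n
  obtain ⟨C, hC0, hC⟩ := HM_est (n := n)
  obtain ⟨Co, hCo0, hCo⟩ := osc n
  set C5 := Co * (C2 + 1) with hC5
  have hv3 := vB_nonneg (n := n) (r := 3)
  set K := C * (2 * (1 + A) ^ 2 + vB n 3 * (2 * C5 ^ 2)) with hK
  refine ⟨Co * ((3 * n ^ 2) ^ 2 * K + 1), by positivity, fun h hh hcurl ε hε0 hε1 hε => ?_⟩
  have hc : Continuous (hM h) := hM_cont fun i j => (hh i j).1.continuous
  have hDc : Continuous fun x => distSOn (hM h x) := continuous_dist.comp hc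
  have hε' : ε ^ 2 ≤ ε := by nlinarith
  have hD := hA h hh (hε.trans (hε'.trans hε1))
  obtain ⟨R, hR, hRe⟩ := hCo h (fun i j => (hh i j).1) 3 (C2 * ε) ε (by norm_num) le_rfl (by positivity)
    (fun i j k x hx => hC2 h hh ε hε0 hε1 hε i j k x hx) hε
  have hRe' : ∀ x, ‖x‖ < 3 → frobn (hM h x - R) ^ 2 ≤ C5 * ε := fun x hx => (hRe x hx).trans (by
    rw [hC5, mul_assoc]; exact mul_le_mul_of_nonneg_left (by linarith) hCo0)
  set g : Fin n → Fin n → (Fin n → ℝ) → ℝ := fun i j x => ∑ l, R l i * h l j x with hg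
  have hgHM : ∀ i j, HM (g i j) := fun i j => HM.sum Finset.univ fun l => (hh l j).cmul (R l i)
  set e : Fin n → Fin n → (Fin n → ℝ) → ℝ := fun i j x => (1/2:ℝ) * (g i j x + g j i x) - (1 : Matrix (Fin n) (Fin n) ℝ) i j with he
  have heHM : ∀ i j, HM (e i j) := fun i j => (((hgHM i j).add (hgHM j i)).cmul (1/2)).sub_const _
  have heM : ∀ i j x, e i j x = ((1/2 : ℝ) • (R.transpose * hM h x + (R.transpose * hM h x).transpose) - 1) i j := by
    intro i j x
    simp [he, hg, Matrix.mul_apply, hM]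
    rw [mul_add]
    simp only [mul_comm (h _ _ _)]
  have heb : ∀ i j x, ‖x‖ < 3 → e i j x ^ 2 ≤ 2 * (1 + A) ^ 2 * distSOn (hM h x) ^ 2 + 2 * C5 ^ 2 * ε ^ 2 := by
    intro i j x hx
    have h1 : |e i j x| ≤ (1 + A) * distSOn (hM h x) + C5 * ε := by
      rw [heM]
      refine (abs_entry_le _ i j).trans ((sym_est (hM h x) R hR).trans ?_)
      have h2 := hD x (by linarith)
      have h3 := hRe' x hx
      nlinarith [dist_nonneg (hM h x)]
    have := pow_le_pow_left₀ (abs_nonneg _) h1 2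
    rw [sq_abs] at this
    nlinarith [sq_nonneg ((1 + A) * distSOn (hM h x) - C5 * ε)]
  have heI : ∀ i j, ∫ x in Metric.ball 0 3, e i j x ^ 2 ≤ (2 * (1 + A) ^ 2 + vB n 3 * (2 * C5 ^ 2)) * ε ^ 2 := by
    intro i j
    have hcc : Continuous fun x => 2 * (1 + A) ^ 2 * distSOn (hM h x) ^ 2 + 2 * C5 ^ 2 * ε ^ 2 :=
      (continuous_const.mul (hDc.pow 2)).add continuous_const
    refine (int_mono_B ((heHM i j).1.continuous.pow 2) hcc (heb i j)).trans ?_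
    have i1 : IntegrableOn (fun x => 2 * (1 + A) ^ 2 * distSOn (hM h x) ^ 2) (Metric.ball 0 3) := ciB (continuous_const.mul (hDc.pow 2)) 3
    have i2 : IntegrableOn (fun _ : Fin n → ℝ => 2 * C5 ^ 2 * ε ^ 2) (Metric.ball 0 3) := ciB continuous_const 3
    rw [integral_add i1 i2, int_const_B, integral_const_mul]
    have : ∫ x in Metric.ball (0 : Fin n → ℝ) 3, distSOn (hM h x) ^ 2 ≤ ε ^ 2 := (int_mono_set_B (hDc.pow 2) (fun x => sq_nonneg _) (show (3:ℝ) ≤ 8 by norm_num)).trans hε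
    have := mul_le_mul_of_nonneg_left this (show 0 ≤ 2 * (1 + A) ^ 2 by positivity)
    linarith
  have hpe : ∀ i j k x, ‖x‖ < 2 → pd (e i j) k x ^ 2 ≤ K * ε ^ 2 := by
    intro i j k x hx
    refine ((hC _ (heHM i j) x 3 (by linarith) (by linarith)).2.1 k).trans ?_
    rw [hK, mul_assoc]
    exact mul_le_mul_of_nonneg_left (heI i j) hC0
  have hdiff : ∀ i j x, DifferentiableAt ℝ (h i j) x := fun i j x => (hh i j).1.differentiable (by norm_num) x
  have hgd : ∀ i j x, DifferentiableAt ℝ (g i j) x := fun i j x => (hgHM i j).1.differentiable (by norm_num) x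
  have hpe2 : ∀ i j k x, pd (e i j) k x = (1/2:ℝ) * ((∑ l, R l i * pd (h l j) k x) + ∑ l, R l j * pd (h l i) k x) := by
    intro i j k x
    rw [← pd_lin Finset.univ (fun l => R l i) (fun l => hdiff l j x) k, ← pd_lin Finset.univ (fun l => R l j) (fun l => hdiff l i x) k]
    have : HasFDerivAt (e i j) ((1/2:ℝ) • (fderiv ℝ (g i j) x + fderiv ℝ (g j i) x)) x :=
      (((hgd i j x).hasFDerivAt.add (hgd j i x).hasFDerivAt).const_mul (1/2:ℝ)).sub_const _
    unfold pd
    rw [this.fderiv]; rfl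
  have hph : ∀ i j k x, ‖x‖ < 2 → pd (h i j) k x ^ 2 ≤ (3 * n ^ 2) ^ 2 * (K * ε ^ 2) := by
    intro i j k x hx
    exact korn_pt n hR (H := fun i j k => pd (h i j) k x) (fun i j k => hcurl i j k x (by linarith))
      (fun i j k => by rw [← hpe2]; exact hpe i j k x hx) i j k
  obtain ⟨R', hR', hf⟩ := hCo h (fun i j => (hh i j).1) 2 _ ε (by norm_num) (by norm_num) (by positivity) hph hε
  refine ⟨R', hR', fun x hx => (hf x (by linarith)).trans (le_of_eq (by ring))⟩

end GR

namespace GR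
variable {n : ℕ}

/-- ENNReal-valued squared Frobenius distance -/
def sq (F G : Matrix (Fin n) (Fin n) ℝ) : ENNReal := ENNReal.ofReal (frobn (F - G) ^ 2)

lemma sq_comm (F G : Matrix (Fin n) (Fin n) ℝ) : sq F G = sq G F := by rw [sq, sq, frobn_sub_comm]

lemma sq_tri (F G H : Matrix (Fin n) (Fin n) ℝ) : sq F H ≤ 2 * sq F G + 2 * sq G H := by
  unfold sq
  rw [show (2:ENNReal) = ENNReal.ofReal 2 by simp, ← ENNReal.ofReal_mul (by norm_num), ← ENNReal.ofReal_mul (by norm_num), ← ENNReal.ofReal_add (by positivity) (by positivity)]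
  refine ENNReal.ofReal_le_ofReal ?_
  have := frobn_tri_sq F G H
  linarith

lemma measurable_sq {α : Type*} [MeasurableSpace α] {F G : α → Matrix (Fin n) (Fin n) ℝ} (hF : ∀ i j, Measurable fun x => F x i j)
    (hG : ∀ i j, Measurable fun x => G x i j) : Measurable fun x => sq (F x) (G x) := by
  unfold sq frobn
  refine ENNReal.measurable_ofReal.comp (Measurable.pow_const ?_ 2)
  refine Real.continuous_sqrt.measurable.comp ?_
  exact Finset.measurable_sum _ fun i _ => Finset.measurable_sum _ fun j _ => ((hF i j).sub (hG i j)).pow_const 2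

lemma ofReal_dist_sq_le (F G : Matrix (Fin n) (Fin n) ℝ) :
    ENNReal.ofReal (distSOn G ^ 2) ≤ 2 * ENNReal.ofReal (distSOn F ^ 2) + 2 * sq F G := by
  unfold sq
  rw [show (2:ENNReal) = ENNReal.ofReal 2 by simp, ← ENNReal.ofReal_mul (by norm_num), ← ENNReal.ofReal_mul (by norm_num), ← ENNReal.ofReal_add (by positivity) (by positivity)]
  refine ENNReal.ofReal_le_ofReal ?_
  have h1 := dist_lip G F
  rw [frobn_sub_comm] at h1
  have h2 := pow_le_pow_left₀ (dist_nonneg _) h1 2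
  nlinarith [sq_nonneg (distSOn F - frobn (F - G))]

lemma sq_one_le (F R : Matrix (Fin n) (Fin n) ℝ) (hR : R ∈ SOn n) :
    sq F R ≤ 2 * ENNReal.ofReal (distSOn F ^ 2) + ENNReal.ofReal (8 * n ^ 2) := by
  obtain ⟨Q, hQ, hd⟩ := exists_dist F
  refine (sq_tri F Q R).trans ?_
  rw [hd]
  unfold sq
  refine add_le_add le_rfl ?_
  rw [show (2:ENNReal) = ENNReal.ofReal 2 by simp, ← ENNReal.ofReal_mul (by norm_num)]
  refine ENNReal.ofReal_le_ofReal ?_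
  have h1 := frobn_sub_le Q R
  have h2 := frobn_SOn_le hQ
  have h3 := frobn_SOn_le hR
  have := pow_le_pow_left₀ (frobn_nonneg _) (h1.trans (add_le_add h2 h3)) 2
  nlinarith

lemma local_rig0 (n : ℕ) : ∃ C : ENNReal, C ≠ ⊤ ∧ ∀ u : (Fin n → ℝ) → Fin n → ℝ,
    (∀ x ∈ Metric.ball (0 : Fin n → ℝ) 30, DifferentiableAt ℝ u x) →
    ∃ R ∈ SOn n, ∫⁻ x in Metric.ball 0 1, sq (DD u x) R ≤ C * ∫⁻ x in Metric.ball 0 30, ee u x := by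
  obtain ⟨C1, hC10, hC1⟩ := harm_approx n
  obtain ⟨C, hC0, hC⟩ := harm_rig n
  set V : ENNReal := volume (Metric.ball (0 : Fin n → ℝ) 1) with hV
  have hVt : V ≠ ⊤ := measure_ball_lt_top.ne
  set C' : ENNReal := 2 + 2 * ENNReal.ofReal C1 with hC'
  have hC't : C' ≠ ⊤ := by finiteness
  set CA : ENNReal := 2 * ENNReal.ofReal C1 + 2 * (ENNReal.ofReal C * V) * C' with hCA
  set CB : ENNReal := 2 + ENNReal.ofReal (8 * n ^ 2) * V * C' with hCB
  refine ⟨CA + CB, by finiteness, fun u hu => ?_⟩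
  obtain ⟨h, hh, hcurl, hap⟩ := hC1 u hu
  set E := ∫⁻ x in Metric.ball 0 30, ee u x with hE
  have hc : Continuous (hM h) := hM_cont fun i j => (hh i j).1.continuous
  have hDc : Continuous fun x => distSOn (hM h x) := continuous_dist.comp hc
  have hap' : ∫⁻ x in Metric.ball 0 8, sq (DD u x) (hM h x) ≤ ENNReal.ofReal C1 * E := hap
  have hE8 : ∫⁻ x in Metric.ball 0 8, ENNReal.ofReal (distSOn (hM h x) ^ 2) ≤ C' * E := by
    calc ∫⁻ x in Metric.ball 0 8, ENNReal.ofReal (distSOn (hM h x) ^ 2)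
        ≤ ∫⁻ x in Metric.ball 0 8, (2 * ee u x + 2 * sq (DD u x) (hM h x)) := lintegral_mono fun x => ofReal_dist_sq_le _ _
      _ = 2 * (∫⁻ x in Metric.ball 0 8, ee u x) + 2 * ∫⁻ x in Metric.ball 0 8, sq (DD u x) (hM h x) := by
          rw [lintegral_add_left ((measurable_ee u).const_mul 2), lintegral_const_mul' _ _ (by simp), lintegral_const_mul' _ _ (by simp)]
      _ ≤ 2 * E + 2 * (ENNReal.ofReal C1 * E) := by
          gcongr
          exact lintegral_mono_set (Metric.ball_subset_ball (by norm_num))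
      _ = _ := by rw [hC']; ring
  by_cases hcase : C' * E ≤ 1
  · have hfin : C' * E ≠ ⊤ := (hcase.trans_lt ENNReal.one_lt_top).ne
    set ε := Real.sqrt (C' * E).toReal with hε
    have hε2 : ε ^ 2 = (C' * E).toReal := Real.sq_sqrt ENNReal.toReal_nonneg
    have hε1 : ε ≤ 1 := by
      rw [hε, Real.sqrt_le_one]
      exact ENNReal.toReal_le_of_le_ofReal zero_le_one (by simpa using hcase)
    have hI : ∫ x in Metric.ball 0 8, distSOn (hM h x) ^ 2 ≤ ε ^ 2 := by
      rw [hε2, integral_eq_lintegral_of_nonneg_ae (ae_of_all _ fun x => sq_nonneg _) (hDc.pow 2).aestronglyMeasurable]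
      exact ENNReal.toReal_mono hfin hE8
    obtain ⟨R, hR, hRe⟩ := hC h hh hcurl ε (Real.sqrt_nonneg _) hε1 hI
    refine ⟨R, hR, ?_⟩
    calc ∫⁻ x in Metric.ball 0 1, sq (DD u x) R
        ≤ ∫⁻ x in Metric.ball 0 1, (2 * sq (DD u x) (hM h x) + 2 * (ENNReal.ofReal C * (C' * E))) := by
          refine setLIntegral_mono' measurableSet_ball fun x hx => ?_
          refine (sq_tri _ (hM h x) _).trans ?_
          gcongr
          unfold sq
          refine (ENNReal.ofReal_le_ofReal (hRe x (by simpa using hx))).trans ?_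
          rw [ENNReal.ofReal_mul hC0, hε2, ENNReal.ofReal_toReal hfin]
      _ = 2 * (∫⁻ x in Metric.ball 0 1, sq (DD u x) (hM h x)) + 2 * (ENNReal.ofReal C * (C' * E)) * V := by
          rw [lintegral_add_right _ measurable_const, lintegral_const_mul' _ _ (by simp), setLIntegral_const]
      _ ≤ 2 * (ENNReal.ofReal C1 * E) + 2 * (ENNReal.ofReal C * (C' * E)) * V := by
          gcongr
          exact (lintegral_mono_set (Metric.ball_subset_ball (by norm_num))).trans hap'
      _ = CA * E := by rw [hCA]; ring
      _ ≤ _ := by gcongr; exact le_self_add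
  · push Not at hcase
    refine ⟨1, one_mem, ?_⟩
    calc ∫⁻ x in Metric.ball 0 1, sq (DD u x) 1
        ≤ ∫⁻ x in Metric.ball 0 1, (2 * ee u x + ENNReal.ofReal (8 * n ^ 2)) := lintegral_mono fun x => sq_one_le _ _ one_mem
      _ = 2 * (∫⁻ x in Metric.ball 0 1, ee u x) + ENNReal.ofReal (8 * n ^ 2) * V := by
          rw [lintegral_add_right _ measurable_const, lintegral_const_mul' _ _ (by simp), setLIntegral_const]
      _ ≤ 2 * E + ENNReal.ofReal (8 * n ^ 2) * V * (C' * E) := by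
          refine add_le_add ?_ (le_mul_of_one_le_right zero_le hcase.le)
          gcongr
          exact lintegral_mono_set (Metric.ball_subset_ball (by norm_num))
      _ = CB * E := by rw [hCB]; ring
      _ ≤ _ := by gcongr; exact le_add_self

end GR

namespace GR
variable {n : ℕ}

/-- the open unit cube -/
def QQ (n : ℕ) : Set (Fin n → ℝ) := {x : Fin n → ℝ | ∀ i, x i ∈ Ioo (0:ℝ) 1}

/-- distance to the boundary of the cube -/
def dd (x : Fin n → ℝ) : ℝ := ⨅ i, min (x i) (1 - x i)

section
variable [Nonempty (Fin n)]

lemma dd_le_min (x : Fin n → ℝ) (i : Fin n) : dd x ≤ min (x i) (1 - x i) := ciInf_le (finite_range _).bddBelow i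

lemma dd_le1 (x : Fin n → ℝ) (i : Fin n) : dd x ≤ x i := (dd_le_min x i).trans (min_le_left _ _)

lemma dd_le2 (x : Fin n → ℝ) (i : Fin n) : dd x ≤ 1 - x i := (dd_le_min x i).trans (min_le_right _ _)

lemma le_dd {x : Fin n → ℝ} {c : ℝ} (h : ∀ i, c ≤ x i ∧ c ≤ 1 - x i) : c ≤ dd x := le_ciInf fun i => le_min (h i).1 (h i).2

lemma dd_exists (x : Fin n → ℝ) : ∃ i, dd x = x i ∨ dd x = 1 - x i := by
  obtain ⟨i, hi⟩ := exists_eq_ciInf_of_finite (f := fun i => min (x i) (1 - x i))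
  refine ⟨i, ?_⟩
  unfold dd
  rw [← hi]
  rcases min_choice (x i) (1 - x i) with h | h
  · left; exact h
  · right; exact h

lemma mem_QQ {x : Fin n → ℝ} : x ∈ QQ n ↔ 0 < dd x := by
  constructor
  · intro h
    obtain ⟨i, hi | hi⟩ := dd_exists x
    · rw [hi]; exact (h i).1
    · rw [hi]; linarith [(h i).2]
  · intro h i
    exact ⟨h.trans_le (dd_le1 x i), by linarith [dd_le2 x i]⟩

lemma dd_lip (x y : Fin n → ℝ) : dd x ≤ dd y + dist x y := by
  rw [← sub_le_iff_le_add]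
  refine le_dd fun i => ?_
  have h1 := dd_le1 x i
  have h2 := dd_le2 x i
  have h3 := dist_le_pi_dist x y i
  rw [Real.dist_eq, abs_le] at h3
  constructor <;> linarith [h3.1, h3.2]

lemma dd_le_half (x : Fin n → ℝ) : dd x ≤ 1 / 2 := by
  obtain ⟨i⟩ := (inferInstance : Nonempty (Fin n))
  linarith [dd_le1 x i, dd_le2 x i]

lemma dd_cont : Continuous (dd (n := n)) := by
  have : LipschitzWith 1 (dd (n := n)) := LipschitzWith.of_le_add_mul 1 fun x y => by simpa using dd_lip x y
  exact this.continuous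

lemma QQ_open : IsOpen (QQ n) := by
  have : QQ n = {x | 0 < dd x} := by ext x; exact mem_QQ
  rw [this]; exact isOpen_lt continuous_const dd_cont

lemma ball_sub_QQ {x : Fin n → ℝ} : Metric.ball x (dd x) ⊆ QQ n := by
  intro y hy
  rw [mem_QQ]
  have := dd_lip x y
  rw [Metric.mem_ball, dist_comm] at hy
  linarith

/-- kernel set -/
def kset (n : ℕ) (a : ℝ) : Set ((Fin n → ℝ) × (Fin n → ℝ)) := {p | dist p.1 p.2 < a * dd p.2}

lemma kset_meas (a : ℝ) : MeasurableSet (kset n a) :=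
  (isOpen_lt _root_.continuous_dist (continuous_const.mul (dd_cont.comp continuous_snd))).measurableSet

def om (z : Fin n → ℝ) : ENNReal := (QQ n).indicator (fun z => ENNReal.ofReal ((dd z)⁻¹ ^ n)) z

lemma om_meas : Measurable (om (n := n)) :=
  (ENNReal.measurable_ofReal.comp ((dd_cont.measurable.inv).pow_const n)).indicator QQ_open.measurableSet

lemma ker_low {a : ℝ} (ha : 0 < a) (ha1 : a ≤ 1) {x : Fin n → ℝ} (hx : x ∈ QQ n) :
    ENNReal.ofReal ((a / 2) ^ n) ≤ ∫⁻ z, om z * (kset n a).indicator 1 (x, z) := by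
  rw [mem_QQ] at hx
  have hd := hx
  calc ENNReal.ofReal ((a / 2) ^ n) = ∫⁻ z in Metric.ball x (a / 2 * dd x), ENNReal.ofReal ((2 * dd x)⁻¹ ^ n) := by
        rw [setLIntegral_const, Real.volume_pi_ball _ (by positivity), ← ENNReal.ofReal_mul (by positivity), Fintype.card_fin, ← mul_pow]
        congr 2; field_simp
    _ ≤ ∫⁻ z in Metric.ball x (a / 2 * dd x), om z * (kset n a).indicator 1 (x, z) := by
        refine setLIntegral_mono' measurableSet_ball fun z hz => ?_
        rw [Metric.mem_ball] at hz
        have h1 := dd_lip x z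
        have h2 := dd_lip z x
        rw [dist_comm] at h1
        have h3 : dd x / 2 ≤ dd z := by nlinarith
        have hz0 : 0 < dd z := by linarith
        have hk : (x, z) ∈ kset n a := by
          show dist x z < a * dd z
          rw [dist_comm]; nlinarith
        rw [indicator_of_mem hk, om, indicator_of_mem (mem_QQ.2 hz0)]
        simp only [Pi.one_apply, mul_one]
        refine ENNReal.ofReal_le_ofReal ?_
        refine pow_le_pow_left₀ (by positivity) ?_ n
        refine inv_anti₀ hz0 ?_
        nlinarith
    _ ≤ _ := setLIntegral_le_lintegral _ _

lemma ker_up {b : ℝ} (hb : 0 < b) (hb1 : b < 1) (y : Fin n → ℝ) (hy : y ∈ QQ n) :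
    ∫⁻ z, om z * (kset n b).indicator 1 (y, z) ≤ ENNReal.ofReal ((4 * b / (1 - b)) ^ n) := by
  rw [mem_QQ] at hy
  have hb2 : 0 < 1 - b := by linarith
  calc ∫⁻ z, om z * (kset n b).indicator 1 (y, z)
      ≤ ∫⁻ z, (Metric.ball y (b * (dd y / (1 - b)))).indicator (fun _ => ENNReal.ofReal ((2 / dd y) ^ n)) z := by
        refine lintegral_mono fun z => ?_
        by_cases hk : (y, z) ∈ kset n b
        swap
        · simp [indicator_of_notMem hk]
        by_cases hz : z ∈ QQ n
        swap
        · simp [om, indicator_of_notMem hz]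
        rw [indicator_of_mem hk, om, indicator_of_mem hz]
        rw [mem_QQ] at hz
        have hk' : dist y z < b * dd z := hk
        have h1 := dd_lip y z
        have h2 := dd_lip z y
        rw [dist_comm] at h2
        have h3 : dd z ≤ dd y / (1 - b) := by rw [le_div_iff₀ hb2]; nlinarith
        have hm : z ∈ Metric.ball y (b * (dd y / (1 - b))) := by
          rw [Metric.mem_ball, dist_comm]; nlinarith
        rw [indicator_of_mem hm]
        simp only [Pi.one_apply, mul_one]
        refine ENNReal.ofReal_le_ofReal ?_
        refine pow_le_pow_left₀ (by positivity) ?_ n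
        rw [inv_eq_one_div, div_le_div_iff₀ hz hy]
        nlinarith
    _ = _ := by
        rw [lintegral_indicator measurableSet_ball, setLIntegral_const, Real.volume_pi_ball _ (by positivity), ← ENNReal.ofReal_mul (by positivity), Fintype.card_fin, ← mul_pow]
        congr 2; field_simp; ring

lemma patch {a b : ℝ} (ha : 0 < a) (ha1 : a ≤ 1) (hb : 0 < b) (hb1 : b < 1) : ∃ C : ENNReal, C ≠ ⊤ ∧
    ∀ (P : Set (Fin n → ℝ)) (_ : MeasurableSet P) (A : (Fin n → ℝ) → Fin n → ℝ) (_ : Measurable A) (_ : ∀ x ∈ P, A x ∈ QQ n)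
      (g ρ : (Fin n → ℝ) → ENNReal) (_ : Measurable g) (_ : Measurable ρ) (K : ENNReal),
      (∀ z ∈ QQ n, ∫⁻ x in P ∩ A ⁻¹' Metric.ball z (a * dd z), g x ≤ K * ∫⁻ x in Metric.ball z (b * dd z), ρ x) →
      ∫⁻ x in P, g x ≤ C * K * ∫⁻ x in QQ n, ρ x := by
  set c1 := ENNReal.ofReal ((a / 2) ^ n) with hc1
  set c2 := ENNReal.ofReal ((4 * b / (1 - b)) ^ n) with hc2
  have hc10 : c1 ≠ 0 := by rw [hc1]; simp; positivity
  refine ⟨c1⁻¹ * c2, ENNReal.mul_ne_top (ENNReal.inv_ne_top.2 hc10) ENNReal.ofReal_ne_top, fun P hP A hA hAP g ρ hg hρ K h => ?_⟩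
  suffices hs : c1 * ∫⁻ x in P, g x ≤ K * (c2 * ∫⁻ x in QQ n, ρ x) by
    have hc1t : c1 ≠ ⊤ := ENNReal.ofReal_ne_top
    calc ∫⁻ x in P, g x = c1⁻¹ * (c1 * ∫⁻ x in P, g x) := by
          rw [← mul_assoc, ENNReal.inv_mul_cancel hc10 hc1t, one_mul]
      _ ≤ c1⁻¹ * (K * (c2 * ∫⁻ x in QQ n, ρ x)) := by gcongr
      _ = _ := by ring
  have hm1 : Measurable fun p : (Fin n → ℝ) × (Fin n → ℝ) => om p.2 * (kset n a).indicator 1 (A p.1, p.2) := by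
    refine (om_meas.comp measurable_snd).mul ?_
    exact (measurable_one.indicator (kset_meas a)).comp ((hA.comp measurable_fst).prodMk measurable_snd)
  have hm2 : Measurable fun p : (Fin n → ℝ) × (Fin n → ℝ) => om p.2 * (kset n b).indicator 1 (p.1, p.2) :=
    (om_meas.comp measurable_snd).mul (measurable_one.indicator (kset_meas b))
  calc c1 * ∫⁻ x in P, g x = ∫⁻ x in P, c1 * g x := (lintegral_const_mul _ hg).symm
    _ ≤ ∫⁻ x in P, ∫⁻ z, g x * (om z * (kset n a).indicator 1 (A x, z)) := by
        refine setLIntegral_mono' hP fun x hx => ?_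
        have hmx : Measurable fun z => om z * (kset n a).indicator 1 (A x, z) := hm1.comp (measurable_prodMk_left (x := x))
        rw [lintegral_const_mul _ hmx, mul_comm]
        gcongr
        exact ker_low ha ha1 (hAP x hx)
    _ = ∫⁻ z, ∫⁻ x in P, g x * (om z * (kset n a).indicator 1 (A x, z)) := by
        refine lintegral_lintegral_swap ?_
        exact ((hg.comp measurable_fst).mul hm1).aemeasurable
    _ ≤ ∫⁻ z, K * ∫⁻ y in QQ n, ρ y * (om z * (kset n b).indicator 1 (y, z)) := by
        refine lintegral_mono fun z => ?_
        by_cases hz : z ∈ QQ n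
        swap
        · simp [om, indicator_of_notMem hz]
        have e1 : ∫⁻ x in P, g x * (om z * (kset n a).indicator 1 (A x, z)) = om z * ∫⁻ x in P ∩ A ⁻¹' Metric.ball z (a * dd z), g x := by
          rw [inter_comm, ← Measure.restrict_restrict (hA measurableSet_ball), ← lintegral_indicator (hA measurableSet_ball), ← lintegral_const_mul _ (hg.indicator (hA measurableSet_ball))]
          refine lintegral_congr fun x => ?_
          by_cases hk : (A x, z) ∈ kset n a
          · rw [indicator_of_mem hk, indicator_of_mem (show x ∈ A ⁻¹' Metric.ball z (a * dd z) from hk)]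
            simp [mul_comm]
          · rw [indicator_of_notMem hk, indicator_of_notMem (show x ∉ A ⁻¹' Metric.ball z (a * dd z) from hk)]
            simp
        have e2 : ∫⁻ y in QQ n, ρ y * (om z * (kset n b).indicator 1 (y, z)) = om z * ∫⁻ x in Metric.ball z (b * dd z), ρ x := by
          have hsub : Metric.ball z (b * dd z) ∩ QQ n = Metric.ball z (b * dd z) := by
            refine inter_eq_left.2 ((Metric.ball_subset_ball ?_).trans ball_sub_QQ)
            have := mem_QQ.1 hz
            nlinarith
          rw [← hsub, ← Measure.restrict_restrict measurableSet_ball, ← lintegral_indicator measurableSet_ball, ← lintegral_const_mul _ (hρ.indicator measurableSet_ball)]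
          refine lintegral_congr fun x => ?_
          by_cases hk : (x, z) ∈ kset n b
          · rw [indicator_of_mem hk, indicator_of_mem (show x ∈ Metric.ball z (b * dd z) from hk)]
            simp [mul_comm]
          · rw [indicator_of_notMem hk, indicator_of_notMem (show x ∉ Metric.ball z (b * dd z) from hk)]
            simp
        rw [e1, e2, mul_left_comm]
        gcongr
        exact h z hz
    _ = K * ∫⁻ z, ∫⁻ y in QQ n, ρ y * (om z * (kset n b).indicator 1 (y, z)) := by
        rw [lintegral_const_mul]
        exact Measurable.lintegral_prod_left ((hρ.comp measurable_fst).mul hm2)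
    _ = K * ∫⁻ y in QQ n, ∫⁻ z, ρ y * (om z * (kset n b).indicator 1 (y, z)) := by
        congr 1
        refine (lintegral_lintegral_swap ?_).symm
        exact ((hρ.comp measurable_fst).mul hm2).aemeasurable
    _ ≤ K * ∫⁻ y in QQ n, c2 * ρ y := by
        gcongr K * ?_
        refine setLIntegral_mono' QQ_open.measurableSet fun y hy => ?_
        have hmx : Measurable fun z => om z * (kset n b).indicator 1 (y, z) := hm2.comp (measurable_prodMk_left (x := y))
        rw [lintegral_const_mul _ hmx, mul_comm]
        gcongr
        exact ker_up hb hb1 y hy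
    _ = _ := by rw [lintegral_const_mul _ hρ]

end

end GR

namespace GR
variable {n : ℕ}

lemma dmap_cont (α β : Fin n → ℝ) : Continuous (dmap α β) :=
  continuous_pi fun i => (continuous_const.mul (continuous_apply i)).add continuous_const

lemma dm_le (α β : Fin n → ℝ) {κ : ℝ} (hκ : 0 < κ) (hα : κ ≤ ∏ i, α i) {S T : Set (Fin n → ℝ)} (hS : MeasurableSet S)
    (hT : ∀ x ∈ S, dmap α β x ∈ T) (g : (Fin n → ℝ) → ENNReal) :
    ∫⁻ x in S, g (dmap α β x) ≤ (ENNReal.ofReal κ)⁻¹ * ∫⁻ x in T, g x := by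
  have hp : 0 < ∏ i, α i := hκ.trans_le hα
  have h0 : ∀ i, α i ≠ 0 := fun i h => hp.ne' (Finset.prod_eq_zero (Finset.mem_univ i) h)
  have h1 := lint_dmap α β h0 S hS g
  have h2 : ∫⁻ x in dmap α β '' S, g x ≤ ∫⁻ x in T, g x := lintegral_mono_set (image_subset_iff.2 hT)
  have hk0 : ENNReal.ofReal κ ≠ 0 := by simpa using hκ
  suffices hs : ENNReal.ofReal κ * ∫⁻ x in S, g (dmap α β x) ≤ ∫⁻ x in T, g x by
    calc ∫⁻ x in S, g (dmap α β x) = (ENNReal.ofReal κ)⁻¹ * (ENNReal.ofReal κ * ∫⁻ x in S, g (dmap α β x)) := by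
          rw [← mul_assoc, ENNReal.inv_mul_cancel hk0 ENNReal.ofReal_ne_top, one_mul]
      _ ≤ _ := by gcongr
  calc ENNReal.ofReal κ * ∫⁻ x in S, g (dmap α β x) ≤ ENNReal.ofReal |∏ i, α i| * ∫⁻ x in S, g (dmap α β x) := by
        gcongr; rw [abs_of_pos hp]; exact hα
    _ = _ := h1.symm
    _ ≤ _ := h2

/-- local rigidity hypothesis -/
def LOC (F : (Fin n → ℝ) → Matrix (Fin n) (Fin n) ℝ) (ρ : (Fin n → ℝ) → ENNReal) (a b : ℝ) (K : ENNReal) : Prop :=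
  ∀ z ∈ QQ n, ∃ R ∈ SOn n, ∫⁻ y in Metric.ball z (a * dd z), sq (F y) R ≤ K * ∫⁻ y in Metric.ball z (b * dd z), ρ y

lemma meas_dm {F : (Fin n → ℝ) → Matrix (Fin n) (Fin n) ℝ} (hF : ∀ i j, Measurable fun x => F x i j) (α β : Fin n → ℝ) :
    ∀ i j, Measurable fun x => F (dmap α β x) i j := fun i j => (hF i j).comp (dmap_cont α β).measurable

lemma sq_self (F : Matrix (Fin n) (Fin n) ℝ) : sq F F = 0 := by
  simp [sq, frobn]

/-- interpolated coefficients -/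
def itp (t : ℝ) (α α' : Fin n → ℝ) : Fin n → ℝ := fun i => (1 - t) * α i + t * α' i

lemma dmap_itp (t : ℝ) (α β α' β' x : Fin n → ℝ) (i : Fin n) :
    dmap (itp t α α') (itp t β β') x i = (1 - t) * dmap α β x i + t * dmap α' β' x i := by
  simp only [dmap, itp]; ring

section
variable [Nonempty (Fin n)]

lemma pair_est {a b κ : ℝ} (ha : 0 < a) (ha1 : a ≤ 1) (hb : 0 < b) (hb1 : b < 1) (hκ : 0 < κ) : ∃ C : ENNReal, C ≠ ⊤ ∧
    ∀ (F : (Fin n → ℝ) → Matrix (Fin n) (Fin n) ℝ) (_ : ∀ i j, Measurable fun x => F x i j) (ρ : (Fin n → ℝ) → ENNReal) (_ : Measurable ρ)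
      (K : ENNReal) (_ : LOC F ρ a b K) (α β α' β' : Fin n → ℝ) (_ : κ ≤ ∏ i, α i) (_ : κ ≤ ∏ i, α' i)
      (P : Set (Fin n → ℝ)) (_ : MeasurableSet P) (_ : ∀ x ∈ P, dmap α β x ∈ QQ n)
      (_ : ∀ x ∈ P, dist (dmap α β x) (dmap α' β' x) ≤ a / 4 * dd (dmap α β x)),
      ∫⁻ x in P, sq (F (dmap α β x)) (F (dmap α' β' x)) ≤ C * K * ∫⁻ x in QQ n, ρ x := by
  obtain ⟨C, hCt, hC⟩ := patch (n := n) (a := a / 2) (by positivity) (by linarith) hb hb1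
  set k := (ENNReal.ofReal κ)⁻¹ with hk
  have hkt : k ≠ ⊤ := by rw [hk]; simpa using hκ
  refine ⟨C * (4 * k), by finiteness, fun F hF ρ hρ K hL α β α' β' hα hα' P hP hPQ hd => ?_⟩
  have := hC P hP (dmap α β) (dmap_cont α β).measurable hPQ (fun x => sq (F (dmap α β x)) (F (dmap α' β' x))) ρ
    (measurable_sq (meas_dm hF α β) (meas_dm hF α' β')) hρ (4 * k * K) ?_
  · refine this.trans (le_of_eq (by ring))
  intro z hz
  obtain ⟨R, _, hR⟩ := hL z hz
  rw [mem_QQ] at hz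
  have hSm : MeasurableSet (P ∩ dmap α β ⁻¹' Metric.ball z (a / 2 * dd z)) := hP.inter ((dmap_cont α β).measurable measurableSet_ball)
  have h1 := dm_le α β hκ hα hSm (T := Metric.ball z (a * dd z)) (fun x hx => Metric.ball_subset_ball (by nlinarith) hx.2) (fun y => sq (F y) R)
  have h2 := dm_le α' β' hκ hα' hSm (T := Metric.ball z (a * dd z)) (fun x hx => by
    have e1 : dist (dmap α β x) z < a / 2 * dd z := hx.2
    have e2 := hd x hx.1
    have e3 := dd_lip (dmap α β x) z
    have e4 := dist_triangle (dmap α' β' x) (dmap α β x) z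
    rw [dist_comm (dmap α' β' x) (dmap α β x)] at e4
    rw [Metric.mem_ball]
    have e5 : dd (dmap α β x) ≤ 3/2 * dd z := by nlinarith
    have e6 : a / 4 * dd (dmap α β x) ≤ a / 4 * (3/2 * dd z) := mul_le_mul_of_nonneg_left e5 (by positivity)
    have e7 : 0 < a * dd z := by positivity
    nlinarith) (fun y => sq (F y) R)
  calc ∫⁻ x in P ∩ dmap α β ⁻¹' Metric.ball z (a / 2 * dd z), sq (F (dmap α β x)) (F (dmap α' β' x))
      ≤ ∫⁻ x in P ∩ dmap α β ⁻¹' Metric.ball z (a / 2 * dd z), (2 * sq (F (dmap α β x)) R + 2 * sq (F (dmap α' β' x)) R) :=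
        lintegral_mono fun x => by rw [sq_comm (F (dmap α' β' x)) R]; exact sq_tri _ _ _
    _ = 2 * (∫⁻ x in P ∩ dmap α β ⁻¹' Metric.ball z (a / 2 * dd z), sq (F (dmap α β x)) R)
        + 2 * ∫⁻ x in P ∩ dmap α β ⁻¹' Metric.ball z (a / 2 * dd z), sq (F (dmap α' β' x)) R := by
        have hm : Measurable fun x => 2 * sq (F (dmap α β x)) R := (measurable_sq (G := fun _ => R) (meas_dm hF α β) fun i j => measurable_const).const_mul 2
        rw [lintegral_add_left hm, lintegral_const_mul' _ _ (by simp), lintegral_const_mul' _ _ (by simp)]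
    _ ≤ 2 * (k * (K * ∫⁻ y in Metric.ball z (b * dd z), ρ y)) + 2 * (k * (K * ∫⁻ y in Metric.ball z (b * dd z), ρ y)) := by
        gcongr
        · exact h1.trans (by gcongr)
        · exact h2.trans (by gcongr)
    _ = _ := by ring


lemma chain_est {a b κ D : ℝ} (ha : 0 < a) (ha1 : a ≤ 1) (hb : 0 < b) (hb1 : b < 1) (hκ : 0 < κ) (hD : 0 ≤ D) : ∃ C : ENNReal, C ≠ ⊤ ∧
    ∀ (F : (Fin n → ℝ) → Matrix (Fin n) (Fin n) ℝ) (_ : ∀ i j, Measurable fun x => F x i j) (ρ : (Fin n → ℝ) → ENNReal) (_ : Measurable ρ)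
      (K : ENNReal) (_ : LOC F ρ a b K) (α β α' β' : Fin n → ℝ) (_ : ∀ i, κ ≤ α i) (_ : ∀ i, κ ≤ α' i)
      (P : Set (Fin n → ℝ)) (_ : MeasurableSet P) (d0 : (Fin n → ℝ) → ℝ) (_ : ∀ x ∈ P, 0 < d0 x)
      (_ : ∀ x ∈ P, d0 x ≤ dd (dmap α β x)) (_ : ∀ x ∈ P, d0 x ≤ dd (dmap α' β' x))
      (_ : ∀ x ∈ P, dist (dmap α β x) (dmap α' β' x) ≤ D * d0 x),
      ∫⁻ x in P, sq (F (dmap α β x)) (F (dmap α' β' x)) ≤ C * K * ∫⁻ x in QQ n, ρ x := by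
  obtain ⟨C, hCt, hC⟩ := pair_est (n := n) ha ha1 hb hb1 (pow_pos hκ n)
  obtain ⟨N, hN⟩ := exists_nat_gt (D / (a / 4))
  have hN0 : (0:ℝ) < N := lt_of_le_of_lt (by positivity) hN
  rw [div_lt_iff₀ (by positivity)] at hN
  refine ⟨4 ^ N * C, by finiteness, fun F hF ρ hρ K hL α β α' β' hα hα' P hP d0 hd0 hd1 hd2 hdist => ?_⟩
  have key : ∀ m : ℕ, m ≤ N → ∫⁻ x in P, sq (F (dmap α β x)) (F (dmap (itp (m / N) α α') (itp (m / N) β β') x)) ≤ 4 ^ m * (C * K * ∫⁻ x in QQ n, ρ x) := by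
    intro m
    induction m with
    | zero =>
      intro _
      have e : ∀ γ γ' : Fin n → ℝ, itp (((0:ℕ):ℝ) / N) γ γ' = γ := by intro γ γ'; ext i; simp [itp]
      simp only [e, sq_self]; simp
    | succ m ih =>
      intro hm
      have hm' : (m:ℝ) + 1 ≤ N := by exact_mod_cast hm
      set t : ℝ := m / N with ht
      set t' : ℝ := ((m + 1 : ℕ):ℝ) / N with ht'
      have htt : t' - t = 1 / N := by rw [ht, ht']; push_cast; ring
      have ht0 : 0 ≤ t := by positivity
      have ht0' : 0 ≤ t' := by positivity
      have ht1' : t' ≤ 1 := by rw [ht', div_le_one hN0]; exact_mod_cast hm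
      have ht1 : t ≤ 1 := by have : 0 < 1 / (N:ℝ) := by positivity
                             linarith
      have hprod : ∀ s : ℝ, 0 ≤ s → s ≤ 1 → κ ^ n ≤ ∏ i, itp s α α' i := by
        intro s hs0 hs1
        calc κ ^ n = ∏ _i : Fin n, κ := by simp
          _ ≤ _ := Finset.prod_le_prod (fun _ _ => hκ.le) fun i _ => by
            simp only [itp]; nlinarith [hα i, hα' i]
      have hdd : ∀ x ∈ P, d0 x ≤ dd (dmap (itp t α α') (itp t β β') x) := by
        intro x hx
        refine le_dd fun i => ?_
        rw [dmap_itp]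
        have q1 := (hd1 x hx).trans (dd_le1 _ i)
        have q2 := (hd1 x hx).trans (dd_le2 _ i)
        have q3 := (hd2 x hx).trans (dd_le1 _ i)
        have q4 := (hd2 x hx).trans (dd_le2 _ i)
        constructor <;> nlinarith
      have h2 := hC F hF ρ hρ K hL (itp t α α') (itp t β β') (itp t' α α') (itp t' β β') (hprod t ht0 ht1) (hprod t' ht0' ht1') P hP
        (fun x hx => mem_QQ.2 ((hd0 x hx).trans_le (hdd x hx))) (fun x hx => by
          have q1 : dist (dmap (itp t α α') (itp t β β') x) (dmap (itp t' α α') (itp t' β β') x) ≤ (1 / N) * dist (dmap α β x) (dmap α' β' x) := by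
            refine (dist_pi_le_iff (by positivity)).2 fun i => ?_
            rw [dmap_itp, dmap_itp, Real.dist_eq]
            have : (1 - t) * dmap α β x i + t * dmap α' β' x i - ((1 - t') * dmap α β x i + t' * dmap α' β' x i) = (t' - t) * (dmap α β x i - dmap α' β' x i) := by ring
            rw [this, htt, abs_mul, abs_of_pos (show 0 < 1 / (N:ℝ) by positivity), ← Real.dist_eq]
            exact mul_le_mul_of_nonneg_left (dist_le_pi_dist _ _ i) (by positivity)
          refine q1.trans ?_
          have q2 := hdist x hx
          have q3 : (1 / (N:ℝ)) * dist (dmap α β x) (dmap α' β' x) ≤ (1 / N) * (N * (a / 4) * d0 x) := by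
            refine mul_le_mul_of_nonneg_left (q2.trans ?_) (by positivity)
            exact mul_le_mul_of_nonneg_right hN.le (hd0 x hx).le
          refine q3.trans ?_
          have : (1 / (N:ℝ)) * (N * (a / 4) * d0 x) = a / 4 * d0 x := by field_simp
          rw [this]
          exact mul_le_mul_of_nonneg_left (hdd x hx) (by positivity))
      calc ∫⁻ x in P, sq (F (dmap α β x)) (F (dmap (itp t' α α') (itp t' β β') x))
          ≤ ∫⁻ x in P, (2 * sq (F (dmap α β x)) (F (dmap (itp t α α') (itp t β β') x))
              + 2 * sq (F (dmap (itp t α α') (itp t β β') x)) (F (dmap (itp t' α α') (itp t' β β') x))) := lintegral_mono fun x => sq_tri _ _ _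
        _ = 2 * (∫⁻ x in P, sq (F (dmap α β x)) (F (dmap (itp t α α') (itp t β β') x)))
            + 2 * ∫⁻ x in P, sq (F (dmap (itp t α α') (itp t β β') x)) (F (dmap (itp t' α α') (itp t' β β') x)) := by
            have hmm : Measurable fun x => 2 * sq (F (dmap α β x)) (F (dmap (itp t α α') (itp t β β') x)) :=
              (measurable_sq (meas_dm hF α β) (meas_dm hF _ _)).const_mul 2
            rw [lintegral_add_left hmm, lintegral_const_mul' _ _ (by simp), lintegral_const_mul' _ _ (by simp)]
        _ ≤ 2 * (4 ^ m * (C * K * ∫⁻ x in QQ n, ρ x)) + 2 * (4 ^ m * (C * K * ∫⁻ x in QQ n, ρ x)) := by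
            gcongr
            · exact ih (by omega)
            · exact h2.trans (le_mul_of_one_le_left zero_le (one_le_pow₀ (by norm_num)))
        _ = _ := by ring
  have h1 := key N le_rfl
  have e : ∀ γ γ' : Fin n → ℝ, itp ((N:ℝ) / N) γ γ' = γ' := by intro γ γ'; ext i; simp [itp, div_self hN0.ne']
  simp only [e] at h1
  exact h1.trans (le_of_eq (by ring))

end

end GR

namespace GR
variable {n : ℕ}

lemma dmap_id (x : Fin n → ℝ) : dmap (fun _ => 1) (fun _ => 0) x = x := by ext i; simp [dmap]

lemma vol_QQ_ne_top : volume (QQ n) ≠ ⊤ := by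
  refine (lt_of_le_of_lt (measure_mono ?_) (measure_ball_lt_top (x := (0 : Fin n → ℝ)) (r := 2))).ne
  intro x hx
  rw [mem_ball_zero_iff]
  refine lt_of_le_of_lt ((pi_norm_le_iff_of_nonneg zero_le_one).2 fun i => ?_) one_lt_two
  rw [Real.norm_eq_abs, abs_le]
  constructor <;> linarith [(hx i).1, (hx i).2]

lemma lint_tri {F : (Fin n → ℝ) → Matrix (Fin n) (Fin n) ℝ} (hF : ∀ i j, Measurable fun x => F x i j)
    {G : (Fin n → ℝ) → Matrix (Fin n) (Fin n) ℝ} (hG : ∀ i j, Measurable fun x => G x i j) (R : Matrix (Fin n) (Fin n) ℝ) (P : Set (Fin n → ℝ)) :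
    ∫⁻ x in P, sq (F x) R ≤ 2 * (∫⁻ x in P, sq (F x) (G x)) + 2 * ∫⁻ x in P, sq (G x) R := by
  have hm : Measurable fun x => 2 * sq (F x) (G x) := (measurable_sq hF hG).const_mul 2
  calc ∫⁻ x in P, sq (F x) R ≤ ∫⁻ x in P, (2 * sq (F x) (G x) + 2 * sq (G x) R) := lintegral_mono fun x => sq_tri _ _ _
    _ = _ := by rw [lintegral_add_left hm, lintegral_const_mul' _ _ (by simp), lintegral_const_mul' _ _ (by simp)]

section
variable [Nonempty (Fin n)]

lemma bd_piece {a b : ℝ} (ha : 0 < a) (ha1 : a ≤ 1) (hb : 0 < b) (hb1 : b < 1) : ∃ C : ENNReal, C ≠ ⊤ ∧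
    ∀ (F : (Fin n → ℝ) → Matrix (Fin n) (Fin n) ℝ) (_ : ∀ i j, Measurable fun x => F x i j) (ρ : (Fin n → ℝ) → ENNReal) (_ : Measurable ρ)
      (K : ENNReal) (_ : LOC F ρ a b K) (R : Matrix (Fin n) (Fin n) ℝ) (P : Set (Fin n → ℝ)) (_ : MeasurableSet P) (i : Fin n) (s : ℝ)
      (_ : ∀ x ∈ P, 0 < dd x ∧ dd x ≤ 1 / (16 * n) ∧ ((s = 0 ∧ x i = dd x) ∨ (s = 1 - 8 * n ∧ 1 - x i = dd x))),
      ∫⁻ x in P, sq (F x) R ≤ 2 * (C * K * ∫⁻ x in QQ n, ρ x) + 2 * ((ENNReal.ofReal (8 * n))⁻¹ * ∫⁻ x in QQ n, sq (F x) R) := by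
  have hn : 1 ≤ (n:ℝ) := by
    have : 0 < n := Fin.pos_iff_nonempty.2 inferInstance
    exact_mod_cast this
  obtain ⟨C, hCt, hC⟩ := chain_est (n := n) (κ := 1) (D := 8 * n) ha ha1 hb hb1 one_pos (by positivity)
  refine ⟨C, hCt, fun F hF ρ hρ K hL R P hP i s hPp => ?_⟩
  set α : Fin n → ℝ := fun j => if j = i then 8 * (n:ℝ) else 1 with hα
  set β : Fin n → ℝ := fun j => if j = i then s else 0 with hβ
  have hT1 : ∀ x, dmap α β x i = 8 * n * x i + s := by intro x; simp [dmap, hα, hβ]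
  have hT2 : ∀ x j, j ≠ i → dmap α β x j = x j := by intro x j hj; simp [dmap, hα, hβ, hj]
  have hfacts : ∀ x ∈ P, dd x ≤ dmap α β x i ∧ dd x ≤ 1 - dmap α β x i ∧ |x i - dmap α β x i| ≤ 8 * n * dd x := by
    intro x hx
    obtain ⟨h0, h1, h2⟩ := hPp x hx
    have h3 : 8 * n * dd x ≤ 1 / 2 := by
      rw [le_div_iff₀ (by positivity)] at h1; linarith
    have h4 := dd_le_half x
    have h5 : dd x ≤ 8 * n * dd x := by nlinarith
    rw [hT1, abs_le]
    rcases h2 with ⟨hs, h2⟩ | ⟨hs, h2⟩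
    · rw [h2, hs]
      refine ⟨?_, ?_, ?_, ?_⟩ <;> linarith
    · have : x i = 1 - dd x := by linarith
      rw [this, hs]
      refine ⟨?_, ?_, ?_, ?_⟩ <;> linarith
  have hddT : ∀ x ∈ P, dd x ≤ dd (dmap α β x) := by
    intro x hx
    refine le_dd fun j => ?_
    by_cases hj : j = i
    · subst hj; exact ⟨(hfacts x hx).1, (hfacts x hx).2.1⟩
    · rw [hT2 x j hj]; exact ⟨dd_le1 x j, dd_le2 x j⟩
  have h1 := hC F hF ρ hρ K hL (fun _ => 1) (fun _ => 0) α β (fun _ => le_rfl) (fun j => by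
      simp only [hα]; split_ifs
      · linarith
      · exact le_rfl) P hP dd (fun x hx => (hPp x hx).1)
      (fun x _ => by rw [dmap_id]) hddT (fun x hx => by
        rw [dmap_id]
        have := (hPp x hx).1
        refine (dist_pi_le_iff (by positivity)).2 fun j => ?_
        by_cases hj : j = i
        · subst hj; rw [Real.dist_eq]; exact (hfacts x hx).2.2
        · rw [hT2 x j hj, dist_self]; positivity)
  simp only [dmap_id] at h1
  have h2 := dm_le α β (κ := 8 * n) (by positivity) (by simp [hα, Finset.prod_ite_eq']) hP (T := QQ n)
    (fun x hx => mem_QQ.2 ((hPp x hx).1.trans_le (hddT x hx))) (fun y => sq (F y) R)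
  refine (lint_tri hF (meas_dm hF α β) R P).trans ?_
  gcongr

lemma int_piece {a b δ : ℝ} (ha : 0 < a) (ha1 : a ≤ 1) (hb : 0 < b) (hb1 : b < 1) (hδ : 0 < δ) : ∃ C : ENNReal, C ≠ ⊤ ∧
    ∀ (F : (Fin n → ℝ) → Matrix (Fin n) (Fin n) ℝ) (_ : ∀ i j, Measurable fun x => F x i j) (ρ : (Fin n → ℝ) → ENNReal) (_ : Measurable ρ)
      (K : ENNReal) (_ : LOC F ρ a b K), ∃ R ∈ SOn n, 
      ∫⁻ x in {x | δ ≤ dd x}, sq (F x) R ≤ C * K * ∫⁻ x in QQ n, ρ x := by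
  obtain ⟨C, hCt, hC⟩ := chain_est (n := n) (κ := a / 2) (D := 1 / δ) ha ha1 hb hb1 (by positivity) (by positivity)
  set k := (ENNReal.ofReal ((a / 2) ^ n))⁻¹ with hk
  have hkt : k ≠ ⊤ := by
    rw [hk]; simp only [ne_eq, ENNReal.inv_eq_top, ENNReal.ofReal_eq_zero, not_le]; positivity
  refine ⟨2 * C + 2 * k, by finiteness, fun F hF ρ hρ K hL => ?_⟩
  set c : Fin n → ℝ := fun _ => 1 / 2 with hc
  have hdc : dd c = 1 / 2 := by
    refine le_antisymm (dd_le_half c) (le_dd fun i => ?_)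
    simp [hc]; norm_num
  have hcQ : c ∈ QQ n := by rw [mem_QQ, hdc]; norm_num
  obtain ⟨R, hR, hRe⟩ := hL c hcQ
  refine ⟨R, hR, ?_⟩
  have hP : MeasurableSet {x : Fin n → ℝ | δ ≤ dd x} := (isClosed_le continuous_const dd_cont).measurableSet
  set α : Fin n → ℝ := fun _ => a / 2 with hα
  set β : Fin n → ℝ := fun _ => (1 - a / 2) / 2 with hβ
  have hx01 : ∀ x : Fin n → ℝ, δ ≤ dd x → ∀ i, 0 ≤ x i ∧ x i ≤ 1 := fun x hx i => ⟨by linarith [dd_le1 x i], by linarith [dd_le2 x i]⟩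
  have h1 := hC F hF ρ hρ K hL (fun _ => 1) (fun _ => 0) α β (fun _ => by linarith) (fun _ => le_rfl) _ hP (fun _ => δ) (fun _ _ => hδ)
    (fun x hx => by rw [dmap_id]; exact hx)
    (fun x hx => le_dd fun i => by
      have q1 := dd_le_half x
      have q2 := hx01 x hx i
      have q3 : δ ≤ dd x := hx
      have q4 := dd_le1 x i
      have q5 := dd_le2 x i
      simp only [dmap, hα, hβ]
      constructor <;> nlinarith)
    (fun x hx => by
      rw [dmap_id, one_div_mul_cancel hδ.ne']
      refine (dist_pi_le_iff zero_le_one).2 fun i => ?_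
      have q2 := hx01 x hx i
      rw [Real.dist_eq, abs_le]
      simp only [dmap, hα, hβ]
      constructor <;> nlinarith)
  simp only [dmap_id] at h1
  have h2 := dm_le α β (κ := (a / 2) ^ n) (by positivity) (le_of_eq (by simp [hα, div_pow])) hP (T := Metric.ball c (a * dd c)) (fun x hx => by
      rw [Metric.mem_ball, hdc]
      refine (dist_pi_lt_iff (by positivity)).2 fun i => ?_
      have q4 := dd_le1 x i
      have q5 := dd_le2 x i
      have q3 : δ ≤ dd x := hx
      rw [Real.dist_eq, abs_lt]
      simp only [dmap, hα, hβ, hc]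
      constructor <;> nlinarith) (fun y => sq (F y) R)
  have h3 : ∫⁻ y in Metric.ball c (b * dd c), ρ y ≤ ∫⁻ y in QQ n, ρ y := by
    refine lintegral_mono_set ((Metric.ball_subset_ball ?_).trans ball_sub_QQ)
    rw [hdc]; linarith
  refine (lint_tri hF (meas_dm hF α β) R _).trans ?_
  calc _ ≤ 2 * (C * K * ∫⁻ x in QQ n, ρ x) + 2 * (k * (K * ∫⁻ x in QQ n, ρ x)) := by
        gcongr
        refine h2.trans ?_
        gcongr
        exact hRe.trans (by gcongr)
    _ = _ := by ring

lemma glob {a b : ℝ} (ha : 0 < a) (ha1 : a ≤ 1) (hb : 0 < b) (hb1 : b < 1) : ∃ C : ENNReal, C ≠ ⊤ ∧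
    ∀ (F : (Fin n → ℝ) → Matrix (Fin n) (Fin n) ℝ) (_ : ∀ i j, Measurable fun x => F x i j) (ρ : (Fin n → ℝ) → ENNReal) (_ : Measurable ρ)
      (K : ENNReal) (_ : LOC F ρ a b K) (_ : ∫⁻ x in QQ n, sq (F x) 1 ≠ ⊤), ∃ R ∈ SOn n,
      ∫⁻ x in QQ n, sq (F x) R ≤ C * K * ∫⁻ x in QQ n, ρ x := by
  have hn : 1 ≤ (n:ℝ) := by
    have : 0 < n := Fin.pos_iff_nonempty.2 inferInstance
    exact_mod_cast this
  obtain ⟨C1, hC1t, hC1⟩ := bd_piece (n := n) ha ha1 hb hb1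
  obtain ⟨C2, hC2t, hC2⟩ := int_piece (n := n) (δ := 1 / (16 * n)) ha ha1 hb hb1 (by positivity)
  refine ⟨2 * (C2 + 4 * n * C1), by finiteness, fun F hF ρ hρ K hL hfin => ?_⟩
  obtain ⟨R, hR, hI⟩ := hC2 F hF ρ hρ K hL
  refine ⟨R, hR, ?_⟩
  set X := ∫⁻ x in QQ n, sq (F x) R with hX
  set Y := ∫⁻ x in QQ n, ρ x with hY
  have hXt : X ≠ ⊤ := by
    refine ne_top_of_le_ne_top ?_ (lint_tri hF (G := fun _ => 1) (fun i j => measurable_const) R (QQ n))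
    rw [setLIntegral_const]
    refine ENNReal.add_ne_top.2 ⟨ENNReal.mul_ne_top (by simp) hfin, ENNReal.mul_ne_top (by simp) (ENNReal.mul_ne_top ENNReal.ofReal_ne_top vol_QQ_ne_top)⟩
  set P1 : Fin n → Set (Fin n → ℝ) := fun i => {x | 0 < dd x ∧ dd x ≤ 1 / (16 * n) ∧ x i = dd x} with hP1
  set P2 : Fin n → Set (Fin n → ℝ) := fun i => {x | 0 < dd x ∧ dd x ≤ 1 / (16 * n) ∧ 1 - x i = dd x} with hP2
  have hm0 : MeasurableSet {x : Fin n → ℝ | 0 < dd x} := (isOpen_lt continuous_const dd_cont).measurableSet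
  have hm1 : MeasurableSet {x : Fin n → ℝ | dd x ≤ 1 / (16 * n)} := (isClosed_le dd_cont continuous_const).measurableSet
  have hP1m : ∀ i, MeasurableSet (P1 i) := fun i => hm0.inter (hm1.inter (isClosed_eq (continuous_apply i) dd_cont).measurableSet)
  have hP2m : ∀ i, MeasurableSet (P2 i) := fun i => hm0.inter (hm1.inter (isClosed_eq (continuous_const.sub (continuous_apply i)) dd_cont).measurableSet)
  set B := 2 * (C1 * K * Y) + 2 * ((ENNReal.ofReal (8 * n))⁻¹ * X) with hB
  have hb1 : ∀ i, ∫⁻ x in P1 i, sq (F x) R ≤ B := fun i =>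
    hC1 F hF ρ hρ K hL R (P1 i) (hP1m i) i 0 fun x hx => ⟨hx.1, hx.2.1, Or.inl ⟨rfl, hx.2.2⟩⟩
  have hb2 : ∀ i, ∫⁻ x in P2 i, sq (F x) R ≤ B := fun i =>
    hC1 F hF ρ hρ K hL R (P2 i) (hP2m i) i (1 - 8 * n) fun x hx => ⟨hx.1, hx.2.1, Or.inr ⟨rfl, hx.2.2⟩⟩
  have hcov : QQ n ⊆ {x | 1 / (16 * n) ≤ dd x} ∪ ((⋃ i, P1 i) ∪ ⋃ i, P2 i) := by
    intro x hx
    rw [mem_QQ] at hx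
    rcases le_total (1 / (16 * (n:ℝ))) (dd x) with h | h
    · exact Or.inl h
    · right
      obtain ⟨i, hi | hi⟩ := dd_exists x
      · exact Or.inl (mem_iUnion.2 ⟨i, hx, h, hi.symm⟩)
      · exact Or.inr (mem_iUnion.2 ⟨i, hx, h, hi.symm⟩)
  have hmain : X ≤ C2 * K * Y + (n * B + n * B) := by
    calc X ≤ ∫⁻ x in {x | 1 / (16 * n) ≤ dd x} ∪ ((⋃ i, P1 i) ∪ ⋃ i, P2 i), sq (F x) R := lintegral_mono_set hcov
      _ ≤ (∫⁻ x in {x | 1 / (16 * n) ≤ dd x}, sq (F x) R) + ((∫⁻ x in ⋃ i, P1 i, sq (F x) R) + ∫⁻ x in ⋃ i, P2 i, sq (F x) R) :=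
          (lintegral_union_le _ _ _).trans (add_le_add le_rfl (lintegral_union_le _ _ _))
      _ ≤ (∫⁻ x in {x | 1 / (16 * n) ≤ dd x}, sq (F x) R) + ((∑ i, ∫⁻ x in P1 i, sq (F x) R) + ∑ i, ∫⁻ x in P2 i, sq (F x) R) := by
          rw [← tsum_fintype (L := .unconditional _), ← tsum_fintype (L := .unconditional _)]
          gcongr
          · exact lintegral_iUnion_le _ _
          · exact lintegral_iUnion_le _ _
      _ ≤ C2 * K * Y + ((∑ _i : Fin n, B) + ∑ _i : Fin n, B) := by
          gcongr
          · exact hb1 _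
          · exact hb2 _
      _ = _ := by simp
  have hhalf : n * (2 * ((ENNReal.ofReal (8 * n))⁻¹ * X)) + n * (2 * ((ENNReal.ofReal (8 * n))⁻¹ * X)) = X / 2 := by
    have e1 : ENNReal.ofReal (8 * n) = 8 * (n:ENNReal) := by
      rw [ENNReal.ofReal_mul (by norm_num)]; simp
    have hn0 : (n:ENNReal) ≠ 0 := by
      have : 0 < n := Fin.pos_iff_nonempty.2 inferInstance
      exact_mod_cast this.ne'
    have hnt : (n:ENNReal) ≠ ⊤ := by simp
    rw [e1, ENNReal.mul_inv (by simp) (by simp)]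
    have e2 : n * (2 * ((8:ENNReal)⁻¹ * (n:ENNReal)⁻¹ * X)) + n * (2 * ((8:ENNReal)⁻¹ * (n:ENNReal)⁻¹ * X)) = (n * (n:ENNReal)⁻¹) * (4 * 8⁻¹ * X) := by ring
    rw [e2, ENNReal.mul_inv_cancel hn0 hnt, one_mul, ENNReal.div_eq_inv_mul]
    congr 1
    rw [← ENNReal.toReal_eq_toReal_iff' (by finiteness) (by finiteness)]
    simp; norm_num
  have hX2 : X / 2 + X / 2 ≤ (C2 + 4 * n * C1) * K * Y + X / 2 := by
    rw [ENNReal.add_halves]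
    refine hmain.trans (le_of_eq ?_)
    rw [← hhalf, hB]; ring
  have hX3 : X / 2 ≤ (C2 + 4 * n * C1) * K * Y := by
    have : X / 2 ≠ ⊤ := by finiteness
    exact (ENNReal.add_le_add_iff_right this).1 hX2
  calc X = X / 2 + X / 2 := (ENNReal.add_halves X).symm
    _ ≤ (C2 + 4 * n * C1) * K * Y + (C2 + 4 * n * C1) * K * Y := add_le_add hX3 hX3
    _ = _ := by ring

end

end GR

namespace GR
variable {n : ℕ}

lemma dmap_ball (x0 : Fin n → ℝ) {s : ℝ} (hs : 0 < s) (r : ℝ) :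
    dmap (fun _ => s) x0 '' Metric.ball 0 r = Metric.ball x0 (s * r) := by
  have e : ∀ z, dmap (fun _ => s) x0 z = s • z + x0 := fun z => by ext i; simp [dmap]
  ext y; constructor
  · rintro ⟨z, hz, rfl⟩
    rw [e, Metric.mem_ball, dist_eq_norm, add_sub_cancel_right, norm_smul, Real.norm_eq_abs, abs_of_pos hs]
    rw [mem_ball_zero_iff] at hz
    gcongr
  · intro hy
    refine ⟨s⁻¹ • (y - x0), ?_, ?_⟩
    · rw [Metric.mem_ball, dist_eq_norm] at hy
      rw [mem_ball_zero_iff, norm_smul, Real.norm_eq_abs, abs_of_pos (inv_pos.2 hs), inv_mul_lt_iff₀ hs]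
      exact hy
    · rw [e, smul_smul, mul_inv_cancel₀ hs.ne']; simp

lemma DD_scale {u : (Fin n → ℝ) → Fin n → ℝ} (x0 : Fin n → ℝ) {s : ℝ} (hs : 0 < s) (y : Fin n → ℝ)
    (h : DifferentiableAt ℝ u (dmap (fun _ => s) x0 y)) :
    DifferentiableAt ℝ (fun y => s⁻¹ • u (dmap (fun _ => s) x0 y)) y ∧
    DD (fun y => s⁻¹ • u (dmap (fun _ => s) x0 y)) y = DD u (dmap (fun _ => s) x0 y) := by
  have e : dmap (fun _ => s) x0 = fun z => s • z + x0 := by funext z; ext i; simp [dmap]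
  have h1 : HasFDerivAt (dmap (fun _ => s) x0) (s • ContinuousLinearMap.id ℝ (Fin n → ℝ)) y := by
    rw [e]; exact ((hasFDerivAt_id y).const_smul s).add_const x0
  have h2 := (h.hasFDerivAt.comp y h1).const_smul s⁻¹
  have h3 : HasFDerivAt (fun y => s⁻¹ • u (dmap (fun _ => s) x0 y)) _ y := h2
  refine ⟨h3.differentiableAt, ?_⟩
  ext i j
  simp only [DD, Matrix.of_apply]
  rw [h3.fderiv]
  simp [hs.ne']

lemma local_rig (n : ℕ) : ∃ C : ENNReal, C ≠ ⊤ ∧ ∀ (u : (Fin n → ℝ) → Fin n → ℝ) (x0 : Fin n → ℝ) (s : ℝ),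
    0 < s → (∀ x ∈ Metric.ball x0 (s * 30), DifferentiableAt ℝ u x) →
    ∃ R ∈ SOn n, ∫⁻ x in Metric.ball x0 s, sq (DD u x) R ≤ C * ∫⁻ x in Metric.ball x0 (s * 30), ee u x := by
  obtain ⟨C, hC, h⟩ := local_rig0 n
  refine ⟨C, hC, fun u x0 s hs hu => ?_⟩
  have hd : ∀ y ∈ Metric.ball (0 : Fin n → ℝ) 30, DifferentiableAt ℝ u (dmap (fun _ => s) x0 y) := fun y hy =>
    hu _ (by rw [← dmap_ball x0 hs]; exact mem_image_of_mem _ hy)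
  obtain ⟨R, hR, hR2⟩ := h (fun y => s⁻¹ • u (dmap (fun _ => s) x0 y)) fun y hy =>
    (DD_scale x0 hs y (hd y hy)).1
  refine ⟨R, hR, ?_⟩
  have k1 := dmap_ball x0 hs 1
  rw [mul_one] at k1
  rw [← k1, ← dmap_ball x0 hs 30, lint_dmap _ _ (fun _ => hs.ne') _ measurableSet_ball,
    lint_dmap _ _ (fun _ => hs.ne') _ measurableSet_ball, mul_left_comm]
  gcongr
  refine le_of_eq_of_le ?_ (hR2.trans_eq ?_)
  · refine setLIntegral_congr_fun measurableSet_ball fun y hy => ?_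
    rw [(DD_scale x0 hs y (hd y (Metric.ball_subset_ball (by norm_num) hy))).2]
  · congr 1
    refine setLIntegral_congr_fun measurableSet_ball fun y hy => ?_
    simp only [ee]
    rw [(DD_scale x0 hs y (hd y hy)).2]

lemma vol_image_le {f : (Fin n → ℝ) → Fin n → ℝ} {s : Set (Fin n → ℝ)} {K : NNReal}
    (h : LipschitzOnWith K f s) : volume (f '' s) ≤ (K : ENNReal) ^ n * volume s := by
  have := h.hausdorffMeasure_image_le (d := (Fintype.card (Fin n) : ℝ)) (by positivity)
  rw [hausdorffMeasure_pi_real, Fintype.card_fin, ENNReal.rpow_natCast] at this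
  exact this

/-- integral over image bounded by integral over domain -/
lemma lint_image_le {f : (Fin n → ℝ) → Fin n → ℝ} {s : Set (Fin n → ℝ)} {K : NNReal} (hf : Measurable f)
    (hs : MeasurableSet s)
    (h : LipschitzOnWith K f s) {g : (Fin n → ℝ) → ENNReal} (hg : Measurable g) :
    ∫⁻ y in f '' s, g y ≤ (K : ENNReal) ^ n * ∫⁻ x in s, g (f x) := by
  have hle : volume.restrict (f '' s) ≤ ((K : ENNReal) ^ n) • Measure.map f (volume.restrict s) := by
    refine Measure.le_iff.2 fun t ht => ?_
    rw [Measure.restrict_apply ht, Measure.smul_apply, Measure.map_apply hf ht,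
      Measure.restrict_apply (hf ht), smul_eq_mul]
    have e : t ∩ f '' s = f '' (f ⁻¹' t ∩ s) := by rw [inter_comm, ← image_inter_preimage, inter_comm]
    rw [e]
    exact vol_image_le (h.mono inter_subset_right)
  calc _ ≤ ∫⁻ y, g y ∂(((K : ENNReal) ^ n) • Measure.map f (volume.restrict s)) := lintegral_mono' hle le_rfl
    _ = _ := by rw [lintegral_smul_measure, lintegral_map hg hf, smul_eq_mul]

/-- integral over domain bounded by integral over image -/
lemma lint_dom_le {f : (Fin n → ℝ) → Fin n → ℝ} {s : Set (Fin n → ℝ)} {K : NNReal} (hf : Measurable f)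
    (hs : MeasurableSet s)
    (h : ∀ x ∈ s, ∀ y ∈ s, dist x y ≤ K * dist (f x) (f y)) {g : (Fin n → ℝ) → ENNReal} (hg : Measurable g) :
    ∫⁻ x in s, g (f x) ≤ (K : ENNReal) ^ n * ∫⁻ y in f '' s, g y := by
  have hinj : InjOn f s := fun x hx y hy e => by
    have := h x hx y hy
    rw [e, dist_self, mul_zero] at this
    exact dist_le_zero.1 this
  have hle : Measure.map f (volume.restrict s) ≤ ((K : ENNReal) ^ n) • volume.restrict (f '' s) := by
    refine Measure.le_iff.2 fun t ht => ?_
    rw [Measure.smul_apply, Measure.restrict_apply ht, Measure.map_apply hf ht,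
      Measure.restrict_apply (hf ht), smul_eq_mul]
    have e : t ∩ f '' s = f '' (f ⁻¹' t ∩ s) := by rw [inter_comm, ← image_inter_preimage, inter_comm]
    have e2 : (Function.invFunOn f s) '' (f '' (f ⁻¹' t ∩ s)) = f ⁻¹' t ∩ s := by
      rw [hinj.invFunOn_image inter_subset_right]
    rw [e]
    have := vol_image_le (f := Function.invFunOn f s) (s := f '' (f ⁻¹' t ∩ s)) (K := K) ?_
    · rwa [e2] at this
    · refine LipschitzOnWith.of_dist_le_mul ?_
      rintro _ ⟨x, hx, rfl⟩ _ ⟨y, hy, rfl⟩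
      rw [hinj.leftInvOn_invFunOn hx.2, hinj.leftInvOn_invFunOn hy.2]
      exact h x hx.2 y hy.2
  calc _ = ∫⁻ y, g y ∂(Measure.map f (volume.restrict s)) := by rw [lintegral_map hg hf]
    _ ≤ ∫⁻ y, g y ∂(((K : ENNReal) ^ n) • volume.restrict (f '' s)) := lintegral_mono' hle le_rfl
    _ = _ := by rw [lintegral_smul_measure, smul_eq_mul]
end GR

namespace GR
variable {n : ℕ}

lemma image_open [Nonempty (Fin n)] {Φ : (Fin n → ℝ) → Fin n → ℝ} {K : NNReal} (hK : 1 ≤ K) (hΦ : LipschitzWith K Φ)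
    (hlow : ∀ x ∈ QQ n, ∀ y ∈ QQ n, dist x y ≤ K * dist (Φ x) (Φ y)) {z : Fin n → ℝ} (hz : z ∈ QQ n) :
    Metric.closedBall z (dd z / 2) ⊆ QQ n ∧
    Metric.ball (Φ z) ((K : ℝ)⁻¹ * (dd z / 2)) ⊆ Φ '' Metric.closedBall z (dd z / 2) := by
  have hd : 0 < dd z := mem_QQ.1 hz
  have hK0 : (0:ℝ) < K := lt_of_lt_of_le one_pos (by exact_mod_cast hK)
  have h1 : Metric.closedBall z (dd z / 2) ⊆ QQ n :=
    (Metric.closedBall_subset_ball (by linarith)).trans ball_sub_QQ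
  refine ⟨h1, open_bilip (hΦ.lipschitzOnWith) (by linarith) (inv_pos.2 hK0) fun x hx y hy => ?_⟩
  rw [inv_mul_le_iff₀ hK0, ← dist_eq_norm, ← dist_eq_norm]
  exact hlow x (h1 hx) y (h1 hy)

lemma UU_open [Nonempty (Fin n)] {Φ : (Fin n → ℝ) → Fin n → ℝ} {K : NNReal} (hK : 1 ≤ K) (hΦ : LipschitzWith K Φ)
    (hlow : ∀ x ∈ QQ n, ∀ y ∈ QQ n, dist x y ≤ K * dist (Φ x) (Φ y)) : IsOpen (Φ '' QQ n) := by
  rw [Metric.isOpen_iff]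
  rintro _ ⟨z, hz, rfl⟩
  have hd : 0 < dd z := mem_QQ.1 hz
  have hK0 : (0:ℝ) < K := lt_of_lt_of_le one_pos (by exact_mod_cast hK)
  obtain ⟨h1, h2⟩ := image_open hK hΦ hlow hz
  exact ⟨_, by positivity, h2.trans (image_mono h1)⟩

lemma loc_main (n : ℕ) [Nonempty (Fin n)] {K : NNReal} (hK : 1 ≤ K) : ∃ C : ENNReal, C ≠ ⊤ ∧
    ∀ Φ : (Fin n → ℝ) → Fin n → ℝ, LipschitzWith K Φ →
    (∀ x ∈ QQ n, ∀ y ∈ QQ n, dist x y ≤ K * dist (Φ x) (Φ y)) →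
    ∀ u : (Fin n → ℝ) → Fin n → ℝ, DifferentiableOn ℝ u (Φ '' QQ n) →
    LOC (fun x => DD u (Φ x)) (fun x => ee u (Φ x)) (1 / (60 * (K : ℝ) ^ 2)) (3 / 4) C := by
  obtain ⟨C, hC, hloc⟩ := local_rig n
  refine ⟨(K : ENNReal) ^ n * (C * (K : ENNReal) ^ n), ?_, fun Φ hΦ hlow u hu z hz => ?_⟩
  · exact ENNReal.mul_ne_top (by simp) (ENNReal.mul_ne_top hC (by simp))
  have hd : 0 < dd z := mem_QQ.1 hz
  have hK1 : (1:ℝ) ≤ K := by exact_mod_cast hK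
  have hK0 : (0:ℝ) < K := by linarith
  have hm : Measurable Φ := hΦ.continuous.measurable
  obtain ⟨h1, h2⟩ := image_open hK hΦ hlow hz
  have hU := UU_open hK hΦ hlow
  set s : ℝ := (K : ℝ)⁻¹ * (dd z / 2) / 30 with hs
  have hs0 : 0 < s := by positivity
  have hs30 : s * 30 = (K : ℝ)⁻¹ * (dd z / 2) := by rw [hs]; ring
  rw [← hs30] at h2
  obtain ⟨R, hR, hR2⟩ := hloc u (Φ z) s hs0 fun x hx =>
    hu.differentiableAt (hU.mem_nhds (image_mono h1 (h2 hx)))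
  refine ⟨R, hR, ?_⟩
  have ha : 1 / (60 * (K : ℝ) ^ 2) * dd z ≤ dd z := by
    refine mul_le_of_le_one_left hd.le ?_
    rw [div_le_one (by positivity)]; nlinarith
  have hsub : Metric.ball z (1 / (60 * (K : ℝ) ^ 2) * dd z) ⊆ QQ n :=
    (Metric.ball_subset_ball ha).trans ball_sub_QQ
  have hm1 : Measurable fun x => sq (DD u x) R :=
    measurable_sq (G := fun _ => R) (measurable_DD_entry u) fun i j => measurable_const
  calc ∫⁻ y in Metric.ball z (1 / (60 * (K : ℝ) ^ 2) * dd z), sq (DD u (Φ y)) R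
      ≤ (K : ENNReal) ^ n * ∫⁻ y in Φ '' Metric.ball z (1 / (60 * (K : ℝ) ^ 2) * dd z), sq (DD u y) R :=
        lint_dom_le (g := fun y => sq (DD u y) R) hm measurableSet_ball
          (fun x hx y hy => hlow x (hsub hx) y (hsub hy)) hm1
    _ ≤ (K : ENNReal) ^ n * ∫⁻ y in Metric.ball (Φ z) s, sq (DD u y) R := by
        gcongr
        rintro _ ⟨y, hy, rfl⟩
        rw [Metric.mem_ball] at hy ⊢
        refine (hΦ.dist_le_mul y z).trans_lt ((mul_lt_mul_of_pos_left hy hK0).trans_eq ?_)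
        rw [hs]; field_simp; norm_num
    _ ≤ (K : ENNReal) ^ n * (C * ∫⁻ y in Metric.ball (Φ z) (s * 30), ee u y) := by gcongr
    _ ≤ (K : ENNReal) ^ n * (C * ∫⁻ y in Φ '' Metric.closedBall z (dd z / 2), ee u y) := by gcongr
    _ ≤ (K : ENNReal) ^ n * (C * ((K : ENNReal) ^ n * ∫⁻ y in Metric.closedBall z (dd z / 2), ee u (Φ y))) := by
        gcongr
        exact lint_image_le hm measurableSet_closedBall hΦ.lipschitzOnWith (measurable_ee u)
    _ ≤ (K : ENNReal) ^ n * (C * ((K : ENNReal) ^ n * ∫⁻ y in Metric.ball z (3 / 4 * dd z), ee u (Φ y))) := by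
        gcongr
        exact Metric.closedBall_subset_ball (by linarith)
    _ = _ := by ring

lemma main0 (n : ℕ) [Nonempty (Fin n)] {K : NNReal} (hK : 1 ≤ K) : ∃ C : ENNReal, C ≠ ⊤ ∧
    ∀ Φ : (Fin n → ℝ) → Fin n → ℝ, LipschitzWith K Φ →
    (∀ x ∈ QQ n, ∀ y ∈ QQ n, dist x y ≤ K * dist (Φ x) (Φ y)) →
    ∀ u : (Fin n → ℝ) → Fin n → ℝ, DifferentiableOn ℝ u (Φ '' QQ n) →
    ∫⁻ x in Φ '' QQ n, ee u x ≠ ⊤ →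
    ∃ R ∈ SOn n, ∫⁻ x in Φ '' QQ n, sq (DD u x) R ≤ C * ∫⁻ x in Φ '' QQ n, ee u x := by
  have hK1 : (1:ℝ) ≤ K := by exact_mod_cast hK
  have hK0 : (0:ℝ) < K := by linarith
  obtain ⟨C1, hC1, hl⟩ := loc_main n hK
  obtain ⟨C2, hC2, hg⟩ := glob (n := n) (a := 1 / (60 * (K : ℝ) ^ 2)) (b := 3 / 4) (by positivity)
    (by rw [div_le_one (by positivity)]; nlinarith) (by norm_num) (by norm_num)
  refine ⟨(K : ENNReal) ^ n * (C2 * C1 * (K : ENNReal) ^ n), ?_, fun Φ hΦ hlow u hu hfin => ?_⟩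
  · exact ENNReal.mul_ne_top (by simp) (ENNReal.mul_ne_top (ENNReal.mul_ne_top hC2 hC1) (by simp))
  have hm : Measurable Φ := hΦ.continuous.measurable
  have hQ : MeasurableSet (QQ n) := QQ_open.measurableSet
  have hm1 : ∀ R, Measurable fun x => sq (DD u x) R := fun R =>
    measurable_sq (G := fun _ => R) (measurable_DD_entry u) fun i j => measurable_const
  have hfin1 : ∫⁻ x in QQ n, sq (DD u (Φ x)) 1 ≠ ⊤ := by
    have hvU : volume (Φ '' QQ n) ≠ ⊤ :=
      ne_top_of_le_ne_top (ENNReal.mul_ne_top (by simp) vol_QQ_ne_top)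
        (vol_image_le (hΦ.lipschitzOnWith (s := QQ n)))
    refine ne_top_of_le_ne_top ?_ (lint_dom_le (g := fun y => sq (DD u y) 1) hm hQ hlow (hm1 1))
    refine ENNReal.mul_ne_top (by simp) ?_
    have hme : Measurable fun x => 2 * ee u x := (measurable_ee u).const_mul 2
    refine ne_top_of_le_ne_top ?_ (lintegral_mono (g := fun x => 2 * ee u x + ENNReal.ofReal (8 * n ^ 2))
      fun x => sq_one_le (DD u x) 1 one_mem)
    rw [lintegral_add_left hme, lintegral_const_mul _ (measurable_ee u), setLIntegral_const]
    exact ENNReal.add_ne_top.2 ⟨ENNReal.mul_ne_top (by simp) hfin, ENNReal.mul_ne_top ENNReal.ofReal_ne_top hvU⟩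
  obtain ⟨R, hR, hR2⟩ := hg (fun x => DD u (Φ x)) (fun i j => (measurable_DD_entry u i j).comp hm)
    (fun x => ee u (Φ x)) ((measurable_ee u).comp hm) C1 (hl Φ hΦ hlow u hu) hfin1
  refine ⟨R, hR, ?_⟩
  calc _ ≤ (K : ENNReal) ^ n * ∫⁻ x in QQ n, sq (DD u (Φ x)) R :=
        lint_image_le hm hQ hΦ.lipschitzOnWith (hm1 R)
    _ ≤ (K : ENNReal) ^ n * (C2 * C1 * ∫⁻ x in QQ n, ee u (Φ x)) := by gcongr
    _ ≤ (K : ENNReal) ^ n * (C2 * C1 * ((K : ENNReal) ^ n * ∫⁻ x in Φ '' QQ n, ee u x)) := by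
        gcongr
        exact lint_dom_le hm hQ hlow (measurable_ee u)
    _ = _ := by ring

lemma norm_le_enormn (x : Fin n → ℝ) : ‖x‖ ≤ enormn x := by
  refine (pi_norm_le_iff_of_nonneg (Real.sqrt_nonneg _)).2 fun i => ?_
  rw [Real.norm_eq_abs, ← Real.sqrt_sq_eq_abs]
  exact Real.sqrt_le_sqrt (Finset.single_le_sum (f := fun i => x i ^ 2) (fun i _ => sq_nonneg _) (Finset.mem_univ i))

lemma enormn_le_norm (x : Fin n → ℝ) : enormn x ≤ Real.sqrt n * ‖x‖ := by
  rw [enormn, ← Real.sqrt_sq (norm_nonneg x), ← Real.sqrt_mul (by positivity)]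
  refine Real.sqrt_le_sqrt ?_
  calc ∑ i, x i ^ 2 ≤ ∑ i : Fin n, ‖x‖ ^ 2 := Finset.sum_le_sum fun i _ => by
        rw [← sq_abs]; have := norm_le_pi_norm x i; rw [Real.norm_eq_abs] at this; gcongr
    _ = _ := by simp
end GR

namespace GR
variable {n : ℕ}

lemma main1 (n : ℕ) (hn : 2 ≤ n) (M : ℝ) (hM : 1 ≤ M) :
    ∃ C : ℝ, 0 < C ∧
      ∀ Φ : (Fin n → ℝ) → Fin n → ℝ,
        (∀ x ∈ QQ n, ∀ y ∈ QQ n,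
            M⁻¹ * enormn (x - y) ≤ enormn (Φ x - Φ y) ∧
            enormn (Φ x - Φ y) ≤ M * enormn (x - y)) →
        ∀ u : (Fin n → ℝ) → Fin n → ℝ,
          DifferentiableOn ℝ u (Φ '' QQ n) →
          ∃ R ∈ SOn n,
            ∫ x in Φ '' QQ n, frobn (DuMat u (Φ '' QQ n) x - R) ^ 2 ≤
              C * ∫ x in Φ '' QQ n, distSOn (DuMat u (Φ '' QQ n) x) ^ 2 := by
  haveI : Nonempty (Fin n) := ⟨⟨0, by omega⟩⟩
  have hM0 : 0 < M := by linarith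
  have hn1 : 1 ≤ Real.sqrt n := by
    rw [Real.one_le_sqrt]; exact_mod_cast (by omega : 1 ≤ n)
  set K : NNReal := ⟨M * Real.sqrt n, by positivity⟩ with hKd
  have hKc : (K : ℝ) = M * Real.sqrt n := rfl
  have hK : 1 ≤ K := by
    rw [← NNReal.coe_le_coe, hKc, NNReal.coe_one]; nlinarith
  obtain ⟨C, hC, hmain⟩ := main0 n hK
  refine ⟨C.toReal + 1, by positivity, fun Φ0 hΦ0 u hu => ?_⟩
  have hL0 : LipschitzOnWith K Φ0 (QQ n) := LipschitzOnWith.of_dist_le_mul fun x hx y hy => by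
    rw [dist_eq_norm, dist_eq_norm, hKc]
    calc _ ≤ enormn (Φ0 x - Φ0 y) := norm_le_enormn _
      _ ≤ M * enormn (x - y) := (hΦ0 x hx y hy).2
      _ ≤ M * (Real.sqrt n * ‖x - y‖) := by gcongr; exact enormn_le_norm _
      _ = _ := by ring
  obtain ⟨Φ, hΦ, he⟩ := hL0.extend_pi
  have hlow : ∀ x ∈ QQ n, ∀ y ∈ QQ n, dist x y ≤ K * dist (Φ x) (Φ y) := fun x hx y hy => by
    rw [dist_eq_norm, dist_eq_norm, hKc, ← he hx, ← he hy]
    have h1 := (hΦ0 x hx y hy).1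
    rw [inv_mul_le_iff₀ hM0] at h1
    calc _ ≤ enormn (x - y) := norm_le_enormn _
      _ ≤ M * enormn (Φ0 x - Φ0 y) := h1
      _ ≤ M * (Real.sqrt n * ‖Φ0 x - Φ0 y‖) := by gcongr; exact enormn_le_norm _
      _ = _ := by ring
  rw [image_congr he] at hu ⊢
  have hU := UU_open hK hΦ hlow
  set U := Φ '' QQ n with hUd
  have hD : ∀ x ∈ U, DuMat u U x = DD u x := fun x hx => by
    simp only [DuMat, DD, fderivWithin_of_isOpen hU hx]
  have e1 : ∀ R, ∫ x in U, frobn (DuMat u U x - R) ^ 2 = (∫⁻ x in U, sq (DD u x) R).toReal := fun R => by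
    rw [setIntegral_congr_fun (g := fun x => frobn (DD u x - R) ^ 2) hU.measurableSet
      fun x hx => by simp only [hD x hx]]
    rw [integral_eq_lintegral_of_nonneg_ae]
    · rfl
    · exact Filter.Eventually.of_forall fun x => sq_nonneg _
    · refine Measurable.aestronglyMeasurable ?_
      exact measurable_comp_mat (g := fun F => frobn (F - R) ^ 2) (measurable_DD_entry u)
        ((continuous_frobn.comp (continuous_id.sub continuous_const)).pow 2)
  have e2 : ∫ x in U, distSOn (DuMat u U x) ^ 2 = (∫⁻ x in U, ee u x).toReal := by
    rw [setIntegral_congr_fun (g := fun x => distSOn (DD u x) ^ 2) hU.measurableSet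
      fun x hx => by simp only [hD x hx]]
    rw [integral_eq_lintegral_of_nonneg_ae]
    · rfl
    · exact Filter.Eventually.of_forall fun x => sq_nonneg _
    · refine Measurable.aestronglyMeasurable ?_
      exact measurable_comp_mat (g := fun F => distSOn F ^ 2) (measurable_DD_entry u)
        (continuous_dist.pow 2)
  by_cases hfin : ∫⁻ x in U, ee u x = ⊤
  · refine ⟨1, one_mem, ?_⟩
    have : ∫⁻ x in U, sq (DD u x) 1 = ⊤ := by
      refine top_le_iff.1 (hfin ▸ lintegral_mono fun x => ?_)
      refine ENNReal.ofReal_le_ofReal ?_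
      exact pow_le_pow_left₀ (dist_nonneg _) (dist_le _ one_mem) 2
    rw [e1, e2, this, hfin]; simp
  · obtain ⟨R, hR, hR2⟩ := hmain Φ hΦ hlow u hu hfin
    refine ⟨R, hR, ?_⟩
    rw [e1, e2]
    have h3 := ENNReal.toReal_mono (ENNReal.mul_ne_top hC hfin) hR2
    rw [ENNReal.toReal_mul] at h3
    have h4 : 0 ≤ (∫⁻ x in U, ee u x).toReal := ENNReal.toReal_nonneg
    linarith
end GR

/-- Geometric rigidity with a constant that is uniform over bilipschitz images of the
unit cube with uniform bilipschitz constants. -/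
theorem geometric_rigidity_uniform (n : ℕ) (hn : 2 ≤ n) (M : ℝ) (hM : 1 ≤ M) :
    ∃ C : ℝ, 0 < C ∧
      ∀ Φ : (Fin n → ℝ) → Fin n → ℝ,
        (∀ x ∈ {x : Fin n → ℝ | ∀ i, x i ∈ Ioo (0:ℝ) 1},
         ∀ y ∈ {x : Fin n → ℝ | ∀ i, x i ∈ Ioo (0:ℝ) 1},
            M⁻¹ * enormn (x - y) ≤ enormn (Φ x - Φ y) ∧
            enormn (Φ x - Φ y) ≤ M * enormn (x - y)) →
        ∀ u : (Fin n → ℝ) → Fin n → ℝ,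
          DifferentiableOn ℝ u (Φ '' {x : Fin n → ℝ | ∀ i, x i ∈ Ioo (0:ℝ) 1}) →
          ∃ R ∈ SOn n,
            ∫ x in Φ '' {x : Fin n → ℝ | ∀ i, x i ∈ Ioo (0:ℝ) 1},
                frobn (DuMat u (Φ '' {x : Fin n → ℝ | ∀ i, x i ∈ Ioo (0:ℝ) 1}) x - R) ^ 2 ≤
              C * ∫ x in Φ '' {x : Fin n → ℝ | ∀ i, x i ∈ Ioo (0:ℝ) 1},
                distSOn (DuMat u (Φ '' {x : Fin n → ℝ | ∀ i, x i ∈ Ioo (0:ℝ) 1}) x) ^ 2 := GR.main1 n hn M hM
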